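/- The graded ring M^{(g)}_• of scalar-valued Siegel modular forms of genus g is algebraically closed inside the graded ring FM^{(g)}_• of symmetric formal Fourier-Jacobi series of cogenus 1; that is, any element of FM^{(g)}_• satisfying a nonzero polynomial relation with coefficients in M^{(g)}_• already lies in M^{(g)}_•. -/

import Mathlib

/-!
STATEMENT 16: The graded ring M^{(g)}_• of scalar-valued Siegel modular forms of
genus g is algebraically closed inside the graded ring FM^{(g)}_• of symmetric
formal Fourier-Jacobi series of cogenus 1; that is, any element of FM^{(g)}_•
satisfying a nonzero polynomial relation with coefficients in M^{(g)}_• already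
lies in M^{(g)}_•.

A symmetric formal Fourier-Jacobi series of weight k is encoded by its family of
formal Fourier coefficients `c : MatQ g → ℂ` (see `IsSymFM` below); a Siegel
modular form embeds into FM^{(g)}_• via its Fourier coefficients, and products of
formal series correspond to convolutions (`convC`, `powC`) of coefficient
families.  A homogeneous element of FM^{(g)}_• of weight k satisfying a nonzero
polynomial relation Σᵢ aᵢ fⁱ = 0 with homogeneous coefficients
aᵢ ∈ M^{(g)}_{k₀+(d−i)k} is the Fourier expansion of a Siegel modular form of
weight k.  Here `g = h + 1` with `h ≥ 1`.
-/

noncomputable section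
open Complex Matrix

attribute [local instance] Matrix.normedAddCommGroup Matrix.normedSpace

/-- Square complex matrices of size `g`. -/
abbrev MatC (g : ℕ) := Matrix (Fin g) (Fin g) ℂ
/-- Square rational matrices of size `g`. -/
abbrev MatQ (g : ℕ) := Matrix (Fin g) (Fin g) ℚ

/-- The Siegel upper half space of genus `g`: symmetric complex matrices with
positive definite imaginary part. -/
def Sieg (g : ℕ) : Set (MatC g) :=
  {τ | τ.IsSymm ∧ (τ.map Complex.im).PosDef}

/-- The standard symplectic form. -/
def sympJ (g : ℕ) : Matrix (Fin g ⊕ Fin g) (Fin g ⊕ Fin g) ℤ :=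
  Matrix.fromBlocks 0 1 (-1) 0

/-- The integral symplectic group `Sp_{2g}(ℤ)` (as a set of integral matrices). -/
def SpZ (g : ℕ) : Set (Matrix (Fin g ⊕ Fin g) (Fin g ⊕ Fin g) ℤ) :=
  {γ | γᵀ * sympJ g * γ = sympJ g}

variable {g : ℕ}

/-- Block `a` of a symplectic matrix, as a complex matrix. -/
def blkA (γ : Matrix (Fin g ⊕ Fin g) (Fin g ⊕ Fin g) ℤ) : MatC g :=
  Matrix.of fun i j => ((γ (Sum.inl i) (Sum.inl j) : ℤ) : ℂ)
/-- Block `b`. -/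
def blkB (γ : Matrix (Fin g ⊕ Fin g) (Fin g ⊕ Fin g) ℤ) : MatC g :=
  Matrix.of fun i j => ((γ (Sum.inl i) (Sum.inr j) : ℤ) : ℂ)
/-- Block `c`. -/
def blkC (γ : Matrix (Fin g ⊕ Fin g) (Fin g ⊕ Fin g) ℤ) : MatC g :=
  Matrix.of fun i j => ((γ (Sum.inr i) (Sum.inl j) : ℤ) : ℂ)
/-- Block `d`. -/
def blkD (γ : Matrix (Fin g ⊕ Fin g) (Fin g ⊕ Fin g) ℤ) : MatC g :=
  Matrix.of fun i j => ((γ (Sum.inr i) (Sum.inr j) : ℤ) : ℂ)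

/-- The matrix `c τ + d`. -/
def jmat (γ : Matrix (Fin g ⊕ Fin g) (Fin g ⊕ Fin g) ℤ) (τ : MatC g) : MatC g :=
  blkC γ * τ + blkD γ

/-- The factor of automorphy `det (c τ + d)`. -/
def jden (γ : Matrix (Fin g ⊕ Fin g) (Fin g ⊕ Fin g) ℤ) (τ : MatC g) : ℂ :=
  (jmat γ τ).det

/-- The action `τ ↦ (a τ + b)(c τ + d)⁻¹` of `Sp_{2g}` on the Siegel upper half
space. -/
def actSp (γ : Matrix (Fin g ⊕ Fin g) (Fin g ⊕ Fin g) ℤ) (τ : MatC g) : MatC g :=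
  (blkA γ * τ + blkB γ) * (jmat γ τ)⁻¹

/-- A rational symmetric matrix is half-integral if its off-diagonal entries lie in
`½ℤ` and its diagonal entries are integers. -/
def HalfIntegral (t : MatQ g) : Prop :=
  t.IsSymm ∧ (∀ i j, ∃ z : ℤ, 2 * t i j = z) ∧ (∀ i, ∃ z : ℤ, t i i = z)

/-- Positive semi-definiteness for rational symmetric matrices. -/
def PosSemidefQ (t : MatQ g) : Prop :=
  ∀ v : Fin g → ℚ, 0 ≤ v ⬝ᵥ t.mulVec v

/-- `t` represents the rational number `q` if `q = ᵀv t v` for some `v ∈ ℤ^g`. -/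
def RepresentsQ (t : MatQ g) (q : ℚ) : Prop :=
  ∃ v : Fin g → ℤ, (fun i => (v i : ℚ)) ⬝ᵥ t.mulVec (fun i => (v i : ℚ)) = q

/-- `e(tτ) = exp(2πi · tr(tτ))`. -/
def eMat (t : MatQ g) (τ : MatC g) : ℂ :=
  Complex.exp (2 * (Real.pi : ℂ) * Complex.I * ((t.map fun q => (q : ℂ)) * τ).trace)

/-- A (scalar-valued, classical) Siegel modular form of genus `g` and weight `k`
for the full symplectic group `Sp_{2g}(ℤ)`, bundled with its Fourier expansion:
a holomorphic function on the Siegel upper half space transforming with the factor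
of automorphy `det(cτ+d)^k`, whose Fourier expansion is supported on half-integral
positive semi-definite matrices. -/
structure SiegelMF (g : ℕ) (k : ℤ) where
  toFun : MatC g → ℂ
  coeff : MatQ g → ℂ
  holo : DifferentiableOn ℂ toFun (Sieg g)
  transf : ∀ γ ∈ SpZ g, ∀ τ ∈ Sieg g, toFun (actSp γ τ) = jden γ τ ^ k * toFun τ
  supp : ∀ t, coeff t ≠ 0 → HalfIntegral t ∧ PosSemidefQ t
  expansion : ∀ τ ∈ Sieg g, HasSum (fun t => coeff t * eMat t τ) (toFun τ)

/-- A Siegel modular form is nonzero if it is nonzero somewhere on the Siegel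
upper half space. -/
def SiegelMF.Nonzero {k : ℤ} (f : SiegelMF g k) : Prop :=
  ∃ τ ∈ Sieg g, f.toFun τ ≠ 0

/-- The vanishing order of a Siegel modular form: the infimum of all rationals
represented by some index matrix `t` with nonvanishing Fourier coefficient. -/
def SiegelMF.ord {k : ℤ} (f : SiegelMF g k) : ℝ :=
  sInf {r : ℝ | ∃ t q, f.coeff t ≠ 0 ∧ RepresentsQ t q ∧ (q : ℝ) = r}

/-- `Mat_{h,l}(ℂ)`. -/
abbrev MatRC (h l : ℕ) := Matrix (Fin h) (Fin l) ℂ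
/-- `Mat_{h,l}(ℚ)`. -/
abbrev MatRQ (h l : ℕ) := Matrix (Fin h) (Fin l) ℚ

/-- The block matrix `(n, r/2; ᵀr/2, m)` of size `h + l`. -/
def blkQ (h l : ℕ) (n : MatQ h) (r : MatRQ h l) (m : MatQ l) : MatQ (h + l) :=
  Matrix.reindex finSumFinEquiv finSumFinEquiv
    (Matrix.fromBlocks n ((1 / 2 : ℚ) • r) ((1 / 2 : ℚ) • rᵀ) m)

/-- A (Siegel-) Jacobi form of genus `h`, cogenus `l`, weight `k` and (matrix)
index `m`, bundled with its Fourier expansion: a holomorphic function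
`φ(τ, z)` on `ℍ_h × Mat_{h,l}(ℂ)` satisfying the transformation laws of Jacobi
forms under `Sp_{2h}(ℤ)` and under the lattice translations
`z ↦ z + τλ + μ`, whose Fourier coefficients `c(φ; n, r)` are supported on pairs
for which the block matrix `(n, r/2; ᵀr/2, m)` is half-integral positive
semi-definite. -/
structure JacobiF (h l : ℕ) (k : ℤ) (m : MatQ l) where
  toFun : MatC h × MatRC h l → ℂ
  coeff : MatQ h × MatRQ h l → ℂ
  holo : DifferentiableOn ℂ toFun (Sieg h ×ˢ (Set.univ : Set (MatRC h l)))
  transfSp : ∀ γ ∈ SpZ h, ∀ p : MatC h × MatRC h l, p.1 ∈ Sieg h →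
    toFun (actSp γ p.1, ((jmat γ p.1)⁻¹)ᵀ * p.2)
      = jden γ p.1 ^ k *
        Complex.exp (2 * (Real.pi : ℂ) * Complex.I *
          ((m.map fun q => (q : ℂ)) *
            (p.2ᵀ * ((jmat γ p.1)⁻¹ * (blkC γ * p.2)))).trace) *
        toFun p
  transfEll : ∀ lam mu : Matrix (Fin h) (Fin l) ℤ, ∀ p : MatC h × MatRC h l,
    p.1 ∈ Sieg h →
    toFun (p.1, p.2 + p.1 * (lam.map fun z => (z : ℂ)) + (mu.map fun z => (z : ℂ)))
      = Complex.exp (-(2 * (Real.pi : ℂ) * Complex.I) *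
          ((m.map fun q => (q : ℂ)) *
            ((lam.map fun z => (z : ℂ))ᵀ * p.1 * (lam.map fun z => (z : ℂ))
              + (2 : ℂ) • ((lam.map fun z => (z : ℂ))ᵀ * p.2))).trace) *
        toFun p
  supp : ∀ nr : MatQ h × MatRQ h l, coeff nr ≠ 0 →
    HalfIntegral (blkQ h l nr.1 nr.2 m) ∧ PosSemidefQ (blkQ h l nr.1 nr.2 m)
  expansion : ∀ p : MatC h × MatRC h l, p.1 ∈ Sieg h →
    HasSum (fun nr : MatQ h × MatRQ h l => coeff nr *
      Complex.exp (2 * (Real.pi : ℂ) * Complex.I *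
        (((nr.1.map fun q => (q : ℂ)) * p.1).trace
          + ((nr.2.map fun q => (q : ℂ))ᵀ * p.2).trace)))
      (toFun p)

/-- The index-`m` Fourier-Jacobi slice of a genus-`(h+l)` family of Fourier
coefficients: `(n, r) ↦ c (n, r/2; ᵀr/2, m)`. -/
def sliceCoeff (h l : ℕ) (c : MatQ (h + l) → ℂ) (m : MatQ l) :
    MatQ h × MatRQ h l → ℂ :=
  fun nr => c (blkQ h l nr.1 nr.2 m)

/-- `c` is (the family of formal Fourier coefficients of) a symmetric formal
Fourier-Jacobi series of genus `h + l`, cogenus `l` and weight `k`: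
the coefficients are supported on half-integral positive semi-definite matrices,
they satisfy the `GL_{h+l}(ℤ)`-symmetry `c(t) = det(u)^k·c(ᵀu t u)`, and for every
half-integral positive semi-definite index `m` the `m`-th Fourier-Jacobi slice of
`c` is the system of Fourier coefficients of a (convergent, holomorphic) Jacobi
form of genus `h`, weight `k` and index `m`. -/
def IsSymFM (h l : ℕ) (k : ℤ) (c : MatQ (h + l) → ℂ) : Prop :=
  (∀ t, c t ≠ 0 → HalfIntegral t ∧ PosSemidefQ t) ∧
  (∀ u : Matrix (Fin (h + l)) (Fin (h + l)) ℤ, IsUnit u.det → ∀ t,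
    c t = ((u.det : ℚ) : ℂ) ^ k *
      c ((u.map fun z => (z : ℚ))ᵀ * t * (u.map fun z => (z : ℚ)))) ∧
  (∀ m : MatQ l, HalfIntegral m → PosSemidefQ m →
    ∃ φ : JacobiF h l k m, φ.coeff = sliceCoeff h l c m)

/-- The convolution (Cauchy) product of two families of Fourier coefficients,
corresponding to the product of the associated (formal) series. -/
noncomputable def convC {g : ℕ} (c c' : MatQ g → ℂ) : MatQ g → ℂ :=
  fun t => ∑ᶠ s : MatQ g, c s * c' (t - s)

/-- Convolution powers `c^i`; `c^0` is the coefficient family of the constant `1`. -/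
noncomputable def powC {g : ℕ} (c : MatQ g → ℂ) : ℕ → (MatQ g → ℂ)
  | 0 => fun t => if t = 0 then 1 else 0
  | i + 1 => convC c (powC c i)

open scoped MatrixOrder in
/-- A positive semi-definite real matrix is a Gram matrix. -/
lemma exists_gram {n : ℕ} {M : Matrix (Fin n) (Fin n) ℝ} (hM : M.PosSemidef) :
    ∃ B : Matrix (Fin n) (Fin n) ℝ, M = Bᵀ * B := by
  obtain ⟨B, hB⟩ := CStarAlgebra.nonneg_iff_eq_star_mul_self.mp hM.nonneg
  exact ⟨B, by rw [hB, star_eq_conjTranspose, conjTranspose_eq_transpose_of_trivial]⟩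

/-- Square real matrices of size `g`. -/
abbrev MatR (g : ℕ) := Matrix (Fin g) (Fin g) ℝ

/-- The quadratic form attached to a real matrix. -/
def qf (M : MatR g) (x : Fin g → ℝ) : ℝ := x ⬝ᵥ M *ᵥ x

/-- The trace pairing `tr(tY)` of a rational and a real matrix. -/
def trQ (t : MatQ g) (Y : MatR g) : ℝ := ((t.map fun q => (q : ℝ)) * Y).trace

/-- Half-integral positive semi-definite index matrices. -/
def IsIndex (t : MatQ g) : Prop := HalfIntegral t ∧ PosSemidefQ t

/-- The matrices `Y` at which the series `∑ b(t) e(tτ)` converges absolutely for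
`Im τ = Y`. -/
def Om (b : MatQ g → ℂ) : Set (MatR g) :=
  {Y | Summable fun t => ‖b t‖ * Real.exp (-(2 * Real.pi * trQ t Y))}

/-- The Fourier series with coefficients `b`. -/
def ser (b : MatQ g → ℂ) (τ : MatC g) : ℂ := ∑' t, b t * eMat t τ

/-- The entrywise imaginary part. -/
def imM (τ : MatC g) : MatR g := τ.map Complex.im

lemma qf_eq_sum (M : MatR g) (x : Fin g → ℝ) : qf M x = ∑ i, ∑ j, x i * M i j * x j := by
  simp [qf, dotProduct, mulVec, Finset.mul_sum, mul_assoc]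

lemma qf_add (M N : MatR g) (x : Fin g → ℝ) : qf (M + N) x = qf M x + qf N x := by
  simp [qf, add_mulVec]

lemma qf_sub (M N : MatR g) (x : Fin g → ℝ) : qf (M - N) x = qf M x - qf N x := by
  simp [qf, sub_mulVec]

lemma qf_smul (a : ℝ) (M : MatR g) (x : Fin g → ℝ) : qf (a • M) x = a * qf M x := by
  simp [qf, smul_mulVec]

lemma qf_smul_right (a : ℝ) (M : MatR g) (x : Fin g → ℝ) :
    qf M (a • x) = a ^ 2 * qf M x := by
  simp [qf, mulVec_smul]; ring

lemma qf_one (x : Fin g → ℝ) : qf (1 : MatR g) x = x ⬝ᵥ x := by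
  simp [qf]

lemma qf_conj (u M : MatR g) (x : Fin g → ℝ) : qf (u * M * uᵀ) x = qf M (uᵀ *ᵥ x) := by
  unfold qf
  rw [mul_assoc, ← mulVec_mulVec, ← mulVec_mulVec, dotProduct_mulVec x u, ← mulVec_transpose]

lemma qf_continuous (M : MatR g) : Continuous fun x => qf M x := by
  simp only [qf_eq_sum]
  fun_prop

lemma dotProduct_self_nonneg_real (x : Fin g → ℝ) : 0 ≤ x ⬝ᵥ x :=
  Finset.sum_nonneg fun _ _ => mul_self_nonneg _

lemma dotProduct_self_pos_real {x : Fin g → ℝ} (hx : x ≠ 0) : 0 < x ⬝ᵥ x :=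
  lt_of_le_of_ne (dotProduct_self_nonneg_real x) fun h => hx (dotProduct_self_eq_zero.mp h.symm)

lemma sq_le_dotProduct_self (x : Fin g → ℝ) (i : Fin g) : x i ^ 2 ≤ x ⬝ᵥ x := by
  rw [sq]
  exact Finset.single_le_sum (f := fun i => x i * x i) (fun i _ => mul_self_nonneg _)
    (Finset.mem_univ i)

lemma abs_qf_le (M : MatR g) (x : Fin g → ℝ) : |qf M x| ≤ (g : ℝ) ^ 2 * ‖M‖ * (x ⬝ᵥ x) := by
  rw [qf_eq_sum]
  calc |∑ i, ∑ j, x i * M i j * x j| ≤ ∑ i : Fin g, ∑ j : Fin g, ‖M‖ * (x ⬝ᵥ x) := by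
        refine (Finset.abs_sum_le_sum_abs _ _).trans (Finset.sum_le_sum fun i _ => ?_)
        refine (Finset.abs_sum_le_sum_abs _ _).trans (Finset.sum_le_sum fun j _ => ?_)
        have h1 : |M i j| ≤ ‖M‖ := Matrix.norm_entry_le_entrywise_sup_norm M
        have h2 : |x i| * |x j| ≤ x ⬝ᵥ x := by
          have := sq_le_dotProduct_self x i
          have := sq_le_dotProduct_self x j
          nlinarith [sq_nonneg (|x i| - |x j|), sq_abs (x i), sq_abs (x j)]
        rw [abs_mul, abs_mul]
        calc |x i| * |M i j| * |x j| = |M i j| * (|x i| * |x j|) := by ring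
          _ ≤ _ := mul_le_mul h1 h2 (by positivity) (norm_nonneg _)
    _ = _ := by simp; ring

lemma real_psd_of_rat {t : MatQ g} (ht : PosSemidefQ t) (x : Fin g → ℝ) :
    0 ≤ qf (t.map fun q => (q : ℝ)) x := by
  have hd : DenseRange (fun v : Fin g → ℚ => fun i => (v i : ℝ)) :=
    DenseRange.piMap fun _ => Rat.denseRange_cast
  refine isClosed_property hd (isClosed_le continuous_const (qf_continuous _)) (fun v => ?_) x
  have := ht v
  rw [qf_eq_sum]
  have h2 : (∑ i, ∑ j, (v i : ℝ) * (t.map fun q => (q : ℝ)) i j * v j)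
      = ((v ⬝ᵥ t.mulVec v : ℚ) : ℝ) := by
    simp [dotProduct, mulVec, Finset.mul_sum, mul_assoc]
  rw [h2]; exact_mod_cast this

lemma real_posSemidef_of_rat {t : MatQ g} (hs : t.IsSymm) (ht : PosSemidefQ t) :
    (t.map fun q => (q : ℝ)).PosSemidef := by
  refine PosSemidef.of_dotProduct_mulVec_nonneg ?_ fun x => by
    simpa [qf] using real_psd_of_rat ht x
  ext i j
  simp [hs.apply i j]

lemma trQ_nonneg {t : MatQ g} (hs : t.IsSymm) (ht : PosSemidefQ t) {E : MatR g}
    (hE : ∀ x, 0 ≤ qf E x) : 0 ≤ trQ t E := by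
  obtain ⟨B, hB⟩ := exists_gram (real_posSemidef_of_rat hs ht)
  rw [trQ, hB, mul_assoc, trace_mul_comm, trace]
  refine Finset.sum_nonneg fun i _ => ?_
  have := hE (B i)
  rw [qf_eq_sum] at this
  simp only [diag_apply, mul_apply, transpose_apply, Finset.sum_mul]
  rw [Finset.sum_comm]
  exact this

lemma trQ_eq_sum (t : MatQ g) (Y : MatR g) : trQ t Y = ∑ i, ∑ j, (t i j : ℝ) * Y j i := by
  simp [trQ, trace, mul_apply]

lemma trQ_add (t : MatQ g) (Y Z : MatR g) : trQ t (Y + Z) = trQ t Y + trQ t Z := by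
  simp [trQ, mul_add]

lemma trQ_sub (t : MatQ g) (Y Z : MatR g) : trQ t (Y - Z) = trQ t Y - trQ t Z := by
  simp [trQ, mul_sub]

lemma trQ_smul (t : MatQ g) (a : ℝ) (Y : MatR g) : trQ t (a • Y) = a * trQ t Y := by
  simp [trQ]

lemma trQ_one (t : MatQ g) : trQ t 1 = ((t.trace : ℚ) : ℝ) := by
  simp [trQ, trace]

/-- A positive definite real quadratic form dominates a multiple of the standard one. -/
lemma exists_pos_lower_bound {M : MatR g} (hM : ∀ x, x ≠ 0 → 0 < qf M x) :
    ∃ ε > 0, ∀ x, ε * (x ⬝ᵥ x) ≤ qf M x := by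
  have hcpt : IsCompact {x : Fin g → ℝ | x ⬝ᵥ x = 1} := by
    refine Metric.isCompact_of_isClosed_isBounded ?_ ?_
    · exact isClosed_eq (by unfold dotProduct; fun_prop) continuous_const
    · refine (Metric.isBounded_iff_subset_closedBall 0).mpr ⟨1, fun x hx => ?_⟩
      rw [mem_closedBall_zero_iff, pi_norm_le_iff_of_nonneg zero_le_one]
      intro i
      have h1 := sq_le_dotProduct_self x i
      rw [hx] at h1
      rw [Real.norm_eq_abs]
      exact (sq_le_one_iff_abs_le_one _).mp h1
  rcases Set.eq_empty_or_nonempty {x : Fin g → ℝ | x ⬝ᵥ x = 1} with he | hne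
  · refine ⟨1, one_pos, fun x => ?_⟩
    by_cases hx : x = 0
    · simp [hx, qf]
    · exfalso
      have hp := dotProduct_self_pos_real hx
      have : (Real.sqrt (x ⬝ᵥ x))⁻¹ • x ∈ {x : Fin g → ℝ | x ⬝ᵥ x = 1} := by
        have := Real.mul_self_sqrt hp.le
        have h3 : Real.sqrt (x ⬝ᵥ x) ≠ 0 := (Real.sqrt_pos.mpr hp).ne'
        simp only [Set.mem_ofPred_eq, smul_dotProduct, dotProduct_smul, smul_eq_mul]
        field_simp
        rw [sq, this]
      rw [he] at this
      exact this
  · obtain ⟨x0, hx0, hmin⟩ := hcpt.exists_isMinOn hne (qf_continuous M).continuousOn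
    have hx0' : x0 ≠ 0 := by
      rintro rfl
      simp at hx0
    refine ⟨qf M x0, hM x0 hx0', fun x => ?_⟩
    by_cases hx : x = 0
    · simp [hx, qf]
    · have hp := dotProduct_self_pos_real hx
      have h2 := Real.mul_self_sqrt hp.le
      have h3 : Real.sqrt (x ⬝ᵥ x) ≠ 0 := (Real.sqrt_pos.mpr hp).ne'
      have hmem : (Real.sqrt (x ⬝ᵥ x))⁻¹ • x ∈ {x : Fin g → ℝ | x ⬝ᵥ x = 1} := by
        simp only [Set.mem_ofPred_eq, smul_dotProduct, dotProduct_smul, smul_eq_mul]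
        field_simp
        rw [sq, h2]
      have h4 := hmin hmem
      simp only [Set.mem_ofPred_eq] at h4
      rw [qf_smul_right, inv_pow, Real.sq_sqrt hp.le] at h4
      calc qf M x0 * (x ⬝ᵥ x) ≤ (x ⬝ᵥ x)⁻¹ * qf M x * (x ⬝ᵥ x) :=
            mul_le_mul_of_nonneg_right h4 hp.le
        _ = _ := by field_simp

lemma IsIndex.diag_nonneg {t : MatQ g} (ht : IsIndex t) (i : Fin g) : 0 ≤ t i i := by
  simpa using ht.2 (Pi.single i 1)

lemma IsIndex.abs_le {t : MatQ g} (ht : IsIndex t) (i j : Fin g) :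
    |2 * t i j| ≤ t i i + t j j := by
  have hs : t j i = t i j := ht.1.1.apply i j
  have h1 := ht.2 (Pi.single i 1 + Pi.single j 1)
  have h2 := ht.2 (Pi.single i 1 - Pi.single j 1)
  simp [mulVec_add, mulVec_sub] at h1 h2
  rw [_root_.abs_le]
  constructor <;> linarith

lemma IsIndex.abs_le_trace {t : MatQ g} (ht : IsIndex t) (i j : Fin g) :
    |t i j| ≤ t.trace := by
  have h1 := ht.abs_le i j
  have hd : ∀ i, t i i ≤ t.trace := fun i =>
    Finset.single_le_sum (f := fun i => t i i) (fun i _ => ht.diag_nonneg i) (Finset.mem_univ i)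
  rw [abs_mul, abs_two] at h1
  linarith [hd i, hd j]

lemma IsIndex.add {s t : MatQ g} (hs : IsIndex s) (ht : IsIndex t) : IsIndex (s + t) := by
  refine ⟨⟨hs.1.1.add ht.1.1, fun i j => ?_, fun i => ?_⟩, fun v => ?_⟩
  · obtain ⟨a, ha⟩ := hs.1.2.1 i j
    obtain ⟨b, hb⟩ := ht.1.2.1 i j
    exact ⟨a + b, by push_cast; rw [← ha, ← hb, Matrix.add_apply]; ring⟩
  · obtain ⟨a, ha⟩ := hs.1.2.2 i
    obtain ⟨b, hb⟩ := ht.1.2.2 i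
    exact ⟨a + b, by push_cast; rw [← ha, ← hb, Matrix.add_apply]⟩
  · rw [add_mulVec, dotProduct_add]
    exact add_nonneg (hs.2 v) (ht.2 v)

lemma isIndex_zero : IsIndex (0 : MatQ g) :=
  ⟨⟨by simp [IsSymm], fun _ _ => ⟨0, by simp⟩, fun _ => ⟨0, by simp⟩⟩, fun v => by simp⟩

/-- The integral matrix `2t` of a half-integral matrix `t`. -/
def twice (t : MatQ g) : Fin g × Fin g → ℤ := fun p => ⌊2 * t p.1 p.2⌋

lemma twice_spec {t : MatQ g} (ht : HalfIntegral t) (p : Fin g × Fin g) :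
    ((twice t p : ℤ) : ℚ) = 2 * t p.1 p.2 := by
  obtain ⟨z, hz⟩ := ht.2.1 p.1 p.2
  simp [twice, hz]

lemma twice_injOn : Set.InjOn (twice (g := g)) {t | HalfIntegral t} := by
  intro s hs t ht h
  ext i j
  have h1 := twice_spec hs (i, j)
  have h2 := twice_spec ht (i, j)
  rw [h, h2] at h1
  simpa using h1.symm

lemma finite_index_le (t : MatQ g) : {s : MatQ g | IsIndex s ∧ IsIndex (t - s)}.Finite := by
  set N : ℤ := ⌈t.trace⌉ * 2
  refine Set.Finite.of_finite_image (f := twice) ?_ (twice_injOn.mono fun s hs => hs.1.1)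
  refine (Set.Finite.pi' (t := fun _ : Fin g × Fin g => Set.Icc (-N) N)
    fun _ => Set.finite_Icc _ _).subset ?_
  rintro _ ⟨s, ⟨hs, hts⟩, rfl⟩ p
  have h1 := hs.abs_le_trace p.1 p.2
  have h2 : s.trace ≤ t.trace := by
    have : 0 ≤ (t - s).trace := Finset.sum_nonneg fun i _ => hts.diag_nonneg i
    rw [trace_sub] at this
    linarith
  have h3 := twice_spec hs.1 p
  have h4 : t.trace ≤ (⌈t.trace⌉ : ℚ) := Int.le_ceil _
  have h5 : |((twice s p : ℤ) : ℚ)| ≤ (N : ℚ) := by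
    rw [h3, abs_mul, abs_two]
    push_cast [N]
    linarith
  rw [Set.mem_Icc, ← abs_le]
  exact_mod_cast h5

lemma summable_prod_pow_abs {ρ : ℝ} (h0 : 0 ≤ ρ) (h1 : ρ < 1) (n : ℕ) :
    Summable fun v : Fin n → ℤ => ∏ i, ρ ^ (v i).natAbs := by
  induction n with
  | zero => exact Summable.of_finite
  | succ n ih =>
    have hZ : Summable fun z : ℤ => ρ ^ z.natAbs := by
      refine Summable.of_nat_of_neg ?_ ?_ <;>
        simpa using summable_geometric_of_lt_one h0 h1
    have := hZ.mul_of_nonneg ih (fun z => by positivity)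
      (fun v => Finset.prod_nonneg fun i _ => by positivity)
    refine (Equiv.summable_iff (Fin.consEquiv fun _ : Fin (n + 1) => ℤ)).mp (this.congr fun p => ?_)
    simp [Fin.consEquiv, Fin.prod_univ_succ]

lemma summable_prod_pow_abs' {κ : Type*} [Fintype κ] {ρ : ℝ} (h0 : 0 ≤ ρ) (h1 : ρ < 1) :
    Summable fun v : κ → ℤ => ∏ i, ρ ^ (v i).natAbs := by
  refine (Equiv.summable_iff ((Fintype.equivFin κ).symm.arrowCongr (Equiv.refl ℤ))).mp
    ((summable_prod_pow_abs h0 h1 (Fintype.card κ)).congr fun v => ?_)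
  simp only [Function.comp_apply, Equiv.arrowCongr_apply, Equiv.coe_refl, id, Equiv.symm_symm]
  exact ((Fintype.equivFin κ).prod_comp fun i => ρ ^ (v i).natAbs).symm

open Classical in
lemma summable_exp_trace {ε : ℝ} (hε : 0 < ε) :
    Summable fun t : MatQ g => if IsIndex t then Real.exp (-(ε * ((t.trace : ℚ) : ℝ))) else 0 := by
  set η : ℝ := ε / (2 * ((g : ℝ) ^ 2 + 1))
  have hη : 0 < η := by positivity
  set ρ : ℝ := Real.exp (-η)
  have hρ : ρ < 1 := by simpa [ρ] using hη
  have hsum := summable_prod_pow_abs' (κ := Fin g × Fin g) (Real.exp_pos (-η)).le hρ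
  have hinj : Function.Injective fun t : {t : MatQ g // IsIndex t} => twice t.1 :=
    fun s t h => Subtype.ext (twice_injOn s.2.1 t.2.1 h)
  have h2 := hsum.comp_injective hinj
  have h3 : Summable fun t : {t : MatQ g // IsIndex t} =>
      Real.exp (-(ε * ((t.1.trace : ℚ) : ℝ))) := by
    refine Summable.of_nonneg_of_le (fun t => (Real.exp_pos _).le) (fun t => ?_) h2
    simp only [Function.comp_apply]
    rw [show ∀ v : Fin g × Fin g → ℤ, ∏ p, Real.exp (-η) ^ (v p).natAbs
        = Real.exp (-(η * ∑ p, ((v p).natAbs : ℝ))) from fun v => by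
      rw [Finset.mul_sum, ← Finset.sum_neg_distrib, Real.exp_sum]
      exact Finset.prod_congr rfl fun p _ => by rw [← Real.exp_nat_mul]; congr 1; ring]
    refine Real.exp_le_exp.mpr (neg_le_neg ?_)
    have hb : ∀ p : Fin g × Fin g, ((twice t.1 p).natAbs : ℝ) ≤ 2 * ((t.1.trace : ℚ) : ℝ) := by
      intro p
      have h := t.2.abs_le_trace p.1 p.2
      have h' : |((twice t.1 p : ℤ) : ℚ)| ≤ 2 * t.1.trace := by
        rw [twice_spec t.2.1, abs_mul, abs_two]; linarith
      rw [Nat.cast_natAbs]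
      exact_mod_cast h'
    have hT : (0 : ℝ) ≤ ((t.1.trace : ℚ) : ℝ) := by
      exact_mod_cast Finset.sum_nonneg fun i _ => t.2.diag_nonneg i
    calc η * ∑ p, ((twice t.1 p).natAbs : ℝ)
        ≤ η * ∑ _p : Fin g × Fin g, 2 * ((t.1.trace : ℚ) : ℝ) := by
          gcongr with p
          exact hb p
      _ = ε * ((t.1.trace : ℚ) : ℝ) * ((g : ℝ) ^ 2 / ((g : ℝ) ^ 2 + 1)) := by
          simp [η]; field_simp
      _ ≤ ε * ((t.1.trace : ℚ) : ℝ) * 1 := by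
          gcongr
          rw [div_le_one (by positivity)]; linarith
      _ = _ := mul_one _
  have h4 := (summable_subtype_iff_indicator (s := {t : MatQ g | IsIndex t})
    (f := fun t : MatQ g => Real.exp (-(ε * ((t.trace : ℚ) : ℝ))))).mp h3
  exact h4.congr fun t => by simp [Set.indicator]

lemma norm_eMat (t : MatQ g) (τ : MatC g) :
    ‖eMat t τ‖ = Real.exp (-(2 * Real.pi * trQ t (imM τ))) := by
  have h : ((t.map fun q => (q : ℂ)) * τ).trace.im = trQ t (imM τ) := by
    simp [trQ_eq_sum, trace, mul_apply, imM, Complex.im_sum]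
  rw [eMat, Complex.norm_exp]
  congr 1
  rw [show 2 * (Real.pi : ℂ) * Complex.I * ((t.map fun q => (q : ℂ)) * τ).trace
    = ((2 * Real.pi : ℝ) : ℂ) * (Complex.I * ((t.map fun q => (q : ℂ)) * τ).trace) by
      push_cast; ring, Complex.re_ofReal_mul, Complex.I_mul_re, h]
  ring

lemma mem_Om {b : MatQ g → ℂ} {Y : MatR g} :
    Y ∈ Om b ↔ Summable fun t => ‖b t‖ * Real.exp (-(2 * Real.pi * trQ t Y)) := Iff.rfl

lemma mem_Om_imM {b : MatQ g → ℂ} {τ : MatC g} :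
    imM τ ∈ Om b ↔ Summable fun t => ‖b t * eMat t τ‖ := by
  simp only [mem_Om, norm_mul, norm_eMat]

lemma hasSum_ser {b : MatQ g → ℂ} {τ : MatC g} (h : imM τ ∈ Om b) :
    HasSum (fun t => b t * eMat t τ) (ser b τ) :=
  (mem_Om_imM.mp h).of_norm.hasSum

lemma convex_Om (b : MatQ g → ℂ) : Convex ℝ (Om b) := by
  intro Y hY Z hZ p q hp hq hpq
  rw [mem_Om] at *
  refine Summable.of_nonneg_of_le (fun t => by positivity) (fun t => ?_)
    ((hY.mul_left p).add (hZ.mul_left q))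
  have := convexOn_exp.2 (Set.mem_univ (-(2 * Real.pi * trQ t Y)))
    (Set.mem_univ (-(2 * Real.pi * trQ t Z))) hp hq hpq
  simp only [smul_eq_mul] at this
  rw [trQ_add, trQ_smul, trQ_smul]
  calc _ ≤ ‖b t‖ * (p * Real.exp (-(2 * Real.pi * trQ t Y))
        + q * Real.exp (-(2 * Real.pi * trQ t Z))) := by
        refine mul_le_mul_of_nonneg_left (le_trans (le_of_eq ?_) this) (norm_nonneg _)
        congr 1; ring
    _ = _ := by ring

lemma trQ_mono {t : MatQ g} (ht : IsIndex t) {Y Y' : MatR g} (h : ∀ x, 0 ≤ qf (Y' - Y) x) :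
    trQ t Y ≤ trQ t Y' := by
  have := trQ_nonneg ht.1.1 ht.2 h
  rw [trQ_sub] at this
  linarith

/-- A family is supported on half-integral positive semi-definite matrices. -/
def SuppIndex (b : MatQ g → ℂ) : Prop := ∀ t, b t ≠ 0 → IsIndex t

lemma SuppIndex.norm_mul_le {b : MatQ g → ℂ} (hb : SuppIndex b) {Y Y' : MatR g}
    (h : ∀ x, 0 ≤ qf (Y' - Y) x) (t : MatQ g) :
    ‖b t‖ * Real.exp (-(2 * Real.pi * trQ t Y')) ≤
      ‖b t‖ * Real.exp (-(2 * Real.pi * trQ t Y)) := by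
  by_cases h0 : b t = 0
  · simp [h0]
  · have := trQ_mono (hb t h0) h
    gcongr

lemma Om_mono {b : MatQ g → ℂ} (hb : SuppIndex b) {Y Y' : MatR g} (hY : Y ∈ Om b)
    (h : ∀ x, 0 ≤ qf (Y' - Y) x) : Y' ∈ Om b :=
  Summable.of_nonneg_of_le (fun t => by positivity) (hb.norm_mul_le h) hY

/-- Bounded terms at `Y` give absolute convergence strictly above `Y`. -/
lemma mem_Om_of_bound {b : MatQ g → ℂ} (hb : SuppIndex b) {Y Y' : MatR g} {C ε : ℝ}
    (hC : ∀ t, ‖b t‖ * Real.exp (-(2 * Real.pi * trQ t Y)) ≤ C) (hε : 0 < ε)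
    (h : ∀ x, ε * (x ⬝ᵥ x) ≤ qf (Y' - Y) x) : Y' ∈ Om b := by
  classical
  have h0 : (0 : ℝ) ≤ C := le_trans (by positivity) (hC 0)
  refine Summable.of_nonneg_of_le (fun t => by positivity) (fun t => ?_)
    ((summable_exp_trace (g := g) (show 0 < 2 * Real.pi * ε by positivity)).mul_left C)
  by_cases hz : b t = 0
  · simp only [hz, norm_zero, zero_mul]
    split_ifs <;> positivity
  · rw [if_pos (hb t hz)]
    have h1 : trQ t (Y + ε • 1) ≤ trQ t Y' := trQ_mono (hb t hz) fun x => by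
      have := h x
      rw [qf_sub] at this ⊢
      rw [qf_add, qf_smul, qf_one]
      linarith
    rw [trQ_add, trQ_smul, trQ_one] at h1
    calc ‖b t‖ * Real.exp (-(2 * Real.pi * trQ t Y'))
        ≤ ‖b t‖ * Real.exp (-(2 * Real.pi * (trQ t Y + ε * ((t.trace : ℚ) : ℝ)))) := by
          gcongr
      _ = ‖b t‖ * Real.exp (-(2 * Real.pi * trQ t Y)) *
          Real.exp (-(2 * Real.pi * ε * ((t.trace : ℚ) : ℝ))) := by
          rw [mul_assoc ‖b t‖, ← Real.exp_add]; congr 2; ring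
      _ ≤ _ := by gcongr; exact hC t

lemma imM_sub (Z W : MatC g) : imM (Z - W) = imM Z - imM W := by
  ext i j; simp [imM]

lemma norm_imM_le (Z : MatC g) : ‖imM Z‖ ≤ ‖Z‖ := by
  refine (Matrix.norm_le_iff (norm_nonneg _)).mpr fun i j => ?_
  exact (Complex.abs_im_le_norm _).trans (Matrix.norm_entry_le_entrywise_sup_norm Z)

/-- The linear form `Z ↦ tr(tZ)`, on the space of arrays (which carries the product norm). -/
def trCLM (t : MatQ g) : (Fin g → Fin g → ℂ) →L[ℂ] ℂ :=
  ∑ i, ∑ j, (t i j : ℂ) •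
    ((ContinuousLinearMap.proj (R := ℂ) (φ := fun _ : Fin g => ℂ) i).comp
      (ContinuousLinearMap.proj (R := ℂ) (φ := fun _ : Fin g => Fin g → ℂ) j))

lemma trCLM_apply (t : MatQ g) (Z : Fin g → Fin g → ℂ) :
    trCLM t Z = ((t.map fun q => (q : ℂ)) * Matrix.of Z).trace := by
  simp [trCLM, trace, mul_apply, _root_.sum_apply]

lemma norm_trCLM_le {t : MatQ g} (ht : IsIndex t) :
    ‖trCLM t‖ ≤ (g : ℝ) ^ 2 * ((t.trace : ℚ) : ℝ) := by
  have hT : (0 : ℝ) ≤ ((t.trace : ℚ) : ℝ) := by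
    exact_mod_cast Finset.sum_nonneg fun i _ => ht.diag_nonneg i
  refine ContinuousLinearMap.opNorm_le_bound _ (by positivity) fun Z => ?_
  rw [trCLM_apply, trace]
  simp only [diag_apply, mul_apply, map_apply, of_apply]
  calc _ ≤ ∑ i : Fin g, ∑ j : Fin g, ((t.trace : ℚ) : ℝ) * ‖Z‖ := by
        refine (norm_sum_le _ _).trans (Finset.sum_le_sum fun i _ => ?_)
        refine (norm_sum_le _ _).trans (Finset.sum_le_sum fun j _ => ?_)
        rw [norm_mul]
        refine mul_le_mul ?_ ((norm_le_pi_norm (Z j) i).trans (norm_le_pi_norm Z j))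
          (norm_nonneg _) hT
        rw [Complex.norm_ratCast]
        exact_mod_cast ht.abs_le_trace i j
    _ = _ := by simp; ring

lemma hasFDerivAt_eMat (t : MatQ g) (Z : Fin g → Fin g → ℂ) :
    HasFDerivAt (fun Z => eMat t (Matrix.of Z))
      ((eMat t (Matrix.of Z) * (2 * (Real.pi : ℂ) * Complex.I)) • trCLM t) Z := by
  have h1 : HasFDerivAt (fun Z => 2 * (Real.pi : ℂ) * Complex.I * trCLM t Z)
      ((2 * (Real.pi : ℂ) * Complex.I) • trCLM t) Z := (trCLM t).hasFDerivAt.const_mul _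
  have h2 := h1.cexp
  rw [smul_smul] at h2
  simp only [trCLM_apply] at h2
  exact h2

lemma exists_shift_mem {b : MatQ g → ℂ} {U : Set (MatC g)}
    (hU : IsOpen U) (h : ∀ Z ∈ U, imM Z ∈ Om b) {Z0 : MatC g} (hZ0 : Z0 ∈ U) :
    ∃ ε : ℝ, 0 < ε ∧ imM Z0 - ε • (1 : MatR g) ∈ Om b := by
  have hc : Continuous fun s : ℝ => Z0 - ((s : ℂ) * Complex.I) • (1 : MatC g) := by
    fun_prop
  have h0 : (fun s : ℝ => Z0 - ((s : ℂ) * Complex.I : ℂ) • (1 : MatC g)) 0 ∈ U := by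
    simpa using hZ0
  obtain ⟨ε, hε, hb⟩ := Metric.mem_nhds_iff.mp ((hU.preimage hc).mem_nhds h0)
  refine ⟨ε / 2, by positivity, ?_⟩
  have := h _ (hb (show ε / 2 ∈ Metric.ball (0 : ℝ) ε by
    rw [Metric.mem_ball, dist_zero_right, Real.norm_eq_abs, abs_of_pos (by positivity)]
    linarith))
  convert this using 1
  rw [imM_sub]
  congr 1
  ext i j
  by_cases hij : i = j <;> simp [imM, hij]

lemma differentiableOn_ser {b : MatQ g → ℂ} (hb : SuppIndex b) {U : Set (MatC g)}
    (hU : IsOpen U) (h : ∀ Z ∈ U, imM Z ∈ Om b) : DifferentiableOn ℂ (ser b) U := by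
  suffices H : ∀ Z0 : Fin g → Fin g → ℂ, Matrix.of Z0 ∈ U →
      DifferentiableAt ℂ (fun Z : Fin g → Fin g → ℂ => ser b (Matrix.of Z)) Z0 from
    fun Z0 hZ0 => (H Z0 hZ0).differentiableWithinAt
  intro Z0 hZ0
  obtain ⟨ε', hε', hεU⟩ := exists_shift_mem hU h hZ0
  obtain ⟨ε, rfl⟩ : ∃ ε, ε' = 2 * ε := ⟨ε' / 2, by ring⟩
  have hε : 0 < ε := by linarith
  set Y0 := imM (Matrix.of Z0)
  set r : ℝ := ε / ((g : ℝ) ^ 2 + 1)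
  have hr : 0 < r := by positivity
  have hball : ∀ Z ∈ Metric.ball Z0 r, ∀ x, 0 ≤ qf (imM (Matrix.of Z) - (Y0 - ε • 1)) x := by
    intro Z hZ x
    have h1 := abs_qf_le (imM (Matrix.of Z) - Y0) x
    have h2 : ‖imM (Matrix.of Z) - Y0‖ ≤ r := by
      rw [← imM_sub]
      refine (norm_imM_le _).trans ?_
      have : ‖Z - Z0‖ ≤ r := by rw [← dist_eq_norm]; exact (Metric.mem_ball.mp hZ).le
      exact this
    have h3 : (g : ℝ) ^ 2 * ‖imM (Matrix.of Z) - Y0‖ ≤ ε := by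
      calc (g : ℝ) ^ 2 * ‖imM (Matrix.of Z) - Y0‖ ≤ (g ^ 2 + 1) * r := by gcongr; linarith
        _ = ε := by simp only [r]; field_simp
    have h4 : |qf (imM (Matrix.of Z) - Y0) x| ≤ ε * (x ⬝ᵥ x) :=
      h1.trans (mul_le_mul_of_nonneg_right h3 (dotProduct_self_nonneg_real x))
    have h5 := (abs_le.mp h4).1
    rw [qf_sub] at h5 ⊢
    rw [qf_sub, qf_smul, qf_one]
    linarith
  set K : ℝ := 2 * Real.pi * ((g : ℝ) ^ 2) / (2 * Real.pi * ε) with hKdef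
  have hu : Summable fun t => K * (‖b t‖ * Real.exp (-(2 * Real.pi * trQ t (Y0 - (2 * ε) • 1)))) :=
    Summable.mul_left _ hεU
  have hK : 0 ≤ K := by positivity
  refine (hasFDerivAt_tsum_of_isPreconnected
    (f := fun t Z => b t * eMat t (Matrix.of Z))
    (f' := fun t Z => b t • ((eMat t (Matrix.of Z) * (2 * (Real.pi : ℂ) * Complex.I)) • trCLM t))
    hu Metric.isOpen_ball
    (convex_ball Z0 r).isPreconnected (fun t Z hZ => ?_) (fun t Z hZ => ?_)
    (Metric.mem_ball_self hr) (hasSum_ser (h _ hZ0)).summable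
    (Metric.mem_ball_self hr)).differentiableAt
  · exact (hasFDerivAt_eMat t Z).const_mul (b t)
  · by_cases hz : b t = 0
    · simp [hz]
    have ht := hb t hz
    have hT : (0 : ℝ) ≤ ((t.trace : ℚ) : ℝ) := by
      exact_mod_cast Finset.sum_nonneg fun i _ => ht.diag_nonneg i
    have h1 : ‖eMat t (Matrix.of Z)‖ ≤ Real.exp (-(2 * Real.pi * trQ t (Y0 - ε • 1))) := by
      rw [norm_eMat]
      have := trQ_mono ht (hball Z hZ)
      gcongr
    have h2 : ((t.trace : ℚ) : ℝ) * (2 * Real.pi * ε)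
        ≤ Real.exp (2 * Real.pi * ε * ((t.trace : ℚ) : ℝ)) := by
      have := Real.add_one_le_exp (2 * Real.pi * ε * ((t.trace : ℚ) : ℝ))
      linarith
    rw [norm_smul, norm_smul, norm_mul]
    have h3 : ‖2 * (Real.pi : ℂ) * Complex.I‖ = 2 * Real.pi := by
      simp [abs_of_pos Real.pi_pos]
    rw [h3]
    calc ‖b t‖ * (‖eMat t (Matrix.of Z)‖ * (2 * Real.pi) * ‖trCLM t‖)
        ≤ ‖b t‖ * (Real.exp (-(2 * Real.pi * trQ t (Y0 - ε • 1))) * (2 * Real.pi) *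
          ((g : ℝ) ^ 2 * ((t.trace : ℚ) : ℝ))) := by
          gcongr
          exact norm_trCLM_le ht
      _ = K * (‖b t‖ * (Real.exp (-(2 * Real.pi * trQ t (Y0 - ε • 1))) *
          (((t.trace : ℚ) : ℝ) * (2 * Real.pi * ε)))) := by
          rw [hKdef]; field_simp
      _ ≤ K * (‖b t‖ * (Real.exp (-(2 * Real.pi * trQ t (Y0 - ε • 1))) *
          Real.exp (2 * Real.pi * ε * ((t.trace : ℚ) : ℝ)))) := by gcongr
      _ = _ := by
          rw [← Real.exp_add, trQ_sub, trQ_sub, trQ_smul, trQ_smul, trQ_one]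
          congr 3; ring

section Fourier

open UnitAddTorus MeasureTheory

@[reducible] def measureSpaceUnitAddCircle : MeasureSpace UnitAddCircle :=
  ⟨AddCircle.haarAddCircle⟩

attribute [local instance] measureSpaceUnitAddCircle

lemma isProbabilityUnitAddCircle : IsProbabilityMeasure (volume : Measure UnitAddCircle) :=
  inferInstanceAs (IsProbabilityMeasure AddCircle.haarAddCircle)

attribute [local instance] isProbabilityUnitAddCircle

/-- The coefficients of an absolutely convergent Fourier series on a torus are bounded by
the supremum of the series. -/
lemma norm_coeff_le_of_sup {κ ι : Type*} [Fintype κ] (a : ι → ℂ) (n : ι → κ → ℤ)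
    (hn : Set.InjOn n {t | a t ≠ 0}) (ha : Summable fun t => ‖a t‖) {B : ℝ}
    (hB : ∀ x : UnitAddTorus κ, ‖∑' t, a t * mFourier (n t) x‖ ≤ B) (s : ι) : ‖a s‖ ≤ B := by
  classical
  have hB0 : 0 ≤ B := (norm_nonneg _).trans (hB 0)
  by_cases hs : a s = 0
  · simpa [hs] using hB0
  have hsum : Summable fun t => a t • (mFourier (n t) : C(UnitAddTorus κ, ℂ)) := by
    refine Summable.of_norm (ha.congr fun t => ?_)
    rw [norm_smul, mFourier_norm, mul_one]
  set f := ∑' t, a t • (mFourier (n t) : C(UnitAddTorus κ, ℂ))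
  have hf : HasSum (fun t => a t • (mFourier (n t) : C(UnitAddTorus κ, ℂ))) f := hsum.hasSum
  have hfB : ‖f‖ ≤ B := by
    refine (ContinuousMap.norm_le _ hB0).mpr fun x => ?_
    have := (hf.mapL (ContinuousMap.evalCLM ℂ x)).tsum_eq
    simp only [ContinuousMap.evalCLM_apply, ContinuousMap.smul_apply, smul_eq_mul] at this
    rw [← this]
    exact hB x
  have h2 := hf.mapL (ContinuousMap.toLp (E := ℂ) 2 (volume : Measure (UnitAddTorus κ)) ℂ)
  have h3 := h2.mapL (innerSL ℂ (mFourierLp 2 (n s)))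
  have h4 : HasSum (fun t => (innerSL ℂ (mFourierLp 2 (n s)))
      (ContinuousMap.toLp (E := ℂ) 2 (volume : Measure (UnitAddTorus κ)) ℂ
        (a t • (mFourier (n t) : C(UnitAddTorus κ, ℂ))))) (a s) := by
    have h5 : ∀ t, (innerSL ℂ (mFourierLp 2 (n s)))
      (ContinuousMap.toLp (E := ℂ) 2 (volume : Measure (UnitAddTorus κ)) ℂ
        (a t • (mFourier (n t) : C(UnitAddTorus κ, ℂ)))) =
        a t * inner ℂ (mFourierLp 2 (n s)) (mFourierLp 2 (n t)) := by
      intro t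
      rw [map_smul, map_smul, innerSL_apply_apply]; rfl
    have h6 := orthonormal_iff_ite.mp (orthonormal_mFourier (d := κ))
    convert hasSum_ite_eq s (a s) using 2 with t
    rw [h5, h6]
    by_cases hts : t = s
    · simp [hts]
    · by_cases ht : a t = 0
      · simp [ht, hts]
      · have : n s ≠ n t := fun h => hts (hn ht hs h.symm)
        simp [hts, this]
  rw [h3.unique h4 |>.symm, innerSL_apply_apply]
  refine (norm_inner_le_norm _ _).trans ?_
  rw [(orthonormal_mFourier (d := κ)).1 (n s), one_mul]
  refine (ContinuousMap.toLp (E := ℂ) 2 (volume : Measure (UnitAddTorus κ)) ℂ).le_opNorm f |>.trans ?_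
  have h7 : ‖ContinuousMap.toLp (E := ℂ) 2 (volume : Measure (UnitAddTorus κ)) ℂ‖ ≤ 1 := by
    refine (ContinuousMap.toLp_norm_le ..).trans ?_
    simp [measureUnivNNReal]
  calc _ ≤ 1 * B := by gcongr
    _ = B := one_mul B

end Fourier

/-- The point `W + ᵗW + iY`. -/
def cpt (W Y : MatR g) : MatC g :=
  (W + Wᵀ).map (fun x => (x : ℂ)) + Complex.I • Y.map (fun x => (x : ℂ))

lemma imM_cpt (W Y : MatR g) : imM (cpt W Y) = Y := by
  ext i j; simp [imM, cpt]

lemma eMat_cpt {t : MatQ g} (ht : HalfIntegral t) (W Y : MatR g) :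
    eMat t (cpt W Y) = (Real.exp (-(2 * Real.pi * trQ t Y)) : ℂ) *
      UnitAddTorus.mFourier (twice t)
        (fun p : Fin g × Fin g => ((W p.1 p.2 : ℝ) : UnitAddCircle)) := by
  have h1 : ((t.map fun q => (q : ℂ)) * cpt W Y).trace =
      (∑ p : Fin g × Fin g, (twice t p : ℂ) * (W p.1 p.2 : ℂ)) + Complex.I * (trQ t Y : ℂ) := by
    have h2 : ∀ p : Fin g × Fin g, (twice t p : ℂ) = 2 * (t p.1 p.2 : ℂ) := fun p => by
      exact_mod_cast congrArg (fun q : ℚ => (q : ℂ)) (twice_spec ht p)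
    have h3 : ∑ i, ∑ j, (t i j : ℂ) * (W j i : ℂ) = ∑ i, ∑ j, (t i j : ℂ) * (W i j : ℂ) := by
      rw [Finset.sum_comm]
      refine Finset.sum_congr rfl fun i _ => Finset.sum_congr rfl fun j _ => ?_
      rw [ht.1.apply]
    simp only [h2, Fintype.sum_prod_type, trQ_eq_sum]
    simp only [cpt, trace, diag_apply, mul_apply, map_apply, Matrix.add_apply, transpose_apply,
      Matrix.smul_apply, smul_eq_mul, Complex.ofReal_add, mul_add, Finset.sum_add_distrib, h3]
    push_cast
    simp only [Finset.mul_sum, ← Finset.sum_add_distrib]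
    refine Finset.sum_congr rfl fun i _ => Finset.sum_congr rfl fun j _ => ?_
    ring
  rw [eMat, h1, UnitAddTorus.mFourier]
  simp only [ContinuousMap.coe_mk, fourier_coe_apply]
  rw [← Complex.exp_sum, Complex.ofReal_exp, ← Complex.exp_add]
  congr 1
  push_cast
  rw [mul_add, Finset.mul_sum, add_comm]
  congr 1
  · linear_combination (2 * Real.pi * trQ t Y : ℂ) * Complex.I_sq
  · refine Finset.sum_congr rfl fun p _ => ?_
    ring

lemma norm_term_le_of_sup {b : MatQ g → ℂ} (hb : SuppIndex b) {Y : MatR g} (hY : Y ∈ Om b)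
    {B : ℝ} (hB : ∀ W : MatR g, (∀ i j, W i j ∈ Set.Icc (0 : ℝ) 1) → ‖ser b (cpt W Y)‖ ≤ B)
    (t : MatQ g) : ‖b t‖ * Real.exp (-(2 * Real.pi * trQ t Y)) ≤ B := by
  have h := norm_coeff_le_of_sup (κ := Fin g × Fin g)
    (fun t => b t * (Real.exp (-(2 * Real.pi * trQ t Y)) : ℂ)) twice
    (fun s hs t ht hst => twice_injOn (hb s (left_ne_zero_of_mul hs)).1
      (hb t (left_ne_zero_of_mul ht)).1 hst)
    (by
      refine (mem_Om.mp hY).congr fun t => ?_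
      rw [norm_mul, Complex.norm_real, Real.norm_eq_abs, Real.abs_exp]) (B := B) ?_ t
  · rwa [norm_mul, Complex.norm_real, Real.norm_eq_abs, Real.abs_exp] at h
  intro x
  have hx : ∀ p, ∃ w ∈ Set.Icc (0 : ℝ) 1, (w : UnitAddCircle) = x p := fun p => by
    have := AddCircle.coe_image_Icc_eq (1 : ℝ) 0
    rw [zero_add] at this
    exact (this.symm ▸ Set.mem_univ (x p) :
      x p ∈ ((↑) : ℝ → UnitAddCircle) '' Set.Icc (0 : ℝ) 1)
  choose w hw hwx using hx
  obtain rfl : (fun p => (w p : UnitAddCircle)) = x := funext hwx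
  refine le_trans (le_of_eq ?_) (hB (Matrix.of fun i j => w (i, j)) fun i j => hw (i, j))
  congr 1
  refine tsum_congr fun t => ?_
  by_cases ht : b t = 0
  · simp [ht]
  · rw [eMat_cpt (hb t ht).1, mul_assoc]; rfl

open Topology in
/-- Locally uniform bounds for a family of Fourier series on the real directions give bounds
for the coefficients. -/
lemma exists_norm_term_le {ι : Type*} {b : ι → MatQ g → ℂ} (hb : ∀ m, SuppIndex (b m))
    {Y : MatR g} (hY : ∀ m, Y ∈ Om (b m)) {B : ℝ → ι → ℝ} (hB : Monotone B)
    (hloc : ∀ W : MatR g, ∃ C, ∀ᶠ W' in 𝓝 W, ∀ m, ‖ser (b m) (cpt W' Y)‖ ≤ B C m) :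
    ∃ C, ∀ m t, ‖b m t‖ * Real.exp (-(2 * Real.pi * trQ t Y)) ≤ B C m := by
  have hcpt : IsCompact {W : MatR g | ∀ i j, W i j ∈ Set.Icc (0 : ℝ) 1} := by
    have : IsCompact (Set.univ.pi fun _ : Fin g => Set.univ.pi fun _ : Fin g => Set.Icc (0 : ℝ) 1) :=
      isCompact_univ_pi fun _ => isCompact_univ_pi fun _ => isCompact_Icc
    have h2 : (Set.univ.pi fun _ : Fin g => Set.univ.pi fun _ : Fin g => Set.Icc (0 : ℝ) 1) =
        {W : MatR g | ∀ i j, W i j ∈ Set.Icc (0 : ℝ) 1} := by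
      ext W
      simp only [Set.mem_pi, Set.mem_univ, true_implies]
      rfl
    rw [← h2]
    exact this
  obtain ⟨C, hC⟩ := hcpt.induction_on
    (p := fun S => ∃ C, ∀ W ∈ S, ∀ m, ‖ser (b m) (cpt W Y)‖ ≤ B C m)
    ⟨0, by simp⟩ (fun s t hst ⟨C, hC⟩ => ⟨C, fun W hW => hC W (hst hW)⟩)
    (fun s t ⟨C, hC⟩ ⟨C', hC'⟩ => ⟨max C C', fun W hW m => hW.elim
      (fun hW => (hC W hW m).trans (hB (le_max_left _ _) m))
      (fun hW => (hC' W hW m).trans (hB (le_max_right _ _) m))⟩)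
    (fun W _ => by
      obtain ⟨C, hC⟩ := hloc W
      exact ⟨_, mem_nhdsWithin_of_mem_nhds hC, C, fun W' hW' => hW'⟩)
  exact ⟨C, fun m t => norm_term_le_of_sup (hb m) (hY m) (fun W hW => hC W hW m) t⟩

/-- The part of `b` at level `m`, i.e. with last diagonal entry `m`. -/
def lev {h : ℕ} (b : MatQ (h + 1) → ℂ) (m : ℕ) : MatQ (h + 1) → ℂ :=
  fun t => if t (Fin.last h) (Fin.last h) = m then b t else 0

lemma SuppIndex.lev {h : ℕ} {b : MatQ (h + 1) → ℂ} (hb : SuppIndex b) (m : ℕ) :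
    SuppIndex (lev b m) := fun t ht => hb t fun h0 => ht (by simp [_root_.lev, h0])

lemma IsIndex.exists_level {h : ℕ} {t : MatQ (h + 1)} (ht : IsIndex t) :
    ∃ m : ℕ, t (Fin.last h) (Fin.last h) = m := by
  obtain ⟨z, hz⟩ := ht.1.2.2 (Fin.last h)
  have h0 := ht.diag_nonneg (Fin.last h)
  rw [hz] at h0
  obtain ⟨m, rfl⟩ := Int.eq_ofNat_of_zero_le (by exact_mod_cast h0)
  exact ⟨m, by rw [hz]; simp⟩

lemma eMat_add (s t : MatQ g) (τ : MatC g) : eMat (s + t) τ = eMat s τ * eMat t τ := by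
  have : ((s + t).map fun q => (q : ℂ)) = (s.map fun q => (q : ℂ)) + t.map fun q => (q : ℂ) := by
    ext; simp
  rw [eMat, eMat, eMat, ← Complex.exp_add, this, add_mul, trace_add, mul_add]

lemma eMat_zero (τ : MatC g) : eMat 0 τ = 1 := by
  simp [eMat]

lemma SuppIndex.finite_conv {b b' : MatQ g → ℂ} (hb : SuppIndex b) (hb' : SuppIndex b')
    (t : MatQ g) : (Function.support fun s => b s * b' (t - s)).Finite :=
  (finite_index_le t).subset fun s hs =>
    ⟨hb s (left_ne_zero_of_mul hs), hb' _ (right_ne_zero_of_mul hs)⟩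

lemma convC_eq_sum {b b' : MatQ g → ℂ} (hb : SuppIndex b) (hb' : SuppIndex b') (t : MatQ g) :
    convC b b' t = ∑ s ∈ (finite_index_le t).toFinset, b s * b' (t - s) :=
  finsum_eq_finsetSum_of_support_subset _ fun s hs => by
    simpa using ⟨hb s (left_ne_zero_of_mul hs), hb' _ (right_ne_zero_of_mul hs)⟩

lemma SuppIndex.convC {b b' : MatQ g → ℂ} (hb : SuppIndex b) (hb' : SuppIndex b') :
    SuppIndex (convC b b') := by
  intro t ht
  rw [convC_eq_sum hb hb'] at ht
  obtain ⟨s, hs, -⟩ := Finset.exists_ne_zero_of_sum_ne_zero ht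
  rw [Set.Finite.mem_toFinset] at hs
  have := hs.1.add hs.2
  rwa [add_sub_cancel] at this

/-- The change of variables `(t, s) ↦ (s, t - s)`. -/
def convEquiv : MatQ g × MatQ g ≃ MatQ g × MatQ g where
  toFun p := (p.2, p.1 - p.2)
  invFun p := (p.1 + p.2, p.1)
  left_inv p := by simp
  right_inv p := by simp

lemma convC_mem_Om {b b' : MatQ g → ℂ} (hb : SuppIndex b) (hb' : SuppIndex b') {τ : MatC g}
    (h : imM τ ∈ Om b) (h' : imM τ ∈ Om b') :
    imM τ ∈ Om (convC b b') ∧ ser (convC b b') τ = ser b τ * ser b' τ := by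
  have h1 := mem_Om_imM.mp h
  have h2 := mem_Om_imM.mp h'
  have h3 := summable_mul_of_summable_norm h1 h2
  have h3n := h1.mul_norm h2
  have key : ∀ p : MatQ g × MatQ g, (b (convEquiv p).1 * eMat (convEquiv p).1 τ) *
      (b' (convEquiv p).2 * eMat (convEquiv p).2 τ) = (b p.2 * b' (p.1 - p.2)) * eMat p.1 τ := by
    rintro ⟨t, s⟩
    have := eMat_add s (t - s) τ
    rw [add_sub_cancel] at this
    simp only [convEquiv, Equiv.coe_fn_mk, this]
    ring
  have h4 : Summable fun p : MatQ g × MatQ g => ‖(b p.2 * b' (p.1 - p.2)) * eMat p.1 τ‖ :=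
    ((Equiv.summable_iff convEquiv).mpr h3n).congr fun p => by
      simp only [Function.comp_apply, key]
  have hfib : ∀ t, ∑' s, (b s * b' (t - s)) * eMat t τ = convC b b' t * eMat t τ := fun t => by
    rw [tsum_mul_right, tsum_eq_finsum (hb.finite_conv hb' t)]; rfl
  have hsum := h4.of_norm.hasSum
  constructor
  · rw [mem_Om_imM]
    refine Summable.of_nonneg_of_le (fun t => norm_nonneg _) (fun t => ?_) h4.prod
    rw [← hfib]
    exact norm_tsum_le_tsum_norm (h4.prod_factor t)
  · rw [ser, ser, ser, tsum_mul_tsum_of_summable_norm h1 h2, ← Equiv.tsum_eq convEquiv]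
    rw [tsum_congr key, h4.of_norm.tsum_prod]
    exact tsum_congr fun t => (hfib t).symm

lemma Om_sum {ι : Type*} (S : Finset ι) {b : ι → MatQ g → ℂ} {τ : MatC g}
    (h : ∀ i ∈ S, imM τ ∈ Om (b i)) : imM τ ∈ Om (fun t => ∑ i ∈ S, b i t) ∧
      ser (fun t => ∑ i ∈ S, b i t) τ = ∑ i ∈ S, ser (b i) τ := by
  constructor
  · rw [mem_Om_imM]
    refine Summable.of_nonneg_of_le (fun t => norm_nonneg _) (fun t => ?_)
      (summable_sum fun i hi => mem_Om_imM.mp (h i hi))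
    rw [Finset.sum_mul]
    exact norm_sum_le _ _
  · have := (hasSum_sum fun i hi => hasSum_ser (h i hi)).tsum_eq
    rw [← this]
    exact tsum_congr fun t => by rw [Finset.sum_mul]

section Level

variable {h : ℕ}

lemma lev_convC {b b' : MatQ (h + 1) → ℂ} (hb : SuppIndex b) (hb' : SuppIndex b') (M : ℕ) :
    lev (convC b b') M =
      fun t => ∑ p ∈ Finset.HasAntidiagonal.antidiagonal M,
        convC (lev b p.1) (lev b' p.2) t := by
  refine funext fun t => ?_
  simp only [fun p : ℕ × ℕ => convC_eq_sum (hb.lev p.1) (hb'.lev p.2) t]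
  rw [Finset.sum_comm, lev, convC_eq_sum hb hb', Finset.ite_sum_zero]
  refine Finset.sum_congr rfl fun s hs => ?_
  rw [Set.Finite.mem_toFinset] at hs
  obtain ⟨i, hi⟩ := hs.1.exists_level
  obtain ⟨j, hj⟩ := hs.2.exists_level
  have ht : t (Fin.last h) (Fin.last h) = ((i + j : ℕ) : ℚ) := by
    rw [Matrix.sub_apply] at hj; push_cast; linarith
  simp only [lev, hi, hj, ht, Nat.cast_inj]
  by_cases hM : i + j = M
  · rw [if_pos hM, Finset.sum_eq_single (i, j)]
    · simp
    · rintro ⟨i', j'⟩ - hne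
      by_cases h1 : i = i'
      · have h2 : j ≠ j' := fun h2 => hne (by rw [h1, h2])
        simp [h2]
      · simp [h1]
    · intro hnot
      exact absurd (Finset.HasAntidiagonal.mem_antidiagonal.mpr hM) hnot
  · rw [if_neg hM]
    refine (Finset.sum_eq_zero ?_).symm
    rintro ⟨i', j'⟩ hp
    have hp := Finset.HasAntidiagonal.mem_antidiagonal.mp hp
    by_cases h1 : i = i'
    · have h2 : j ≠ j' := fun h2 => hM (by rw [h1, h2]; exact hp)
      simp [h2]
    · simp [h1]

/-- The domain of convergence of Fourier-Jacobi coefficients: matrices whose imaginary part is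
positive definite on vectors with vanishing last entry. -/
def jacobiDomain (h : ℕ) : Set (MatC (h + 1)) :=
  {Z | ∀ x, x ≠ 0 → x (Fin.last h) = 0 → 0 < qf (imM Z) x}

/-- All levels of `b` converge absolutely on the Jacobi domain. -/
def LevSummable (b : MatQ (h + 1) → ℂ) : Prop :=
  ∀ m, ∀ Z ∈ jacobiDomain h, imM Z ∈ Om (lev b m)

lemma lev_convC_mem_Om {b b' : MatQ (h + 1) → ℂ} (hb : SuppIndex b) (hb' : SuppIndex b')
    (h1 : LevSummable b) (h2 : LevSummable b') (M : ℕ) {Z : MatC (h + 1)}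
    (hZ : Z ∈ jacobiDomain h) :
    imM Z ∈ Om (lev (convC b b') M) ∧ ser (lev (convC b b') M) Z =
      ∑ p ∈ Finset.HasAntidiagonal.antidiagonal M, ser (lev b p.1) Z * ser (lev b' p.2) Z := by
  have key := fun p : ℕ × ℕ =>
    convC_mem_Om (hb.lev p.1) (hb'.lev p.2) (h1 p.1 Z hZ) (h2 p.2 Z hZ)
  have := Om_sum (Finset.HasAntidiagonal.antidiagonal M)
    (b := fun p : ℕ × ℕ => convC (lev b p.1) (lev b' p.2)) (τ := Z) fun p _ => (key p).1
  rw [lev_convC hb hb' M]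
  exact ⟨this.1, this.2.trans (Finset.sum_congr rfl fun p _ => (key p).2)⟩

lemma levSummable_convC {b b' : MatQ (h + 1) → ℂ} (hb : SuppIndex b) (hb' : SuppIndex b')
    (h1 : LevSummable b) (h2 : LevSummable b') : LevSummable (convC b b') :=
  fun M _ hZ => (lev_convC_mem_Om hb hb' h1 h2 M hZ).1

/-- The ring of complex valued functions on the Jacobi domain. -/
abbrev FunJ (h : ℕ) := {Z : MatC (h + 1) // Z ∈ jacobiDomain h} → ℂ

/-- The Fourier-Jacobi expansion, as a power series with function coefficients. -/
def fjSeries (b : MatQ (h + 1) → ℂ) : PowerSeries (FunJ h) :=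
  PowerSeries.mk fun m Z => ser (lev b m) Z.1

lemma fjSeries_convC {b b' : MatQ (h + 1) → ℂ} (hb : SuppIndex b) (hb' : SuppIndex b')
    (h1 : LevSummable b) (h2 : LevSummable b') :
    fjSeries (convC b b') = fjSeries b * fjSeries b' := by
  refine PowerSeries.ext fun M => funext fun Z => ?_
  rw [PowerSeries.coeff_mul, Finset.sum_apply]
  simp only [fjSeries, PowerSeries.coeff_mk, Pi.mul_apply]
  exact (lev_convC_mem_Om hb hb' h1 h2 M Z.2).2

lemma lev_powC_zero (c : MatQ (h + 1) → ℂ) (m : ℕ) :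
    lev (powC c 0) m = fun t => if t = 0 then (if m = 0 then 1 else 0) else 0 := by
  refine funext fun t => ?_
  by_cases ht : t = 0 <;> simp [lev, powC, ht, eq_comm (a := (0 : ℚ))]

lemma suppIndex_powC {c : MatQ g → ℂ} (hc : SuppIndex c) (i : ℕ) : SuppIndex (powC c i) := by
  induction i with
  | zero =>
    intro t ht
    by_cases h0 : t = 0
    · rw [h0]; exact isIndex_zero
    · simp [powC, h0] at ht
  | succ i ih => exact hc.convC ih

lemma levSummable_powC {c : MatQ (h + 1) → ℂ} (hc : SuppIndex c) (h1 : LevSummable c) (i : ℕ) :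
    LevSummable (powC c i) ∧ fjSeries (powC c i) = fjSeries c ^ i := by
  induction i with
  | zero =>
    refine ⟨fun m Z _ => ?_, ?_⟩
    · rw [lev_powC_zero, mem_Om]
      exact summable_of_ne_finset_zero (s := {0}) fun t ht => by simp at ht; simp [ht]
    · refine PowerSeries.ext fun m => funext fun Z => ?_
      rw [fjSeries, PowerSeries.coeff_mk, lev_powC_zero, ser, tsum_eq_single 0]
      · simp only [if_true, eMat_zero, mul_one, pow_zero, PowerSeries.coeff_one]
        split_ifs <;> rfl
      · intro t ht
        simp [ht]
  | succ i ih =>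
    refine ⟨levSummable_convC hc (suppIndex_powC hc i) h1 ih.1, ?_⟩
    rw [powC, fjSeries_convC hc (suppIndex_powC hc i) h1 ih.1, ih.2, pow_succ']

end Level

/-- Positivity of the quadratic form of a (not necessarily symmetric) real matrix. -/
def PD (Y : MatR g) : Prop := ∀ x, x ≠ 0 → 0 < qf Y x

lemma posDef_iff {Y : MatR g} : Y.PosDef ↔ Y.IsSymm ∧ PD Y := by
  constructor
  · intro h
    refine ⟨by
      have := h.isHermitian
      rwa [IsHermitian, conjTranspose_eq_transpose_of_trivial] at this,
      fun x hx => by simpa [qf] using h.dotProduct_mulVec_pos hx⟩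
  · rintro ⟨h1, h2⟩
    refine PosDef.of_dotProduct_mulVec_pos ?_ fun {x} hx => by simpa [qf] using h2 x hx
    rw [IsHermitian, conjTranspose_eq_transpose_of_trivial]; exact h1

lemma mem_Sieg_iff {τ : MatC g} : τ ∈ Sieg g ↔ τ.IsSymm ∧ PD (imM τ) := by
  change τ.IsSymm ∧ (imM τ).PosDef ↔ _
  rw [posDef_iff]
  refine ⟨fun h => ⟨h.1, h.2.2⟩, fun h => ⟨h.1, ?_, h.2⟩⟩
  ext i j
  simp [imM, h.1.apply i j]

lemma cpt_mem_Sieg (W : MatR g) {Y : MatR g} (hs : Y.IsSymm) (hp : PD Y) : cpt W Y ∈ Sieg g := by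
  rw [mem_Sieg_iff, imM_cpt]
  refine ⟨?_, hp⟩
  ext i j
  simp [cpt, hs.apply i j, add_comm]

/-- The symmetric part of a matrix. -/
def symPart (Y : MatR g) : MatR g := (1 / 2 : ℝ) • (Y + Yᵀ)

lemma symPart_isSymm (Y : MatR g) : (symPart Y).IsSymm := by
  ext i j; simp [symPart]; ring

lemma qf_transpose (Y : MatR g) (x : Fin g → ℝ) : qf Yᵀ x = qf Y x := by
  simp only [qf_eq_sum, transpose_apply]
  rw [Finset.sum_comm]
  exact Finset.sum_congr rfl fun i _ => Finset.sum_congr rfl fun j _ => by ring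

lemma qf_symPart (Y : MatR g) (x : Fin g → ℝ) : qf (symPart Y) x = qf Y x := by
  rw [symPart, qf_smul, qf_add, qf_transpose]; ring

lemma trQ_transpose {t : MatQ g} (ht : t.IsSymm) (Y : MatR g) : trQ t Yᵀ = trQ t Y := by
  simp only [trQ_eq_sum, transpose_apply]
  rw [Finset.sum_comm]
  exact Finset.sum_congr rfl fun i _ => Finset.sum_congr rfl fun j _ => by rw [ht.apply]

lemma trQ_symPart {t : MatQ g} (ht : t.IsSymm) (Y : MatR g) : trQ t (symPart Y) = trQ t Y := by
  rw [symPart, trQ_smul, trQ_add, trQ_transpose ht]; ring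

lemma symPart_mem_Om {b : MatQ g → ℂ} (hb : SuppIndex b) {Y : MatR g} :
    symPart Y ∈ Om b ↔ Y ∈ Om b := by
  rw [mem_Om, mem_Om]
  refine summable_congr fun t => ?_
  by_cases ht : b t = 0
  · simp [ht]
  · rw [trQ_symPart (hb t ht).1.1]

section Blocks

variable {h : ℕ}

/-- The top left block. -/
def topBlk {R : Type*} (Y : Matrix (Fin (h + 1)) (Fin (h + 1)) R) : Matrix (Fin h) (Fin h) R :=
  Y.submatrix Fin.castSucc Fin.castSucc

/-- The matrix unit at the last diagonal position. -/
def lastE (h : ℕ) : MatR (h + 1) := Matrix.single (Fin.last h) (Fin.last h) 1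

lemma qf_lastE (x : Fin (h + 1) → ℝ) : qf (lastE h) x = x (Fin.last h) ^ 2 := by
  rw [qf_eq_sum, Finset.sum_eq_single (Fin.last h), Finset.sum_eq_single (Fin.last h)]
  · simp [lastE, sq]
  · intro j _ hj
    simp [lastE, hj.symm]
  · simp
  · intro i _ hi
    exact Finset.sum_eq_zero fun j _ => by simp [lastE, hi.symm]
  · simp

lemma trQ_lastE (t : MatQ (h + 1)) : trQ t (lastE h) = (t (Fin.last h) (Fin.last h) : ℝ) := by
  rw [trQ, lastE, trace_mul_single]; simp

lemma qf_snoc (Y : MatR (h + 1)) (v : Fin h → ℝ) (s : ℝ) :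
    qf Y (Fin.snoc v s) = qf (topBlk Y) v +
      s * ∑ i, v i * (Y i.castSucc (Fin.last h) + Y (Fin.last h) i.castSucc) +
      s ^ 2 * Y (Fin.last h) (Fin.last h) := by
  simp only [qf_eq_sum, Fin.sum_univ_castSucc, Fin.snoc_castSucc, Fin.snoc_last, topBlk,
    submatrix_apply, Finset.sum_add_distrib, mul_add, Finset.mul_sum]
  rw [show ∑ i, v i * Y i.castSucc (Fin.last h) * s = ∑ i, s * (v i * Y i.castSucc (Fin.last h))
    from Finset.sum_congr rfl fun _ _ => by ring,
    show ∑ i, s * Y (Fin.last h) i.castSucc * v i = ∑ i, s * (v i * Y (Fin.last h) i.castSucc)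
    from Finset.sum_congr rfl fun _ _ => by ring]
  ring

lemma snoc_surj (x : Fin (h + 1) → ℝ) : ∃ v s, x = Fin.snoc v s :=
  ⟨Fin.init x, x (Fin.last h), (Fin.snoc_init_self x).symm⟩

lemma snoc_eq_zero_iff {v : Fin h → ℝ} {s : ℝ} :
    (Fin.snoc v s : Fin (h + 1) → ℝ) = 0 ↔ v = 0 ∧ s = 0 := by
  constructor
  · intro H
    refine ⟨funext fun i => ?_, ?_⟩
    · simpa using congrFun H i.castSucc
    · simpa using congrFun H (Fin.last h)
  · rintro ⟨rfl, rfl⟩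
    ext i
    refine Fin.lastCases ?_ (fun i => ?_) i <;> simp

lemma mem_jacobiDomain_iff {Z : MatC (h + 1)} :
    Z ∈ jacobiDomain h ↔ PD (topBlk (imM Z)) := by
  constructor
  · intro H v hv
    have := H (Fin.snoc v 0) (fun h0 => hv (snoc_eq_zero_iff.mp h0).1) (by simp)
    rw [qf_snoc] at this
    simpa using this
  · intro H x hx hx0
    obtain ⟨v, s, rfl⟩ := snoc_surj x
    have hs : s = 0 := by simpa using hx0
    subst hs
    rw [qf_snoc]
    simpa using H v fun h0 => hx (snoc_eq_zero_iff.mpr ⟨h0, rfl⟩)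

/-- Adding a large multiple of `lastE` makes a matrix with positive top block positive. -/
lemma exists_add_lastE_PD {Y : MatR (h + 1)} (hY : PD (topBlk Y)) :
    ∃ M : ℝ, ∀ M', M ≤ M' → PD (Y + M' • lastE h) := by
  obtain ⟨ε, hε, hlow⟩ := exists_pos_lower_bound hY
  set w : Fin h → ℝ := fun i => Y i.castSucc (Fin.last h) + Y (Fin.last h) i.castSucc
  refine ⟨(∑ i, w i ^ 2) / (2 * ε) - Y (Fin.last h) (Fin.last h) + 1, fun M' hM' x hx => ?_⟩
  obtain ⟨v, s, rfl⟩ := snoc_surj x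
  rw [qf_add, qf_smul, qf_lastE, qf_snoc, Fin.snoc_last]
  have h1 := hlow v
  have h2 : 0 ≤ s * ∑ i, v i * w i + ε / 2 * (v ⬝ᵥ v) + s ^ 2 * ((∑ i, w i ^ 2) / (2 * ε)) := by
    have : s * ∑ i, v i * w i + ε / 2 * (v ⬝ᵥ v) + s ^ 2 * ((∑ i, w i ^ 2) / (2 * ε)) =
        ∑ i, (ε * v i + s * w i) ^ 2 / (2 * ε) := by
      simp only [dotProduct, Finset.mul_sum, Finset.sum_div, ← Finset.sum_add_distrib]
      refine Finset.sum_congr rfl fun i _ => ?_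
      field_simp
      ring
    rw [this]
    positivity
  have h3 : 0 < ε / 2 * (v ⬝ᵥ v) + s ^ 2 := by
    by_cases hv : v = 0
    · have hs : s ≠ 0 := fun hs => hx (snoc_eq_zero_iff.mpr ⟨hv, hs⟩)
      have := dotProduct_self_nonneg_real v
      positivity
    · have := dotProduct_self_pos_real hv
      positivity
  have h4 : s ^ 2 * ((∑ i, w i ^ 2) / (2 * ε) - Y (Fin.last h) (Fin.last h) + 1) ≤ s ^ 2 * M' :=
    mul_le_mul_of_nonneg_left hM' (sq_nonneg s)
  nlinarith

lemma add_lastE_mem_Om_lev {b : MatQ (h + 1) → ℂ} {m : ℕ} {Y : MatR (h + 1)} (M : ℝ) :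
    Y + M • lastE h ∈ Om (lev b m) ↔ Y ∈ Om (lev b m) := by
  have : ∀ t, ‖lev b m t‖ * Real.exp (-(2 * Real.pi * trQ t (Y + M • lastE h))) =
      (‖lev b m t‖ * Real.exp (-(2 * Real.pi * trQ t Y))) *
        Real.exp (-(2 * Real.pi * (M * m))) := by
    intro t
    by_cases ht : t (Fin.last h) (Fin.last h) = m
    · rw [trQ_add, trQ_smul, trQ_lastE, ht, mul_assoc ‖_‖, ← Real.exp_add]
      congr 2; push_cast; ring
    · simp [lev, ht]
  rw [mem_Om, mem_Om]
  simp only [this]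
  exact summable_mul_right_iff (Real.exp_pos _).ne'

lemma Om_lev_of_Om {b : MatQ (h + 1) → ℂ} (m : ℕ) {Y : MatR (h + 1)} (hY : Y ∈ Om b) :
    Y ∈ Om (lev b m) := by
  refine Summable.of_nonneg_of_le (fun t => by positivity) (fun t => ?_) hY
  gcongr
  rw [lev]
  split_ifs <;> simp

lemma SiegelMF.suppIndex {k : ℤ} (f : SiegelMF g k) : SuppIndex f.coeff := f.supp

lemma SiegelMF.mem_Om {k : ℤ} (f : SiegelMF g k) {Y : MatR g} (hY : PD Y) : Y ∈ Om f.coeff := by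
  rw [← symPart_mem_Om f.suppIndex]
  have h1 : cpt 0 (symPart Y) ∈ Sieg g :=
    cpt_mem_Sieg 0 (symPart_isSymm Y) fun x hx => by rw [qf_symPart]; exact hY x hx
  have h2 := (f.expansion _ h1).summable.norm
  rw [← mem_Om_imM, imM_cpt] at h2
  exact h2

lemma finSumFinEquiv_symm_castSucc (i : Fin h) :
    (finSumFinEquiv (m := h) (n := 1)).symm i.castSucc = Sum.inl i := by
  rw [Equiv.symm_apply_eq]; rfl

lemma finSumFinEquiv_symm_last' :
    (finSumFinEquiv (m := h) (n := 1)).symm (Fin.last h) = Sum.inr 0 := by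
  rw [Equiv.symm_apply_eq]; rfl

lemma blkQ_apply_castSucc (n : MatQ h) (r : MatRQ h 1) (m : MatQ 1) (i j : Fin h) :
    blkQ h 1 n r m i.castSucc j.castSucc = n i j := by
  simp only [blkQ, reindex_apply, submatrix_apply, finSumFinEquiv_symm_castSucc,
    fromBlocks_apply₁₁]

lemma blkQ_apply_last (n : MatQ h) (r : MatRQ h 1) (m : MatQ 1) (i : Fin h) :
    blkQ h 1 n r m i.castSucc (Fin.last h) = r i 0 / 2 := by
  simp only [blkQ, reindex_apply, submatrix_apply, finSumFinEquiv_symm_castSucc,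
    finSumFinEquiv_symm_last', fromBlocks_apply₁₂, Matrix.smul_apply, smul_eq_mul]
  ring

lemma blkQ_apply_last_left (n : MatQ h) (r : MatRQ h 1) (m : MatQ 1) (i : Fin h) :
    blkQ h 1 n r m (Fin.last h) i.castSucc = r i 0 / 2 := by
  simp only [blkQ, reindex_apply, submatrix_apply, finSumFinEquiv_symm_castSucc,
    finSumFinEquiv_symm_last', fromBlocks_apply₂₁, Matrix.smul_apply, smul_eq_mul, transpose_apply]
  ring

lemma blkQ_apply_last_last (n : MatQ h) (r : MatRQ h 1) (m : MatQ 1) :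
    blkQ h 1 n r m (Fin.last h) (Fin.last h) = m 0 0 := by
  simp only [blkQ, reindex_apply, submatrix_apply,
    finSumFinEquiv_symm_last', fromBlocks_apply₂₂]

/-- The `1 × 1` matrix with entry `m`. -/
def oneByOne (m : ℕ) : MatQ 1 := Matrix.of fun _ _ => (m : ℚ)

/-- The index matrix with top block `n`, off-diagonal `r/2` and last entry `m`. -/
def idxOf (m : ℕ) (nr : MatQ h × MatRQ h 1) : MatQ (h + 1) := blkQ h 1 nr.1 nr.2 (oneByOne m)

lemma idxOf_injective (m : ℕ) : Function.Injective (idxOf (h := h) m) := by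
  rintro ⟨n, r⟩ ⟨n', r'⟩ H
  have hn : n = n' := by
    ext i j
    have := congrFun (congrFun H i.castSucc) j.castSucc
    simpa only [idxOf, blkQ_apply_castSucc] using this
  have hr : r = r' := by
    ext i j
    have := congrFun (congrFun H i.castSucc) (Fin.last h)
    simp only [idxOf, blkQ_apply_last] at this
    rw [Subsingleton.elim j 0]
    linarith
  rw [hn, hr]

lemma mem_range_idxOf {m : ℕ} {t : MatQ (h + 1)} (ht : t.IsSymm)
    (hm : t (Fin.last h) (Fin.last h) = m) : t ∈ Set.range (idxOf (h := h) m) := by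
  refine ⟨(topBlk t, Matrix.of fun i _ => 2 * t i.castSucc (Fin.last h)), ?_⟩
  ext i j
  refine Fin.lastCases ?_ (fun i => ?_) i <;> refine Fin.lastCases ?_ (fun j => ?_) j
  · rw [idxOf, blkQ_apply_last_last, hm]; rfl
  · rw [idxOf, blkQ_apply_last_left]
    change 2 * t j.castSucc (Fin.last h) / 2 = _
    rw [← ht.apply]
    ring
  · rw [idxOf, blkQ_apply_last]
    change 2 * t i.castSucc (Fin.last h) / 2 = _
    ring
  · rw [idxOf, blkQ_apply_castSucc]; rfl

lemma lev_idxOf (c : MatQ (h + 1) → ℂ) (m : ℕ) (nr : MatQ h × MatRQ h 1) :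
    lev c m (idxOf m nr) = sliceCoeff h 1 c (oneByOne m) nr := by
  rw [lev, if_pos]
  · rfl
  · rw [idxOf, blkQ_apply_last_last]; rfl

lemma oneByOne_index (m : ℕ) : HalfIntegral (oneByOne m) ∧ PosSemidefQ (oneByOne m) := by
  refine ⟨⟨by ext; rfl, fun i j => ⟨2 * m, by simp [oneByOne]⟩, fun i => ⟨m, by simp [oneByOne]⟩⟩,
    fun v => ?_⟩
  simp only [dotProduct, mulVec, oneByOne, of_apply, Finset.univ_unique, Finset.sum_singleton]
  nlinarith [mul_self_nonneg (v default), (Nat.cast_nonneg m : (0 : ℚ) ≤ m)]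

lemma eMat_idxOf (m : ℕ) (nr : MatQ h × MatRQ h 1) {τ : MatC (h + 1)} (hτ : τ.IsSymm) :
    eMat (idxOf m nr) τ =
      Complex.exp (2 * (Real.pi : ℂ) * Complex.I *
        (((nr.1.map fun q => (q : ℂ)) * topBlk τ).trace
          + ((nr.2.map fun q => (q : ℂ))ᵀ *
            (Matrix.of fun (i : Fin h) (_ : Fin 1) => τ i.castSucc (Fin.last h))).trace)) *
      Complex.exp (2 * (Real.pi : ℂ) * Complex.I * (m * τ (Fin.last h) (Fin.last h))) := by
  rw [← Complex.exp_add, eMat, ← mul_add]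
  congr 2
  simp only [trace, diag_apply, mul_apply, map_apply, Fin.sum_univ_castSucc, idxOf,
    blkQ_apply_castSucc, blkQ_apply_last, blkQ_apply_last_left, blkQ_apply_last_last,
    Finset.univ_unique, Finset.sum_singleton, transpose_apply, of_apply, topBlk, submatrix_apply,
    Finset.sum_add_distrib, oneByOne]
  have h1 : ∀ i, τ (Fin.last h) (Fin.castSucc i) = τ (Fin.castSucc i) (Fin.last h) :=
    fun i => hτ.apply _ _
  simp only [h1]
  have h2 : ∀ i, ((nr.2 i 0 / 2 : ℚ) : ℂ) * τ (Fin.castSucc i) (Fin.last h) =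
      (1 / 2) * ((nr.2 i 0 : ℂ) * τ (Fin.castSucc i) (Fin.last h)) := fun i => by
    push_cast; ring
  simp only [h2, ← Finset.mul_sum]
  have h3 : ∀ i, nr.2 i default = nr.2 i 0 := fun i => by rw [Subsingleton.elim default 0]
  simp only [h3]
  push_cast
  ring

lemma topBlk_mem_Sieg {τ : MatC (h + 1)} (hτ : τ.IsSymm) (hV : τ ∈ jacobiDomain h) :
    topBlk τ ∈ Sieg h :=
  mem_Sieg_iff.mpr ⟨by ext i j; exact hτ.apply _ _, mem_jacobiDomain_iff.mp hV⟩

/-- The levels of a formal Fourier-Jacobi series are given by its Jacobi forms. -/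
lemma hasSum_lev_of_jacobiF {k : ℤ} {c : MatQ (h + 1) → ℂ} (hc : SuppIndex c) {m : ℕ}
    (φ : JacobiF h 1 k (oneByOne m)) (hφ : φ.coeff = sliceCoeff h 1 c (oneByOne m))
    {τ : MatC (h + 1)} (hτ : τ.IsSymm) (hV : τ ∈ jacobiDomain h) :
    HasSum (fun t => lev c m t * eMat t τ)
      (φ.toFun (topBlk τ, Matrix.of fun i _ => τ i.castSucc (Fin.last h)) *
        Complex.exp (2 * (Real.pi : ℂ) * Complex.I * (m * τ (Fin.last h) (Fin.last h)))) := by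
  refine (Function.Injective.hasSum_iff (idxOf_injective m) fun t ht => ?_).mp ?_
  · by_cases h0 : lev c m t = 0
    · rw [h0, zero_mul]
    · refine absurd (mem_range_idxOf (hc.lev m t h0).1.1 ?_) ht
      by_contra hm
      exact h0 (if_neg hm)
  · have := (φ.expansion (topBlk τ, Matrix.of fun i _ => τ i.castSucc (Fin.last h))
      (topBlk_mem_Sieg hτ hV)).mul_right
      (Complex.exp (2 * (Real.pi : ℂ) * Complex.I * (m * τ (Fin.last h) (Fin.last h))))
    refine this.congr_fun fun nr => ?_
    rw [Function.comp_apply, lev_idxOf, eMat_idxOf m nr hτ, hφ]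
    exact (mul_assoc _ _ _).symm

lemma topBlk_symPart_PD {Y : MatR (h + 1)} (hY : PD (topBlk Y)) : PD (topBlk (symPart Y)) := by
  intro x hx
  have h1 := qf_snoc (symPart Y) x 0
  have h2 := qf_snoc Y x 0
  rw [qf_symPart, h2] at h1
  have := hY x hx
  simp only [zero_mul, add_zero, sq, mul_zero] at h1
  rwa [h1] at this

lemma IsSymFM.levSummable {k : ℤ} {c : MatQ (h + 1) → ℂ} (hc : IsSymFM h 1 k c) :
    LevSummable c := by
  intro m Z hZ
  have hs : SuppIndex c := hc.1
  obtain ⟨φ, hφ⟩ := hc.2.2 (oneByOne m) (oneByOne_index m).1 (oneByOne_index m).2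
  rw [← symPart_mem_Om (hs.lev m), ← imM_cpt 0 (symPart _), mem_Om_imM]
  refine (hasSum_lev_of_jacobiF hs φ hφ ?_ ?_).summable.norm
  · ext i j
    simp [cpt, (symPart_isSymm (imM Z)).apply i j]
  · rw [mem_jacobiDomain_iff, imM_cpt]
    exact topBlk_symPart_PD (mem_jacobiDomain_iff.mp hZ)

end Blocks

section ConvergentSeries

open Filter Topology PowerSeries

variable {K : Type*}

/-- Power series over a ring of functions whose coefficients grow at most geometrically,
uniformly in the point. -/
def convSub (K : Type*) : Subring (PowerSeries (K → ℂ)) where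
  carrier := {f | ∃ C R : ℝ, 0 ≤ C ∧ 0 ≤ R ∧ ∀ m x, ‖coeff m f x‖ ≤ C * R ^ m}
  zero_mem' := ⟨0, 0, le_rfl, le_rfl, fun m x => by simp⟩
  one_mem' := ⟨1, 1, zero_le_one, zero_le_one, fun m x => by
    rw [coeff_one]; split_ifs <;> simp⟩
  neg_mem' := by
    rintro f ⟨C, R, hC, hR, h⟩
    exact ⟨C, R, hC, hR, fun m x => by simpa using h m x⟩
  add_mem' := by
    rintro f f' ⟨C, R, hC, hR, h⟩ ⟨C', R', hC', hR', h'⟩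
    refine ⟨C + C', max R R', by positivity, le_max_of_le_left hR, fun m x => ?_⟩
    rw [map_add, Pi.add_apply, add_mul]
    refine (norm_add_le _ _).trans (add_le_add ((h m x).trans ?_) ((h' m x).trans ?_))
    · gcongr; exact le_max_left _ _
    · gcongr; exact le_max_right _ _
  mul_mem' := by
    rintro f f' ⟨C, R, hC, hR, h⟩ ⟨C', R', hC', hR', h'⟩
    refine ⟨C * C', 2 * max R R', by positivity, by positivity, fun m x => ?_⟩
    rw [coeff_mul, Finset.sum_apply]
    refine (norm_sum_le _ _).trans ?_
    have : ∀ p ∈ Finset.HasAntidiagonal.antidiagonal m, ‖(coeff p.1 f * coeff p.2 f') x‖ ≤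
        C * C' * max R R' ^ m := fun p hp => by
      rw [Pi.mul_apply, norm_mul, ← Finset.HasAntidiagonal.mem_antidiagonal.mp hp, pow_add]
      calc _ ≤ (C * R ^ p.1) * (C' * R' ^ p.2) :=
            mul_le_mul (h _ x) (h' _ x) (norm_nonneg _) (by positivity)
        _ ≤ (C * max R R' ^ p.1) * (C' * max R R' ^ p.2) := by
            gcongr
            · exact le_max_left _ _
            · exact le_max_right _ _
        _ = _ := by ring
    refine (Finset.sum_le_sum this).trans ?_
    rw [Finset.sum_const, Finset.Nat.card_antidiagonal, nsmul_eq_mul, mul_pow]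
    have h2 : ((m + 1 : ℕ) : ℝ) ≤ 2 ^ m := by exact_mod_cast Nat.lt_two_pow_self
    calc _ ≤ 2 ^ m * (C * C' * max R R' ^ m) := by gcongr
      _ = _ := by ring

lemma convSub_of_X_pow_mul {n : ℕ} {f : PowerSeries (K → ℂ)} (h : X ^ n * f ∈ convSub K) :
    f ∈ convSub K := by
  obtain ⟨C, R, hC, hR, h⟩ := h
  refine ⟨C * R ^ n, R, by positivity, hR, fun m x => ?_⟩
  have := h (m + n) x
  rw [coeff_X_pow_mul, pow_add] at this
  linarith

lemma X_mem_convSub : (X : PowerSeries (K → ℂ)) ∈ convSub K :=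
  ⟨1, 1, zero_le_one, zero_le_one, fun m x => by rw [coeff_X]; split_ifs <;> simp⟩

lemma C_mem_convSub {a : K → ℂ} {B : ℝ} (h : ∀ x, ‖a x‖ ≤ B) :
    C a ∈ convSub K := by
  refine ⟨max B 0, 0, le_max_right _ _, le_rfl, fun m x => ?_⟩
  rw [coeff_C]
  split_ifs with h0
  · subst h0; simpa using Or.inl (h x)
  · simp [h0]

lemma bounded_of_mem_convSub {f : PowerSeries (K → ℂ)} (h : f ∈ convSub K) (m : ℕ) :
    ∃ B, ∀ x, ‖coeff m f x‖ ≤ B := by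
  obtain ⟨C, R, -, -, h⟩ := h
  exact ⟨_, h m⟩

/-- Weighted partial sums of the coefficients. -/
def wsum (r : ℝ) (M : ℕ) (x : K) (f : PowerSeries (K → ℂ)) : ℝ :=
  ∑ m ∈ Finset.range M, ‖coeff m f x‖ * r ^ m

lemma wsum_nonneg {r : ℝ} (hr : 0 ≤ r) (M : ℕ) (x : K) (f : PowerSeries (K → ℂ)) :
    0 ≤ wsum r M x f := Finset.sum_nonneg fun _ _ => by positivity

lemma wsum_add_le {r : ℝ} (hr : 0 ≤ r) (M : ℕ) (x : K) (f f' : PowerSeries (K → ℂ)) :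
    wsum r M x (f + f') ≤ wsum r M x f + wsum r M x f' := by
  rw [wsum, wsum, wsum, ← Finset.sum_add_distrib]
  refine Finset.sum_le_sum fun m _ => ?_
  rw [← add_mul, map_add, Pi.add_apply]
  gcongr
  exact norm_add_le _ _

lemma wsum_sum_le {ι : Type*} {r : ℝ} (hr : 0 ≤ r) (M : ℕ) (x : K) (s : Finset ι)
    (f : ι → PowerSeries (K → ℂ)) :
    wsum r M x (∑ i ∈ s, f i) ≤ ∑ i ∈ s, wsum r M x (f i) := by
  classical
  induction s using Finset.induction_on with
  | empty => simp [wsum]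
  | insert i s hi ih =>
    rw [Finset.sum_insert hi, Finset.sum_insert hi]
    exact (wsum_add_le hr M x _ _).trans (by gcongr)

lemma wsum_mul_le {r : ℝ} (hr : 0 ≤ r) (M : ℕ) (x : K) (f f' : PowerSeries (K → ℂ)) :
    wsum r M x (f * f') ≤ wsum r M x f * wsum r M x f' := by
  rw [wsum, wsum, wsum, Finset.sum_mul_sum, ← Finset.sum_product']
  set F : ℕ × ℕ → ℝ := fun p => ‖coeff p.1 f x‖ * r ^ p.1 * (‖coeff p.2 f' x‖ * r ^ p.2)
  have hF : ∀ p, 0 ≤ F p := fun p => by positivity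
  refine le_trans (Finset.sum_le_sum fun m hm => ?_)
    (Finset.sum_fiberwise_le_sum_of_sum_fiber_nonneg (s := Finset.range M ×ˢ Finset.range M)
      (t := Finset.range M) (g := fun p => p.1 + p.2) (f := F)
      fun y _ => Finset.sum_nonneg fun p _ => hF p)
  rw [coeff_mul, Finset.sum_apply]
  have hs : (Finset.range M ×ˢ Finset.range M).filter (fun p => p.1 + p.2 = m) =
      Finset.HasAntidiagonal.antidiagonal m := by
    ext p
    simp only [Finset.mem_filter, Finset.mem_product, Finset.mem_range,
      Finset.HasAntidiagonal.mem_antidiagonal] at hm ⊢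
    omega
  rw [hs]
  refine (mul_le_mul_of_nonneg_right (norm_sum_le _ _) (by positivity)).trans ?_
  rw [Finset.sum_mul]
  refine Finset.sum_le_sum fun p hp => le_of_eq ?_
  rw [Pi.mul_apply, norm_mul, ← Finset.HasAntidiagonal.mem_antidiagonal.mp hp, pow_add]
  ring

lemma wsum_one_le (r : ℝ) (M : ℕ) (x : K) : wsum r M x 1 ≤ 1 := by
  rw [wsum]
  cases M with
  | zero => simp
  | succ M => rw [Finset.sum_range_succ']; simp [coeff_one]

lemma wsum_pow_le {r : ℝ} (hr : 0 ≤ r) (M : ℕ) (x : K) (f : PowerSeries (K → ℂ)) (j : ℕ) :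
    wsum r M x (f ^ j) ≤ wsum r M x f ^ j := by
  induction j with
  | zero => simpa using wsum_one_le r M x
  | succ j ih =>
    rw [pow_succ, pow_succ]
    exact (wsum_mul_le hr M x _ _).trans
      (mul_le_mul_of_nonneg_right ih (wsum_nonneg hr M x f))

lemma wsum_X_mul (r : ℝ) (M : ℕ) (x : K) (f : PowerSeries (K → ℂ)) :
    wsum r (M + 1) x (X * f) = r * wsum r M x f := by
  rw [wsum, wsum, Finset.sum_range_succ', Finset.mul_sum]
  simp only [coeff_succ_X_mul, coeff_zero_X_mul, Pi.zero_apply, norm_zero, zero_mul, add_zero]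
  refine Finset.sum_congr rfl fun m _ => by ring

lemma exists_wsum_le {f : PowerSeries (K → ℂ)} (hf : f ∈ convSub K) :
    ∃ B, 0 ≤ B ∧ ∀ᶠ r : ℝ in 𝓝[>] 0, ∀ M x, wsum r M x f ≤ B := by
  obtain ⟨C, R, hC, hR, h⟩ := hf
  refine ⟨C * 2, by positivity, ?_⟩
  have h1 : ∀ᶠ r : ℝ in 𝓝[>] 0, r * R < 1 / 2 := by
    have : Tendsto (fun r : ℝ => r * R) (𝓝[>] 0) (𝓝 (0 * R)) :=
      (tendsto_id.mono_left nhdsWithin_le_nhds).mul_const R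
    rw [zero_mul] at this
    exact this.eventually_lt_const (by norm_num)
  filter_upwards [h1, self_mem_nhdsWithin] with r hr (hr0 : 0 < r) M x
  calc wsum r M x f ≤ ∑ m ∈ Finset.range M, C * (1 / 2) ^ m := by
        refine Finset.sum_le_sum fun m _ => ?_
        calc ‖coeff m f x‖ * r ^ m ≤ C * R ^ m * r ^ m := by gcongr; exact h m x
          _ = C * (r * R) ^ m := by rw [mul_pow]; ring
          _ ≤ _ := by gcongr
    _ ≤ C * 2 := by
        rw [← Finset.mul_sum]
        gcongr
        have := sum_geometric_two_le M
        simpa using this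

/-- Fixed points of a contracting polynomial recursion are convergent. -/
lemma mem_convSub_of_eq_add_X_mul {g : PowerSeries (K → ℂ)} (e : convSub K)
    (p : Polynomial (convSub K)) 
    (h : g = (e : PowerSeries (K → ℂ)) + X * Polynomial.aeval g p) : g ∈ convSub K := by
  obtain ⟨B, hB0, hB⟩ := exists_wsum_le e.2
  choose b hb0 hb using fun j : ℕ => exists_wsum_le (p.coeff j).2
  set L := B + 1
  set n := p.natDegree
  set D := ∑ j ∈ Finset.range (n + 1), b j * L ^ j
  have hD : 0 ≤ D := Finset.sum_nonneg fun j _ => mul_nonneg (hb0 j) (by positivity)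
  have h1 : ∀ᶠ r : ℝ in 𝓝[>] 0, r * D < 1 := by
    have : Tendsto (fun r : ℝ => r * D) (𝓝[>] 0) (𝓝 (0 * D)) :=
      (tendsto_id.mono_left nhdsWithin_le_nhds).mul_const D
    rw [zero_mul] at this
    exact this.eventually_lt_const zero_lt_one
  have h2 : ∀ᶠ r : ℝ in 𝓝[>] 0, ∀ j ∈ Finset.range (n + 1), ∀ M x,
      wsum r M x (p.coeff j : PowerSeries (K → ℂ)) ≤ b j :=
    (Filter.eventually_all_finset _).mpr fun j _ => hb j
  obtain ⟨r, hr1, hr2, hrB, hr0⟩ :=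
    (h1.and (h2.and (hB.and self_mem_nhdsWithin))).exists
  replace hr0 : 0 < r := hr0
  have key : ∀ M x, wsum r M x g ≤ L := by
    intro M x
    induction M with
    | zero => simp only [wsum, Finset.range_zero, Finset.sum_empty]; positivity
    | succ M ih =>
      rw [h]
      refine (wsum_add_le hr0.le _ x _ _).trans (add_le_add (hrB _ x) ?_)
      rw [wsum_X_mul]
      refine le_trans (mul_le_mul_of_nonneg_left ?_ hr0.le) hr1.le
      rw [Polynomial.aeval_eq_sum_range]
      refine (wsum_sum_le hr0.le M x _ _).trans (Finset.sum_le_sum fun j hj => ?_)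
      rw [Subring.smul_def, smul_eq_mul]
      refine (wsum_mul_le hr0.le M x _ _).trans (mul_le_mul (hr2 j hj M x) ?_
        (wsum_nonneg hr0.le M x _) (hb0 j))
      exact (wsum_pow_le hr0.le M x g j).trans
        (pow_le_pow_left₀ (wsum_nonneg hr0.le M x g) ih j)
  refine ⟨L, r⁻¹, by positivity, by positivity, fun m x => ?_⟩
  have h3 : ‖coeff m g x‖ * r ^ m ≤ L :=
    (Finset.single_le_sum (f := fun m => ‖coeff m g x‖ * r ^ m) (fun _ _ => by positivity)
      (Finset.self_mem_range_succ m)).trans (key (m + 1) x)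
  rw [inv_pow, ← div_eq_mul_inv, le_div_iff₀ (by positivity)]
  exact h3

lemma exists_reduced_equation {B : Type*} [CommRing B] (S : Subring B) {x : B}
    (hS : ∀ n b, x ^ n * b ∈ S → b ∈ S)
    (P : S) (q : Polynomial S) {s : ℕ} {f g v : B} (hf : f = x ^ (s + 1) * g + algebraMap S B P)
    (hq : Polynomial.aeval f q = 0)
    (hv : Polynomial.aeval f (Polynomial.derivative q) = x ^ s * v) :
    ∃ v' ∈ S, ∃ (e : S) (U : Polynomial S), x ∣ v - v' ∧
      (e : B) + v' * g + x * Polynomial.aeval (x ^ (s + 1) * g) U * g ^ 2 = 0 := by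
  have key (T : Polynomial S) (y : B) : Polynomial.aeval y T =
      Polynomial.aeval y T.divX.divX * y ^ 2 + T.coeff 1 * y + T.coeff 0 := by
    conv_lhs => rw [← Polynomial.divX_mul_X_add T, ← Polynomial.divX_mul_X_add T.divX]
    simp only [map_add, map_mul, Polynomial.aeval_X, Polynomial.aeval_C, Polynomial.coeff_divX]
    change (_ * y + (T.coeff 1 : B)) * y + (T.coeff 0 : B) = _
    ring
  have hroot : Polynomial.aeval (x ^ (s + 1) * g) (Polynomial.taylor P q) = 0 := by
    rw [← hq, hf, Polynomial.taylor_apply, Polynomial.aeval_comp]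
    simp
  rw [key] at hroot
  have h1 : (((Polynomial.taylor P q).coeff 1 : S) : B) =
      Polynomial.aeval (algebraMap S B P) (Polynomial.derivative q) := by
    rw [Polynomial.taylor_coeff_one, Polynomial.aeval_algebraMap_apply]
    rfl
  obtain ⟨u, hu⟩ : x ^ (s + 1) * g ∣ x ^ s * v - (((Polynomial.taylor P q).coeff 1 : S) : B) := by
    rw [h1, ← hv]
    have := Polynomial.sub_dvd_eval_sub f (algebraMap S B P)
      ((Polynomial.derivative q).map (algebraMap S B))
    rw [Polynomial.eval_map_algebraMap, Polynomial.eval_map_algebraMap] at this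
    refine dvd_trans (dvd_of_eq ?_) this
    rw [hf]
    ring
  have h2 : (((Polynomial.taylor P q).coeff 1 : S) : B) = x ^ s * (v - x * (g * u)) := by
    rw [← sub_sub_cancel (x ^ s * v) (((Polynomial.taylor P q).coeff 1 : S) : B), hu]
    ring
  set U := (Polynomial.taylor P q).divX.divX
  have h0 : (((Polynomial.taylor P q).coeff 0 : S) : B) = x ^ (s + (s + 1)) *
      (-((v - x * (g * u)) * g + x * Polynomial.aeval (x ^ (s + 1) * g) U * g ^ 2)) := by
    rw [h2] at hroot
    linear_combination hroot
  refine ⟨v - x * (g * u), hS s _ (h2 ▸ SetLike.coe_mem _), ⟨_, hS _ _ (h0 ▸ SetLike.coe_mem _)⟩, U,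
    ⟨g * u, by ring⟩, ?_⟩
  change -(_ + _) + _ + _ = (0 : B)
  ring

/-- A formal power series which is a root of a polynomial with convergent coefficients is
convergent, provided that the derivative has a lowest coefficient bounded away from zero. -/
lemma mem_convSub_of_root {f : PowerSeries (K → ℂ)} (hf : ∀ m, ∃ B, ∀ x, ‖coeff m f x‖ ≤ B)
    (q : Polynomial (convSub K)) (hq : Polynomial.aeval f q = 0) {s : ℕ}
    {v : PowerSeries (K → ℂ)} (hv : Polynomial.aeval f (Polynomial.derivative q) = X ^ s * v)
    {η : ℝ} (hη : 0 < η) (hδ : ∀ x, η ≤ ‖coeff 0 v x‖) : f ∈ convSub K := by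
  have htr : (f.trunc (s + 1) : PowerSeries (K → ℂ)) ∈ convSub K := by
    choose B hB using hf
    refine ⟨∑ m ∈ Finset.range (s + 1), |B m|, 1, by positivity, zero_le_one, fun m x => ?_⟩
    rw [Polynomial.coeff_coe, coeff_trunc, one_pow, mul_one]
    split_ifs with hm
    · exact ((hB m x).trans (le_abs_self _)).trans (Finset.single_le_sum
        (f := fun m => |B m|) (fun _ _ => abs_nonneg _) (Finset.mem_range.mpr hm))
    · simpa using Finset.sum_nonneg fun _ _ => abs_nonneg _
  set P : convSub K := ⟨_, htr⟩ with hP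
  set g := PowerSeries.mk fun i => coeff (i + (s + 1)) f
  have hg : f = X ^ (s + 1) * g + algebraMap (convSub K) (PowerSeries (K → ℂ)) P := by
    rw [mul_comm]
    exact eq_shift_mul_X_pow_add_trunc (s + 1) f
  obtain ⟨v', hv', e, U, ⟨w, hw⟩, hE⟩ := exists_reduced_equation (convSub K)
    (fun n b => convSub_of_X_pow_mul)
    P q hg hq hv
  set δ := coeff 0 v
  have hv'0 : coeff 0 v' = δ := by
    have : v' = v - X * w := by rw [← hw]; ring
    rw [this, map_sub, coeff_zero_X_mul, sub_zero]
  have hCδ : C δ ∈ convSub K := by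
    obtain ⟨B, hB⟩ := bounded_of_mem_convSub hv' 0
    rw [hv'0] at hB
    exact C_mem_convSub hB
  have hCi : C δ⁻¹ ∈ convSub K := by
    refine C_mem_convSub (B := η⁻¹) fun x => ?_
    rw [Pi.inv_apply, norm_inv]
    exact inv_anti₀ hη (hδ x)
  have hinv : C δ⁻¹ * C δ = (1 : PowerSeries (K → ℂ)) := by
    rw [← map_mul, ← map_one C]
    congr 1
    refine funext fun x => inv_mul_cancel₀ ?_
    exact norm_pos_iff.mp (hη.trans_le (hδ x))
  obtain ⟨w', hw'⟩ : X ∣ v' - C δ := by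
    rw [X_dvd_iff, map_sub, ← coeff_zero_eq_constantCoeff_apply, hv'0,
      ← coeff_zero_eq_constantCoeff_apply, coeff_zero_C, sub_self]
  have hw'S : w' ∈ convSub K := by
    refine convSub_of_X_pow_mul (n := 1) ?_
    rw [pow_one, ← hw']
    exact sub_mem hv' hCδ
  have hgS : g ∈ convSub K := by
    refine mem_convSub_of_eq_add_X_mul (⟨C δ⁻¹, hCi⟩ * (-e))
      (Polynomial.C (-⟨C δ⁻¹, hCi⟩) * (Polynomial.C ⟨w', hw'S⟩ * Polynomial.X +
        U.comp (Polynomial.C (⟨X, X_mem_convSub⟩ ^ (s + 1)) * Polynomial.X) *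
          Polynomial.X ^ 2)) ?_
    simp only [map_mul, map_add, Polynomial.aeval_C, Polynomial.aeval_X, Polynomial.aeval_comp,
      map_pow, map_neg, Subring.coe_mul, Subring.coe_neg]
    change g = C δ⁻¹ * (-(e : PowerSeries (K → ℂ))) + X * (-(C δ⁻¹) * (w' * g +
      Polynomial.aeval (X ^ (s + 1) * g) U * g ^ 2))
    have hv2 : v' = C δ + X * w' := by rw [← hw']; ring
    rw [hv2] at hE
    linear_combination g * hinv.symm + C δ⁻¹ * hE
  rw [hg]
  exact add_mem (mul_mem (pow_mem X_mem_convSub _) hgS) htr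

end ConvergentSeries

section LocalBounds

open Filter Topology

lemma qf_add_smul_lastE {h : ℕ} (Y : MatR (h + 1)) (M : ℝ) (x : Fin (h + 1) → ℝ) :
    qf (Y + M • lastE h) x = qf Y x + M * x (Fin.last h) ^ 2 := by
  rw [qf_add, qf_smul, qf_lastE]

lemma norm_ser_le {b : MatQ g → ℂ} (hb : SuppIndex b) {Z : MatC g} {Y : MatR g} (hY : Y ∈ Om b)
    (h : ∀ x, 0 ≤ qf (imM Z - Y) x) :
    ‖ser b Z‖ ≤ ∑' t, ‖b t‖ * Real.exp (-(2 * Real.pi * trQ t Y)) := by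
  have hZ := mem_Om_imM.mp (Om_mono hb hY h)
  refine (norm_tsum_le_tsum_norm hZ).trans (hZ.tsum_le_tsum (fun t => ?_) hY)
  rw [norm_mul, norm_eMat]
  exact hb.norm_mul_le h t

lemma eventually_imM_ge (Z0 : MatC g) {ε : ℝ} (hε : 0 < ε) :
    ∀ᶠ Z in 𝓝 Z0, ∀ x, 0 ≤ qf (imM Z - (imM Z0 - ε • (1 : MatR g))) x := by
  have h1 : ∀ᶠ Z in 𝓝 Z0, ‖Z - Z0‖ < ε / ((g : ℝ) ^ 2 + 1) := by
    have := Metric.ball_mem_nhds Z0 (ε := ε / ((g : ℝ) ^ 2 + 1)) (by positivity)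
    filter_upwards [this] with Z hZ
    rwa [← dist_eq_norm]
  filter_upwards [h1] with Z hZ x
  rw [sub_sub_eq_add_sub, add_sub_right_comm, ← imM_sub, qf_add, qf_smul, qf_one]
  have h2 := (abs_le.mp (abs_qf_le (imM (Z - Z0)) x)).1
  have h3 := dotProduct_self_nonneg_real x
  have h4 : (g : ℝ) ^ 2 * ‖imM (Z - Z0)‖ ≤ ε := by
    have := (norm_imM_le (Z - Z0)).trans hZ.le
    rw [le_div_iff₀ (by positivity)] at this
    nlinarith [norm_nonneg (imM (Z - Z0))]
  nlinarith [mul_le_mul_of_nonneg_right h4 h3]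

variable {h : ℕ}

lemma exists_lower_bound_lastE {Z0 : MatC (h + 1)} (hZ0 : Z0 ∈ jacobiDomain h) :
    ∃ M ε : ℝ, 0 ≤ M ∧ 0 < ε ∧ PD (imM Z0 + M • lastE h - ε • 1) := by
  obtain ⟨M, hM⟩ := exists_add_lastE_PD (mem_jacobiDomain_iff.mp hZ0)
  obtain ⟨ε, hε, h1⟩ := exists_pos_lower_bound (hM (max M 0) (le_max_left _ _))
  refine ⟨max M 0, ε / 2, le_max_right _ _, by positivity, fun x hx => ?_⟩
  rw [qf_sub, qf_smul, qf_one]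
  nlinarith [h1 x, dotProduct_self_pos_real hx]

lemma isOpen_jacobiDomain (h : ℕ) : IsOpen (jacobiDomain h) := by
  rw [isOpen_iff_mem_nhds]
  intro Z0 hZ0
  obtain ⟨M, ε, hM, hε, h1⟩ := exists_lower_bound_lastE hZ0
  filter_upwards [eventually_imM_ge Z0 hε] with Z hZ x hx hl
  have h2 := h1 x hx
  have h3 := hZ x
  rw [qf_sub, qf_add_smul_lastE, hl] at h2
  rw [qf_sub, qf_sub] at h3
  linarith [h2, h3]

lemma convex_jacobiDomain (h : ℕ) : Convex ℝ (jacobiDomain h) := by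
  intro Z hZ W hW a b ha hb hab x hx hl
  have h1 : imM (a • Z + b • W) = a • imM Z + b • imM W := by
    ext i j; simp [imM]
  rw [h1, qf_add, qf_smul, qf_smul]
  have h2 := hZ x hx hl
  have h3 := hW x hx hl
  rcases eq_or_lt_of_le ha with rfl | ha
  · rw [zero_add] at hab; subst hab; linarith
  · nlinarith [mul_pos ha h2, mul_nonneg hb h3.le]

/-- Levels of a series converging on all positive definite matrices grow geometrically. -/
lemma exists_lev_bound {b : MatQ (h + 1) → ℂ} (hb : SuppIndex b) (hO : ∀ Y, PD Y → Y ∈ Om b)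
    {K : Set (MatC (h + 1))} (hK : IsCompact K) (hKV : K ⊆ jacobiDomain h) :
    ∃ C R : ℝ, 0 ≤ C ∧ 0 ≤ R ∧ ∀ Z ∈ K, ∀ m, ‖ser (lev b m) Z‖ ≤ C * R ^ m := by
  refine hK.induction_on (p := fun S => ∃ C R : ℝ, 0 ≤ C ∧ 0 ≤ R ∧ ∀ Z ∈ S, ∀ m,
    ‖ser (lev b m) Z‖ ≤ C * R ^ m) ⟨0, 0, le_rfl, le_rfl, fun _ h => h.elim⟩ ?_ ?_ ?_
  · rintro S T hST ⟨C, R, hC, hR, H⟩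
    exact ⟨C, R, hC, hR, fun Z hZ => H Z (hST hZ)⟩
  · rintro S T ⟨C, R, hC, hR, H⟩ ⟨C', R', hC', hR', H'⟩
    refine ⟨max C C', max R R', le_max_of_le_left hC, le_max_of_le_left hR, fun Z hZ m => ?_⟩
    rcases hZ with hZ | hZ
    · refine (H Z hZ m).trans ?_
      gcongr <;> exact le_max_left _ _
    · refine (H' Z hZ m).trans ?_
      gcongr <;> exact le_max_right _ _
  · intro Z0 hZ0
    obtain ⟨M, ε, hM, hε, h1⟩ := exists_lower_bound_lastE (hKV hZ0)
    set Y := imM Z0 + M • lastE h - ε • (1 : MatR (h + 1)) with hY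
    refine ⟨_, mem_nhdsWithin_of_mem_nhds (eventually_imM_ge Z0 hε),
      ∑' t, ‖b t‖ * Real.exp (-(2 * Real.pi * trQ t Y)), Real.exp (2 * Real.pi * M),
      tsum_nonneg fun t => by positivity, by positivity, fun Z hZ m => ?_⟩
    have hYm : Y ∈ Om (lev b m) := Om_lev_of_Om m (hO Y h1)
    have hY' : Y = (imM Z0 - ε • (1 : MatR (h + 1))) + M • lastE h := by rw [hY]; abel
    have h2 : imM Z0 - ε • (1 : MatR (h + 1)) ∈ Om (lev b m) := by
      rwa [hY', add_lastE_mem_Om_lev] at hYm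
    refine (norm_ser_le (hb.lev m) h2 hZ).trans ?_
    rw [← tsum_mul_right]
    refine Summable.tsum_le_tsum (fun t => ?_) h2 ((hO Y h1).mul_right _)
    rw [hY', trQ_add, trQ_smul, trQ_lastE]
    unfold lev
    split_ifs with ht
    · rw [← Real.exp_nat_mul, mul_assoc ‖_‖, ← Real.exp_add, ht]
      refine le_of_eq ?_
      congr 2
      push_cast
      ring
    · rw [norm_zero, zero_mul]; positivity

end LocalBounds

section FourierJacobi

open Filter Topology

variable {h : ℕ}

/-- The functions on the Jacobi domain which are holomorphic. -/
def holoJ (h : ℕ) : Subring (FunJ h) where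
  carrier := {F | ∃ G : MatC (h + 1) → ℂ, DifferentiableOn ℂ G (jacobiDomain h) ∧ ∀ Z, F Z = G Z.1}
  zero_mem' := ⟨fun _ => 0, differentiableOn_const _, fun _ => rfl⟩
  one_mem' := ⟨fun _ => 1, differentiableOn_const _, fun _ => rfl⟩
  neg_mem' := by
    rintro F ⟨G, hG, h1⟩
    exact ⟨fun Z => -G Z, hG.neg, fun Z => by rw [Pi.neg_apply, h1]⟩
  add_mem' := by
    rintro F F' ⟨G, hG, h1⟩ ⟨G', hG', h2⟩
    exact ⟨fun Z => G Z + G' Z, hG.add hG', fun Z => by rw [Pi.add_apply, h1, h2]⟩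
  mul_mem' := by
    rintro F F' ⟨G, hG, h1⟩ ⟨G', hG', h2⟩
    exact ⟨fun Z => G Z * G' Z, hG.mul hG', fun Z => by rw [Pi.mul_apply, h1, h2]⟩

/-- Power series with coefficients in a subring. -/
def coeffSub {A : Type*} [CommRing A] (S : Subring A) : Subring (PowerSeries A) where
  carrier := {f | ∀ m, PowerSeries.coeff m f ∈ S}
  zero_mem' := fun m => by simp [zero_mem]
  one_mem' := fun m => by rw [PowerSeries.coeff_one]; split_ifs; exacts [one_mem _, zero_mem _]
  neg_mem' := fun h m => by rw [map_neg]; exact neg_mem (h m)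
  add_mem' := fun h h' m => by rw [map_add]; exact add_mem (h m) (h' m)
  mul_mem' := fun h h' m => by
    rw [PowerSeries.coeff_mul]; exact sum_mem fun p _ => mul_mem (h _) (h' _)

lemma coeff_fjSeries (b : MatQ (h + 1) → ℂ) (m : ℕ) (Z) :
    PowerSeries.coeff m (fjSeries b) Z = ser (lev b m) Z.1 := by
  rw [fjSeries, PowerSeries.coeff_mk]

lemma differentiableOn_lev {b : MatQ (h + 1) → ℂ} (hb : SuppIndex b) (h1 : LevSummable b) (m : ℕ) :
    DifferentiableOn ℂ (ser (lev b m)) (jacobiDomain h) :=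
  differentiableOn_ser (hb.lev m) (isOpen_jacobiDomain h) (h1 m)

lemma fjSeries_mem {b : MatQ (h + 1) → ℂ} (hb : SuppIndex b) (h1 : LevSummable b) :
    fjSeries b ∈ coeffSub (holoJ h) := fun m =>
  ⟨ser (lev b m), differentiableOn_lev hb h1 m, coeff_fjSeries b m⟩

lemma fjSeries_ne_zero {b : MatQ (h + 1) → ℂ} (hb : SuppIndex b) (h1 : LevSummable b)
    (hne : b ≠ 0) : fjSeries b ≠ 0 := by
  intro h0
  obtain ⟨t, ht⟩ := Function.ne_iff.mp hne
  obtain ⟨m, hm⟩ := (hb t ht).exists_level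
  have hY : ∀ W : MatR (h + 1), cpt W 1 ∈ jacobiDomain h := fun W x hx _ => by
    rw [imM_cpt, qf_one]
    exact dotProduct_self_pos_real hx
  have hz : ∀ W : MatR (h + 1), ser (lev b m) (cpt W 1) = 0 := fun W => by
    rw [← coeff_fjSeries b m ⟨_, hY W⟩, h0, map_zero, Pi.zero_apply]
  have h2 := norm_term_le_of_sup (hb.lev m) (B := 0) (by
    have := h1 m _ (hY 0)
    rwa [imM_cpt] at this) (fun W _ => by rw [hz, norm_zero]) t
  rw [lev, if_pos hm] at h2
  exact ht (norm_le_zero_iff.mp (nonpos_of_mul_nonpos_left h2 (Real.exp_pos _)))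

end FourierJacobi

section LocalConvergence

open Filter Topology

lemma exists_iterate_derivative_ne {B : Type*} [CommRing B]
    (hB : ∀ (n : ℕ) (b : B), n ≠ 0 → n • b = 0 → b = 0) {q : Polynomial B} (hq : q ≠ 0) {f : B}
    (hf : q.eval f = 0) : ∃ j : ℕ, (Polynomial.derivative^[j] q).eval f = 0 ∧
      (Polynomial.derivative^[j + 1] q).eval f ≠ 0 := by
  classical
  have hex : ∃ j : ℕ, (Polynomial.derivative^[j] q).eval f ≠ 0 := by
    refine ⟨q.natDegree, fun h0 => hq ?_⟩
    have h1 : Polynomial.derivative^[q.natDegree] q =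
        q.natDegree.factorial • Polynomial.C q.leadingCoeff := by
      rw [← Polynomial.hasseDeriv_natDegree_eq_C, ← Polynomial.factorial_smul_hasseDeriv]
      rfl
    rw [h1, Polynomial.eval_smul, Polynomial.eval_C] at h0
    exact Polynomial.leadingCoeff_eq_zero.mp (hB _ _ (Nat.factorial_ne_zero _) h0)
  have h0 : Nat.find hex ≠ 0 := fun h => by
    have := Nat.find_spec hex
    rw [h] at this
    exact this hf
  obtain ⟨j, hj⟩ := Nat.exists_eq_succ_of_ne_zero h0
  refine ⟨j, ?_, ?_⟩
  · by_contra hne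
    have := Nat.find_min' hex hne
    omega
  · have := Nat.find_spec hex
    rwa [hj] at this

variable {h : ℕ}

lemma levSummable_of_Om {b : MatQ (h + 1) → ℂ} (hO : ∀ Y, PD Y → Y ∈ Om b) : LevSummable b := by
  intro m Z hZ
  obtain ⟨M, hM⟩ := exists_add_lastE_PD (mem_jacobiDomain_iff.mp hZ)
  exact (add_lastE_mem_Om_lev M).mp (Om_lev_of_Om m (hO _ (hM M le_rfl)))

lemma fjSeries_sum {d : ℕ} {u : Fin (d + 1) → MatQ (h + 1) → ℂ} (hu : ∀ i, LevSummable (u i)) :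
    fjSeries (fun t => ∑ i, u i t) = ∑ i, fjSeries (u i) := by
  refine PowerSeries.ext fun m => funext fun Z => ?_
  rw [coeff_fjSeries, map_sum, Finset.sum_apply]
  simp only [coeff_fjSeries]
  rw [← (Om_sum Finset.univ (b := fun i => lev (u i) m) (τ := Z.1) fun i _ => hu i m Z.1 Z.2).2]
  congr 1
  refine funext fun t => ?_
  unfold lev
  rw [Finset.ite_sum_zero]

/-- Restriction of functions on the Jacobi domain to a subset. -/
def resJ {K : Set (MatC (h + 1))} (hK : K ⊆ jacobiDomain h) : FunJ h →+* (K → ℂ) :=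
  RingHom.pi fun x => Pi.evalRingHom (fun _ => ℂ) ⟨x.1, hK x.2⟩

lemma resJ_apply {K : Set (MatC (h + 1))} (hK : K ⊆ jacobiDomain h) (F : FunJ h) (x : K) :
    resJ hK F x = F ⟨x.1, hK x.2⟩ := rfl

lemma torsionFree_fjSeries (n : ℕ) (f : PowerSeries (FunJ h)) (hn : n ≠ 0) (h0 : n • f = 0) :
    f = 0 := by
  refine PowerSeries.ext fun m => funext fun Z => ?_
  have h1 : PowerSeries.coeff m (n • f) Z = 0 := by rw [h0, map_zero]; rfl
  rw [map_nsmul] at h1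
  change n • (PowerSeries.coeff m f Z) = 0 at h1
  rw [nsmul_eq_mul, mul_eq_zero] at h1
  exact h1.resolve_left (Nat.cast_ne_zero.mpr hn)

/-- Levels of a root of a polynomial grow geometrically on compact sets on which the lowest
coefficient of the derivative does not vanish. -/
lemma lev_bound_of_ne_zero {d : ℕ} {b : Fin (d + 1) → MatQ (h + 1) → ℂ}
    (hb : ∀ i, SuppIndex (b i)) (hO : ∀ i Y, PD Y → Y ∈ Om (b i)) {c : MatQ (h + 1) → ℂ}
    (hc : SuppIndex c) (hl : LevSummable c) {j s : ℕ} {v : PowerSeries (FunJ h)}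
    (hq : (Polynomial.derivative^[j] (∑ i : Fin (d + 1), Polynomial.C (fjSeries (b i)) *
      Polynomial.X ^ (i : ℕ))).eval (fjSeries c) = 0)
    (hv : (Polynomial.derivative^[j + 1] (∑ i : Fin (d + 1), Polynomial.C (fjSeries (b i)) *
      Polynomial.X ^ (i : ℕ))).eval (fjSeries c) = PowerSeries.X ^ s * v)
    {G : MatC (h + 1) → ℂ} (hG : ContinuousOn G (jacobiDomain h))
    (hvG : ∀ Z, PowerSeries.coeff 0 v Z = G Z.1)
    {K : Set (MatC (h + 1))} (hK : IsCompact K) (hKV : K ⊆ jacobiDomain h)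
    (hne : ∀ Z ∈ K, G Z ≠ 0) :
    ∃ C R : ℝ, 0 ≤ C ∧ 0 ≤ R ∧ ∀ Z ∈ K, ∀ m, ‖ser (lev c m) Z‖ ≤ C * R ^ m := by
  set Φ := PowerSeries.map (resJ hKV)
  have hbS : ∀ i, Φ (fjSeries (b i)) ∈ convSub K := fun i => by
    obtain ⟨C, R, hC, hR, H⟩ := exists_lev_bound (hb i) (hO i) hK hKV
    refine ⟨C, R, hC, hR, fun m x => ?_⟩
    rw [PowerSeries.coeff_map, resJ_apply, coeff_fjSeries]
    exact H x.1 x.2 m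
  set q : Polynomial (convSub K) := ∑ i : Fin (d + 1),
    Polynomial.C ⟨Φ (fjSeries (b i)), hbS i⟩ * Polynomial.X ^ (i : ℕ) with hqdef
  have hqmap : q.map (algebraMap (convSub K) (PowerSeries (K → ℂ))) =
      (∑ i : Fin (d + 1), Polynomial.C (fjSeries (b i)) * Polynomial.X ^ (i : ℕ)).map Φ := by
    rw [hqdef, Polynomial.map_sum, Polynomial.map_sum]
    refine Finset.sum_congr rfl fun i _ => ?_
    rw [Polynomial.map_mul, Polynomial.map_mul, Polynomial.map_C, Polynomial.map_C,
      Polynomial.map_pow, Polynomial.map_pow, Polynomial.map_X, Polynomial.map_X]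
    rfl
  have key : ∀ n : ℕ, Polynomial.aeval (Φ (fjSeries c)) (Polynomial.derivative^[n] q) =
      Φ ((Polynomial.derivative^[n] (∑ i : Fin (d + 1), Polynomial.C (fjSeries (b i)) *
      Polynomial.X ^ (i : ℕ))).eval (fjSeries c)) := fun n => by
    rw [← Polynomial.eval_map_algebraMap, ← Polynomial.iterate_derivative_map, hqmap,
      Polynomial.iterate_derivative_map, Polynomial.eval_map_apply]
  obtain ⟨η, hη, hηG⟩ : ∃ η > 0, ∀ Z ∈ K, η ≤ ‖G Z‖ := by
    rcases K.eq_empty_or_nonempty with rfl | hKne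
    · exact ⟨1, one_pos, fun _ h => h.elim⟩
    · obtain ⟨Z0, hZ0, hmin⟩ := hK.exists_isMinOn hKne (hG.mono hKV).norm
      exact ⟨_, norm_pos_iff.mpr (hne Z0 hZ0), fun Z hZ => hmin hZ⟩
  obtain ⟨C, R, hC, hR, H⟩ := mem_convSub_of_root (f := Φ (fjSeries c)) (fun m => by
      obtain ⟨B, hB⟩ := hK.exists_bound_of_continuousOn
        ((differentiableOn_lev hc hl m).continuousOn.mono hKV)
      refine ⟨B, fun x => ?_⟩
      rw [PowerSeries.coeff_map, resJ_apply, coeff_fjSeries]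
      exact hB x.1 x.2) (Polynomial.derivative^[j] q) (by rw [key, hq, map_zero])
    (s := s) (v := Φ v) (by
      have hk := key (j + 1)
      rw [hv, Function.iterate_succ_apply'] at hk
      rw [hk, map_mul, map_pow, PowerSeries.map_X]) hη
    (fun x => by
      rw [PowerSeries.coeff_map, resJ_apply, hvG]
      exact hηG x.1 x.2)
  refine ⟨C, R, hC, hR, fun Z hZ m => ?_⟩
  have := H m ⟨Z, hZ⟩
  rwa [PowerSeries.coeff_map, resJ_apply, coeff_fjSeries] at this

/-- Around a point of the domain there is a circle in a given direction which avoids the zeros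
of a nonzero holomorphic function. -/
lemma exists_circle_ne_zero {E : Type*} [NormedAddCommGroup E] [NormedSpace ℂ E] {V : Set E}
    (hV : IsOpen V) (hVc : Convex ℝ V) {G : E → ℂ} (hG : DifferentiableOn ℂ G V) {p0 p1 : E}
    (hp0 : p0 ∈ V) (hp1 : p1 ∈ V) (hne : G p1 ≠ 0) :
    ∃ ρ > 0, ∃ w : E, (∀ z : ℂ, ‖z‖ ≤ ρ → p0 + z • w ∈ V) ∧
      ∀ z : ℂ, ‖z‖ = ρ → G (p0 + z • w) ≠ 0 := by
  set ℓ : ℂ → E := fun z => p0 + z • (p1 - p0) with hℓ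
  have hdℓ : Differentiable ℂ ℓ := by fun_prop
  set D := ℓ ⁻¹' V
  have hD : IsOpen D := hV.preimage hdℓ.continuous
  have hDc : Convex ℝ D := by
    intro z hz w hw a b ha hb hab
    have : ℓ (a • z + b • w) = a • ℓ z + b • ℓ w := by
      simp only [hℓ, smul_add, add_smul, smul_assoc]
      rw [add_add_add_comm, ← add_smul, hab, one_smul]
    change ℓ _ ∈ V
    rw [this]
    exact hVc hz hw ha hb hab
  have h0 : (0 : ℂ) ∈ D := by change ℓ 0 ∈ V; simpa [hℓ] using hp0
  have h1 : (1 : ℂ) ∈ D := by change ℓ 1 ∈ V; simpa [hℓ] using hp1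
  have han : AnalyticOnNhd ℂ (fun z => G (ℓ z)) D :=
    (hG.comp hdℓ.differentiableOn fun z hz => hz).analyticOnNhd hD
  have hev : ∀ᶠ z in 𝓝[≠] (0 : ℂ), G (ℓ z) ≠ 0 := by
    rcases (han 0 h0).eventually_eq_zero_or_eventually_ne_zero with hz | hz
    · have := han.eqOn_zero_of_preconnected_of_eventuallyEq_zero hDc.isPreconnected h0 hz h1
      simp [hℓ] at this
      exact absurd this hne
    · exact hz
  obtain ⟨ε, hε, hball⟩ := Metric.mem_nhdsWithin_iff.mp hev
  obtain ⟨ε', hε', hball'⟩ := Metric.isOpen_iff.mp hD 0 h0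
  refine ⟨min ε ε' / 2, by positivity, p1 - p0, fun z hz => ?_, fun z hz => ?_⟩
  · refine hball' ?_
    rw [mem_ball_zero_iff]
    linarith [min_le_right ε ε', hε']
  · refine hball ⟨?_, ?_⟩
    · rw [mem_ball_zero_iff]
      linarith [min_le_left ε ε', hε]
    · rw [Set.mem_compl_singleton_iff, ← norm_pos_iff, hz]
      positivity

/-- A root of a nonzero polynomial with convergent coefficients converges locally. -/
theorem exists_local_bound {d : ℕ} {b : Fin (d + 1) → MatQ (h + 1) → ℂ}
    (hb : ∀ i, SuppIndex (b i)) (hO : ∀ i Y, PD Y → Y ∈ Om (b i)) (hbne : ∃ i, b i ≠ 0)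
    {c : MatQ (h + 1) → ℂ} (hc : SuppIndex c) (hl : LevSummable c)
    (hrel : ∀ t, ∑ i : Fin (d + 1), convC (b i) (powC c i) t = 0)
    {p0 : MatC (h + 1)} (hp0 : p0 ∈ jacobiDomain h) :
    ∃ C : ℝ, 0 ≤ C ∧ ∀ᶠ p in 𝓝 p0, ∀ m, ‖ser (lev c m) p‖ ≤ C ^ (m + 1) := by
  set q : Polynomial (PowerSeries (FunJ h)) := ∑ i : Fin (d + 1), Polynomial.C (fjSeries (b i)) *
      Polynomial.X ^ (i : ℕ) with hqdef
  have hbl : ∀ i, LevSummable (b i) := fun i => levSummable_of_Om (hO i)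
  have hq0 : q.eval (fjSeries c) = 0 := by
    have h1 : fjSeries (fun t => ∑ i : Fin (d + 1), convC (b i) (powC c i) t) = 0 := by
      rw [funext hrel]
      refine PowerSeries.ext fun m => funext fun Z => ?_
      rw [coeff_fjSeries, map_zero, ser]
      simp [lev]
    rw [fjSeries_sum fun i => levSummable_convC (hb i) (suppIndex_powC hc i) (hbl i)
      (levSummable_powC hc hl i).1] at h1
    rw [hqdef, Polynomial.eval_finsetSum, ← h1]
    refine Finset.sum_congr rfl fun i _ => ?_
    rw [fjSeries_convC (hb i) (suppIndex_powC hc i) (hbl i) (levSummable_powC hc hl i).1,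
      (levSummable_powC hc hl i).2, Polynomial.eval_mul, Polynomial.eval_C, Polynomial.eval_pow,
      Polynomial.eval_X]
  have hqne : q ≠ 0 := by
    obtain ⟨i, hi⟩ := hbne
    intro h0
    refine fjSeries_ne_zero (hb i) (hbl i) hi ?_
    have h1 : q.coeff i = 0 := by rw [h0, Polynomial.coeff_zero]
    rw [hqdef, Polynomial.finsetSum_coeff, Finset.sum_eq_single i] at h1
    · rwa [Polynomial.coeff_C_mul, Polynomial.coeff_X_pow, if_pos rfl, mul_one] at h1
    · intro i' _ hi'
      rw [Polynomial.coeff_C_mul, Polynomial.coeff_X_pow, if_neg, mul_zero]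
      exact fun h => hi' (Fin.ext h.symm)
    · simp
  obtain ⟨j, hj0, hj1⟩ := exists_iterate_derivative_ne torsionFree_fjSeries hqne hq0
  set u := (Polynomial.derivative^[j + 1] q).eval (fjSeries c) with hu
  have humem : u ∈ coeffSub (holoJ h) := by
    have hcoef : ∀ n, ((Polynomial.derivative^[j + 1] q).coeff n) ∈ coeffSub (holoJ h) := by
      intro n
      rw [Polynomial.coeff_iterate_derivative]
      refine nsmul_mem ?_ _
      rw [hqdef, Polynomial.finsetSum_coeff]
      refine sum_mem fun i _ => ?_
      rw [Polynomial.coeff_C_mul, Polynomial.coeff_X_pow]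
      split_ifs
      · rw [mul_one]; exact fjSeries_mem (hb i) (hbl i)
      · rw [mul_zero]; exact zero_mem _
    rw [hu, Polynomial.eval_eq_sum_range]
    exact sum_mem fun n _ => mul_mem (hcoef n) (pow_mem (fjSeries_mem hc hl) n)
  classical
  have hex : ∃ s, PowerSeries.coeff s u ≠ 0 := by
    by_contra! hcon
    exact hj1 (PowerSeries.ext fun m => by rw [hcon, map_zero])
  set s := Nat.find hex
  obtain ⟨v, hv⟩ := (PowerSeries.X_pow_dvd_iff (n := s)).mpr fun m hm =>
    not_not.mp (Nat.find_min hex hm)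
  have hv0 : PowerSeries.coeff 0 v = PowerSeries.coeff s u := by
    rw [hv]
    simpa using (PowerSeries.coeff_X_pow_mul v s 0).symm
  obtain ⟨G, hG, hGu⟩ := humem s
  obtain ⟨p1, hp1⟩ := Function.ne_iff.mp (Nat.find_spec hex)
  obtain ⟨ρ, hρ, w, hw1, hw2⟩ := exists_circle_ne_zero (isOpen_jacobiDomain h)
    (convex_jacobiDomain h) hG hp0 p1.2 (by rw [← hGu]; exact hp1)
  have hcont : Continuous fun x : MatC (h + 1) × ℂ => x.1 + x.2 • w := by fun_prop
  have hVo := isOpen_jacobiDomain h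
  have hev1 : ∀ᶠ p in 𝓝 p0, ∀ z ∈ Metric.closedBall (0 : ℂ) ρ, p + z • w ∈ jacobiDomain h :=
    (isCompact_closedBall 0 ρ).eventually_forall_of_forall_eventually fun z hz =>
      hcont.continuousAt.eventually
        (hVo.mem_nhds (hw1 z (mem_closedBall_zero_iff.mp hz)))
  have hev2 : ∀ᶠ p in 𝓝 p0, ∀ z ∈ Metric.sphere (0 : ℂ) ρ, G (p + z • w) ≠ 0 := by
    refine (isCompact_sphere 0 ρ).eventually_forall_of_forall_eventually fun z hz => ?_
    have hz' := mem_sphere_zero_iff_norm.mp hz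
    have h1 : ContinuousAt (fun x : MatC (h + 1) × ℂ => G (x.1 + x.2 • w)) (p0, z) :=
      ContinuousAt.comp (x := (p0, z)) (g := G) (f := fun x : MatC (h + 1) × ℂ => x.1 + x.2 • w)
        (hG.continuousOn.continuousAt (hVo.mem_nhds (hw1 z hz'.le))) hcont.continuousAt
    exact h1.eventually_ne (hw2 z hz')
  have : LocallyCompactSpace (MatC (h + 1)) :=
    inferInstanceAs (LocallyCompactSpace (Fin (h + 1) → Fin (h + 1) → ℂ))
  obtain ⟨N, hN, hNsub, hNc⟩ := local_compact_nhds (Filter.inter_mem hev1 hev2)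
  set K := (fun x : MatC (h + 1) × ℂ => x.1 + x.2 • w) '' (N ×ˢ Metric.sphere (0 : ℂ) ρ)
  have hKc : IsCompact K := (hNc.prod (isCompact_sphere 0 ρ)).image hcont
  have hKV : K ⊆ jacobiDomain h := by
    rintro _ ⟨⟨p, z⟩, ⟨hp, hz⟩, rfl⟩
    exact (hNsub hp).1 z (Metric.sphere_subset_closedBall hz)
  obtain ⟨C, R, hC, hR, H⟩ := lev_bound_of_ne_zero hb hO hc hl hj0 (v := v) (s := s)
    (by rw [← hv]) hG.continuousOn (fun Z => by rw [hv0, hGu]) hKc hKV (by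
      rintro _ ⟨⟨p, z⟩, ⟨hp, hz⟩, rfl⟩
      exact (hNsub hp).2 z hz)
  refine ⟨max (max C R) 1, by positivity, ?_⟩
  filter_upwards [hN] with p hp m
  have hmax := Complex.norm_le_of_forall_mem_frontier_norm_le
    (f := fun z : ℂ => ser (lev c m) (p + z • w)) (U := Metric.ball (0 : ℂ) ρ) (C := C * R ^ m)
    Metric.isBounded_ball (by
      refine DifferentiableOn.diffContOnCl ?_
      rw [closure_ball 0 hρ.ne']
      refine (differentiableOn_lev hc hl m).comp (by fun_prop) fun z hz => (hNsub hp).1 z hz)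
    (fun z hz => H _ ⟨(p, z), ⟨hp, by
      rwa [frontier_ball 0 hρ.ne'] at hz⟩, rfl⟩ m)
    (z := 0) (subset_closure (Metric.mem_ball_self hρ))
  rw [zero_smul, add_zero] at hmax
  refine hmax.trans ?_
  rw [pow_succ']
  gcongr
  · exact (le_max_left _ _).trans (le_max_left _ _)
  · exact (le_max_right _ _).trans (le_max_left _ _)

end LocalConvergence

section Seed

open Filter Topology

variable {h : ℕ}

lemma continuous_cpt (Y : MatR g) : Continuous fun W => cpt W Y := by
  refine continuous_matrix fun i j => ?_
  simp only [cpt, Matrix.add_apply, map_apply, Matrix.smul_apply, transpose_apply]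
  fun_prop

lemma PD.sub_smul_one {Y : MatR g} (hY : PD Y) : ∃ ε : ℝ, 0 < ε ∧ PD (Y - ε • (1 : MatR g)) := by
  obtain ⟨ε, hε, h1⟩ := exists_pos_lower_bound hY
  refine ⟨ε / 2, by positivity, fun x hx => ?_⟩
  rw [qf_sub, qf_smul, qf_one]
  nlinarith [h1 x, dotProduct_self_pos_real hx]

lemma topBlk_sub_smul_one (Y : MatR (h + 1)) (ε : ℝ) :
    topBlk (Y - ε • (1 : MatR (h + 1))) = topBlk Y - ε • 1 := by
  ext i j
  simp [topBlk, Matrix.one_apply]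

/-- If the levels of `c` grow at most geometrically locally, then `c` converges far out in the
direction of the last variable. -/
lemma exists_add_lastE_mem_Om {c : MatQ (h + 1) → ℂ} (hc : SuppIndex c) (hl : LevSummable c)
    (hloc : ∀ p0 ∈ jacobiDomain h, ∃ C : ℝ, 0 ≤ C ∧
      ∀ᶠ p in 𝓝 p0, ∀ m, ‖ser (lev c m) p‖ ≤ C ^ (m + 1))
    {Y : MatR (h + 1)} (hY : PD (topBlk Y)) : ∃ M : ℝ, Y + M • lastE h ∈ Om c := by
  obtain ⟨ε, hε, h1⟩ := hY.sub_smul_one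
  rw [← topBlk_sub_smul_one] at h1
  set Y0 := Y - ε • (1 : MatR (h + 1)) with hY0
  have hmem : ∀ W, cpt W Y0 ∈ jacobiDomain h := fun W => by
    rw [mem_jacobiDomain_iff, imM_cpt]; exact h1
  obtain ⟨C, hC⟩ := exists_norm_term_le (b := lev c) (Y := Y0) (B := fun C m => max C 0 ^ (m + 1))
    (fun m => hc.lev m) (fun m => by have := hl m _ (hmem 0); rwa [imM_cpt] at this)
    (fun C C' hCC m => by
      change max C 0 ^ (m + 1) ≤ max C' 0 ^ (m + 1)
      gcongr)
    (fun W => by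
      obtain ⟨C, hC0, hC⟩ := hloc _ (hmem W)
      refine ⟨C, ?_⟩
      filter_upwards [(continuous_cpt Y0).continuousAt.eventually hC] with W' hW' m
      rw [max_eq_left hC0]
      exact hW' m)
  set D := max C 1
  obtain ⟨M, hM⟩ : ∃ M : ℝ, D ≤ Real.exp (2 * Real.pi * M) := by
    refine ⟨Real.log D / (2 * Real.pi), ?_⟩
    rw [mul_div_cancel₀ _ (by positivity), Real.exp_log (by positivity)]
  refine ⟨M, mem_Om_of_bound hc (Y := Y0 + M • lastE h) (C := D) (fun t => ?_) hε fun x => ?_⟩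
  · by_cases ht : c t = 0
    · rw [ht, norm_zero, zero_mul]; positivity
    · obtain ⟨m, hm⟩ := (hc t ht).exists_level
      have h2 := hC m t
      rw [lev, if_pos hm] at h2
      have h3 : max C 0 ^ (m + 1) ≤ D ^ (m + 1) := by
        gcongr
        exact max_le_max le_rfl zero_le_one
      have h4 : D ^ m ≤ Real.exp (2 * Real.pi * M) ^ m := by gcongr
      rw [trQ_add, trQ_smul, trQ_lastE, hm, mul_add, neg_add, Real.exp_add, ← mul_assoc]
      have h5 : Real.exp (-(2 * Real.pi * (M * ((m : ℚ) : ℝ)))) * Real.exp (2 * Real.pi * M) ^ m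
          = 1 := by
        rw [← Real.exp_nat_mul, ← Real.exp_add, ← Real.exp_zero]
        congr 1
        push_cast
        ring
      calc _ ≤ D ^ (m + 1) * Real.exp (-(2 * Real.pi * (M * ((m : ℚ) : ℝ)))) := by
            gcongr
            exact h2.trans h3
        _ = D * (Real.exp (-(2 * Real.pi * (M * ((m : ℚ) : ℝ)))) * D ^ m) := by ring
        _ ≤ D * 1 := by
            rw [← h5]
            gcongr
        _ = D := mul_one D
  · have : Y + M • lastE h - (Y0 + M • lastE h) = ε • (1 : MatR (h + 1)) := by rw [hY0]; abel
    rw [this, qf_smul, qf_one]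

end Seed

section Symplectic

/-- Shorthand for integral matrices of size `2g`. -/
abbrev MatZ2 (g : ℕ) := Matrix (Fin g ⊕ Fin g) (Fin g ⊕ Fin g) ℤ

lemma one_mem_SpZ : (1 : MatZ2 g) ∈ SpZ g := by
  change _ * _ * _ = _
  rw [transpose_one, Matrix.one_mul, Matrix.mul_one]

lemma mul_mem_SpZ {γ γ' : MatZ2 g} (h : γ ∈ SpZ g) (h' : γ' ∈ SpZ g) : γ * γ' ∈ SpZ g := by
  change _ * _ * _ = _
  have h1 : γᵀ * sympJ g * γ = sympJ g := h
  have h2 : γ'ᵀ * sympJ g * γ' = sympJ g := h'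
  calc (γ * γ')ᵀ * sympJ g * (γ * γ') = γ'ᵀ * (γᵀ * sympJ g * γ) * γ' := by
        rw [transpose_mul]; simp only [Matrix.mul_assoc]
    _ = _ := by rw [h1, h2]

lemma map_intCast_eq (γ : MatZ2 g) :
    γ.map (fun z : ℤ => (z : ℂ)) = fromBlocks (blkA γ) (blkB γ) (blkC γ) (blkD γ) := by
  ext (i | i) (j | j) <;> rfl

lemma blk_mul (γ γ' : MatZ2 g) :
    blkA (γ * γ') = blkA γ * blkA γ' + blkB γ * blkC γ' ∧
    blkB (γ * γ') = blkA γ * blkB γ' + blkB γ * blkD γ' ∧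
    blkC (γ * γ') = blkC γ * blkA γ' + blkD γ * blkC γ' ∧
    blkD (γ * γ') = blkC γ * blkB γ' + blkD γ * blkD γ' := by
  have h1 : (γ * γ').map (fun z : ℤ => (z : ℂ)) =
      γ.map (fun z : ℤ => (z : ℂ)) * γ'.map (fun z : ℤ => (z : ℂ)) :=
    Matrix.map_mul (f := Int.castRingHom ℂ)
  rw [map_intCast_eq, map_intCast_eq, map_intCast_eq, fromBlocks_multiply, fromBlocks_inj] at h1
  exact h1

lemma blk_rel {γ : MatZ2 g} (hγ : γ ∈ SpZ g) :
    (blkA γ)ᵀ * blkC γ = (blkC γ)ᵀ * blkA γ ∧ (blkB γ)ᵀ * blkD γ = (blkD γ)ᵀ * blkB γ ∧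
    (blkA γ)ᵀ * blkD γ - (blkC γ)ᵀ * blkB γ = 1 ∧
    (blkD γ)ᵀ * blkA γ - (blkB γ)ᵀ * blkC γ = 1 := by
  have h0 : γᵀ * sympJ g * γ = sympJ g := hγ
  have h1 := congrArg (fun M : MatZ2 g => M.map (Int.castRingHom ℂ)) h0
  simp only [Matrix.map_mul] at h1
  have h2 : (sympJ g).map (Int.castRingHom ℂ) = fromBlocks 0 1 (-1) 0 := by
    ext (i | i) (j | j) <;> simp [sympJ, Matrix.one_apply, apply_ite]
  have h3 : γ.map (Int.castRingHom ℂ) = _ := map_intCast_eq γ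
  have h4 : γᵀ.map (Int.castRingHom ℂ) = (γ.map (Int.castRingHom ℂ))ᵀ := rfl
  rw [h4, h2, h3, fromBlocks_transpose, fromBlocks_multiply, fromBlocks_multiply, fromBlocks_inj] at h1
  simp only [Matrix.mul_zero, Matrix.mul_one, Matrix.mul_neg, zero_add, add_zero,
    Matrix.neg_mul] at h1
  obtain ⟨e1, e2, e3, e4⟩ := h1
  refine ⟨?_, ?_, ?_, ?_⟩
  · rw [← sub_eq_zero, ← e1]; abel
  · rw [← sub_eq_zero, ← e4]; abel
  · rw [← e2]; abel
  · rw [← neg_eq_iff_eq_neg] at e3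
    rw [← e3]; abel

/-- The numerator `a τ + b` of the symplectic action. -/
def nmat (γ : MatZ2 g) (τ : MatC g) : MatC g := blkA γ * τ + blkB γ

lemma nmat_jmat_symm {γ : MatZ2 g} (hγ : γ ∈ SpZ g) {τ : MatC g} (hτ : τ.IsSymm) :
    (nmat γ τ)ᵀ * jmat γ τ = (jmat γ τ)ᵀ * nmat γ τ := by
  obtain ⟨e1, e2, e3, e4⟩ := blk_rel hγ
  have hτ' : τᵀ = τ := hτ
  rw [← sub_eq_zero]
  calc _ = τ * ((blkA γ)ᵀ * blkC γ - (blkC γ)ᵀ * blkA γ) * τ +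
        τ * ((blkA γ)ᵀ * blkD γ - (blkC γ)ᵀ * blkB γ) -
        ((blkD γ)ᵀ * blkA γ - (blkB γ)ᵀ * blkC γ) * τ +
        ((blkB γ)ᵀ * blkD γ - (blkD γ)ᵀ * blkB γ) := by
        simp only [nmat, jmat, transpose_add, transpose_mul, hτ']
        noncomm_ring
    _ = 0 := by rw [e1, e2, e3, e4]; simp

lemma blk_conjTranspose (γ : MatZ2 g) : (blkA γ)ᴴ = (blkA γ)ᵀ ∧ (blkB γ)ᴴ = (blkB γ)ᵀ ∧
    (blkC γ)ᴴ = (blkC γ)ᵀ ∧ (blkD γ)ᴴ = (blkD γ)ᵀ := by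
  refine ⟨?_, ?_, ?_, ?_⟩ <;> ext i j <;> simp [blkA, blkB, blkC, blkD, conjTranspose_apply]

lemma nmat_jmat_herm {γ : MatZ2 g} (hγ : γ ∈ SpZ g) (τ : MatC g) :
    (jmat γ τ)ᴴ * nmat γ τ - (nmat γ τ)ᴴ * jmat γ τ = τ - τᴴ := by
  obtain ⟨e1, e2, e3, e4⟩ := blk_rel hγ
  obtain ⟨f1, f2, f3, f4⟩ := blk_conjTranspose γ
  calc _ = -(τᴴ * ((blkA γ)ᵀ * blkC γ - (blkC γ)ᵀ * blkA γ) * τ) -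
        τᴴ * ((blkA γ)ᵀ * blkD γ - (blkC γ)ᵀ * blkB γ) +
        ((blkD γ)ᵀ * blkA γ - (blkB γ)ᵀ * blkC γ) * τ -
        ((blkB γ)ᵀ * blkD γ - (blkD γ)ᵀ * blkB γ) := by
        simp only [nmat, jmat, conjTranspose_add, conjTranspose_mul, f1, f2, f3, f4]
        noncomm_ring
    _ = τ - τᴴ := by rw [e1, e2, e3, e4]; simp; abel

/-- The hermitian form attached to a real symmetric matrix, evaluated at a complex vector. -/
lemma star_dotProduct_imM {τ : MatC g} (hτ : τ.IsSymm) (v : Fin g → ℂ) :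
    star v ⬝ᵥ ((τ - τᴴ) *ᵥ v) = 2 * Complex.I *
      ((qf (imM τ) (fun i => (v i).re) + qf (imM τ) (fun i => (v i).im) : ℝ) : ℂ) := by
  have h1 : τ - τᴴ = (2 * Complex.I) • (imM τ).map (fun x : ℝ => (x : ℂ)) := by
    ext i j
    simp only [Matrix.sub_apply, conjTranspose_apply, hτ.apply, Matrix.smul_apply, map_apply, imM,
      smul_eq_mul]
    rw [← starRingEnd_apply, Complex.sub_conj]
    push_cast
    ring
  have hs : ∀ i j, imM τ i j = imM τ j i := fun i j => by simp [imM, hτ.apply i j]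
  rw [h1, smul_mulVec, dotProduct_smul, smul_eq_mul]
  congr 1
  simp only [dotProduct, mulVec, map_apply, Pi.star_apply, Finset.mul_sum]
  apply Complex.ext
  · simp only [qf_eq_sum, ← Finset.sum_add_distrib, Complex.ofReal_re, Complex.re_sum]
    refine Finset.sum_congr rfl fun i _ => Finset.sum_congr rfl fun j _ => ?_
    simp
    ring
  · simp only [Complex.ofReal_im, Complex.im_sum]
    have : ∀ i j, (star (v i) * ((imM τ i j : ℂ) * v j)).im =
        imM τ i j * ((v i).re * (v j).im - (v i).im * (v j).re) := fun i j => by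
      simp
      ring
    simp only [this]
    have h2 : ∑ i, ∑ j, imM τ i j * ((v i).re * (v j).im - (v i).im * (v j).re) =
        -∑ i, ∑ j, imM τ i j * ((v i).re * (v j).im - (v i).im * (v j).re) := by
      conv_lhs => rw [Finset.sum_comm]
      simp only [← Finset.sum_neg_distrib]
      refine Finset.sum_congr rfl fun i _ => Finset.sum_congr rfl fun j _ => ?_
      rw [hs]
      ring
    linarith

lemma qf_re_im_pos {Y : MatR g} (hY : PD Y) {v : Fin g → ℂ} (hv : v ≠ 0) :
    0 < qf Y (fun i => (v i).re) + qf Y (fun i => (v i).im) := by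
  have hnn : ∀ x, 0 ≤ qf Y x := fun x => by
    by_cases hx : x = 0
    · simp [hx, qf]
    · exact (hY x hx).le
  by_cases h1 : (fun i => (v i).re) = 0
  · have h2 : (fun i => (v i).im) ≠ 0 := fun h2 => hv (funext fun i =>
      Complex.ext (congrFun h1 i) (congrFun h2 i))
    exact add_pos_of_nonneg_of_pos (hnn _) (hY _ h2)
  · exact add_pos_of_pos_of_nonneg (hY _ h1) (hnn _)

lemma jden_ne_zero {γ : MatZ2 g} (hγ : γ ∈ SpZ g) {τ : MatC g} (hτ : τ ∈ Sieg g) :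
    jden γ τ ≠ 0 := by
  rw [mem_Sieg_iff] at hτ
  intro h0
  obtain ⟨v, hv, hv0⟩ := exists_mulVec_eq_zero_iff.mpr h0
  have h1 := star_dotProduct_imM hτ.1 v
  rw [← nmat_jmat_herm hγ, sub_mulVec, ← mulVec_mulVec, ← mulVec_mulVec, hv0, mulVec_zero, sub_zero,
    dotProduct_mulVec, vecMul_conjTranspose, star_star, hv0] at h1
  simp only [star_zero, zero_dotProduct] at h1
  have h2 := qf_re_im_pos hτ.2 hv
  have h3 : (2 * Complex.I) ≠ 0 := by simp
  have h4 := (mul_eq_zero.mp h1.symm).resolve_left h3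
  rw [Complex.ofReal_eq_zero] at h4
  linarith

lemma isUnit_jmat {γ : MatZ2 g} (hγ : γ ∈ SpZ g) {τ : MatC g} (hτ : τ ∈ Sieg g) :
    IsUnit (jmat γ τ).det := (jden_ne_zero hγ hτ).isUnit

lemma actSp_mul_jmat {γ : MatZ2 g} (hγ : γ ∈ SpZ g) {τ : MatC g} (hτ : τ ∈ Sieg g) :
    actSp γ τ * jmat γ τ = nmat γ τ := by
  rw [actSp, Matrix.mul_assoc, nonsing_inv_mul _ (isUnit_jmat hγ hτ), Matrix.mul_one, nmat]

lemma actSp_isSymm {γ : MatZ2 g} (hγ : γ ∈ SpZ g) {τ : MatC g} (hτ : τ ∈ Sieg g) :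
    (actSp γ τ).IsSymm := by
  have h1 := nmat_jmat_symm hγ (mem_Sieg_iff.mp hτ).1
  have hu := isUnit_jmat hγ hτ
  rw [← actSp_mul_jmat hγ hτ, transpose_mul] at h1
  have hu' : IsUnit (jmat γ τ)ᵀ.det := by rwa [det_transpose]
  have h2 : (jmat γ τ)ᵀ * (actSp γ τ)ᵀ = (jmat γ τ)ᵀ * actSp γ τ := by
    have := congrArg (· * (jmat γ τ)⁻¹) h1
    simp only [Matrix.mul_assoc, mul_nonsing_inv _ hu, Matrix.mul_one] at this
    exact this
  have := congrArg ((jmat γ τ)ᵀ⁻¹ * ·) h2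
  simp only [← Matrix.mul_assoc, nonsing_inv_mul _ hu', Matrix.one_mul] at this
  exact this

lemma re_im_star_dot (τ : MatC g) (x : Fin g → ℝ) :
    (star (fun i => (x i : ℂ)) ⬝ᵥ (τ *ᵥ fun i => (x i : ℂ))).im = qf (imM τ) x := by
  simp only [dotProduct, mulVec, Pi.star_apply, Finset.mul_sum, Complex.im_sum, qf_eq_sum, imM,
    map_apply]
  refine Finset.sum_congr rfl fun i _ => Finset.sum_congr rfl fun j _ => ?_
  simp
  ring

/-- The imaginary part of `γ τ`. -/
lemma qf_imM_actSp {γ : MatZ2 g} (hγ : γ ∈ SpZ g) {τ : MatC g} (hτ : τ ∈ Sieg g) {x : Fin g → ℝ}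
    {v : Fin g → ℂ} (hv : jmat γ τ *ᵥ v = fun i => (x i : ℂ)) :
    qf (imM (actSp γ τ)) x =
      qf (imM τ) (fun i => (v i).re) + qf (imM τ) (fun i => (v i).im) := by
  set z := star v ⬝ᵥ ((jmat γ τ)ᴴ * nmat γ τ) *ᵥ v with hz
  have h1 : star (fun i => (x i : ℂ)) ⬝ᵥ (actSp γ τ *ᵥ fun i => (x i : ℂ)) = z := by
    rw [← hv, mulVec_mulVec, actSp_mul_jmat hγ hτ, star_mulVec, ← dotProduct_mulVec, mulVec_mulVec]
  have h2 : star z = star v ⬝ᵥ ((nmat γ τ)ᴴ * jmat γ τ) *ᵥ v := by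
    rw [hz, ← star_dotProduct, star_mulVec, conjTranspose_mul, conjTranspose_conjTranspose,
      ← dotProduct_mulVec]
  have h3 := star_dotProduct_imM (mem_Sieg_iff.mp hτ).1 v
  rw [← nmat_jmat_herm hγ, sub_mulVec, dotProduct_sub, ← hz, ← h2] at h3
  rw [← re_im_star_dot, h1]
  have h4 := congrArg Complex.im h3
  simp at h4
  linarith

end Symplectic

section Cocycle

open Filter Topology

lemma actSp_mem_Sieg {γ : MatZ2 g} (hγ : γ ∈ SpZ g) {τ : MatC g} (hτ : τ ∈ Sieg g) :
    actSp γ τ ∈ Sieg g := by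
  refine mem_Sieg_iff.mpr ⟨actSp_isSymm hγ hτ, fun x hx => ?_⟩
  have hv : jmat γ τ *ᵥ ((jmat γ τ)⁻¹ *ᵥ fun i => (x i : ℂ)) = fun i => (x i : ℂ) := by
    rw [mulVec_mulVec, mul_nonsing_inv _ (isUnit_jmat hγ hτ), one_mulVec]
  rw [qf_imM_actSp hγ hτ hv]
  refine qf_re_im_pos (mem_Sieg_iff.mp hτ).2 (fun h0 => hx ?_)
  rw [h0, mulVec_zero] at hv
  ext i
  simpa using (congrFun hv i).symm

lemma actSp_eq {γ : MatZ2 g} {τ X : MatC g} (hu : IsUnit (jmat γ τ).det)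
    (h : X * jmat γ τ = nmat γ τ) : actSp γ τ = X := by
  rw [actSp, ← nmat, ← h, Matrix.mul_assoc, mul_nonsing_inv _ hu, Matrix.mul_one]

lemma jmat_mul (γ : MatZ2 g) {γ' : MatZ2 g} (h' : γ' ∈ SpZ g) {τ : MatC g} (hτ : τ ∈ Sieg g) :
    jmat (γ * γ') τ = jmat γ (actSp γ' τ) * jmat γ' τ := by
  obtain ⟨-, -, e3, e4⟩ := blk_mul γ γ'
  have h1 := actSp_mul_jmat h' hτ
  conv_rhs => rw [jmat, Matrix.add_mul, Matrix.mul_assoc, h1]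
  rw [jmat, e3, e4, nmat, jmat]
  noncomm_ring

lemma nmat_mul (γ : MatZ2 g) {γ' : MatZ2 g} (h' : γ' ∈ SpZ g) {τ : MatC g} (hτ : τ ∈ Sieg g) :
    nmat (γ * γ') τ = nmat γ (actSp γ' τ) * jmat γ' τ := by
  obtain ⟨e1, e2, -, -⟩ := blk_mul γ γ'
  have h1 := actSp_mul_jmat h' hτ
  conv_rhs => rw [nmat, Matrix.add_mul, Matrix.mul_assoc, h1]
  rw [nmat, e1, e2, nmat, jmat]
  noncomm_ring

lemma jden_mul (γ : MatZ2 g) {γ' : MatZ2 g} (h' : γ' ∈ SpZ g) {τ : MatC g} (hτ : τ ∈ Sieg g) :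
    jden (γ * γ') τ = jden γ (actSp γ' τ) * jden γ' τ := by
  rw [jden, jmat_mul γ h' hτ, det_mul, jden, jden]

lemma actSp_mul {γ γ' : MatZ2 g} (h : γ ∈ SpZ g) (h' : γ' ∈ SpZ g) {τ : MatC g}
    (hτ : τ ∈ Sieg g) : actSp (γ * γ') τ = actSp γ (actSp γ' τ) := by
  refine actSp_eq (isUnit_jmat (mul_mem_SpZ h h') hτ) ?_
  rw [jmat_mul γ h' hτ, nmat_mul γ h' hτ, ← Matrix.mul_assoc,
    actSp_mul_jmat h (actSp_mem_Sieg h' hτ)]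

lemma blk_one : blkA (1 : MatZ2 g) = 1 ∧ blkB (1 : MatZ2 g) = 0 ∧ blkC (1 : MatZ2 g) = 0 ∧
    blkD (1 : MatZ2 g) = 1 := by
  refine ⟨?_, ?_, ?_, ?_⟩ <;> ext i j <;> simp [blkA, blkB, blkC, blkD, Matrix.one_apply]

lemma actSp_one (τ : MatC g) : actSp 1 τ = τ := by
  obtain ⟨e1, e2, e3, e4⟩ := blk_one (g := g)
  simp [actSp, jmat, e1, e2, e3, e4]

lemma exists_inv_SpZ {γ : MatZ2 g} (h : γ ∈ SpZ g) :
    ∃ γ' ∈ SpZ g, γ' * γ = 1 ∧ γ * γ' = 1 := by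
  have h0 : γᵀ * sympJ g * γ = sympJ g := h
  have hJ : sympJ g * sympJ g = -1 := by
    simp [sympJ, fromBlocks_multiply, ← fromBlocks_one, fromBlocks_neg]
  have h1 : (-(sympJ g * γᵀ * sympJ g)) * γ = 1 := by
    rw [Matrix.neg_mul, Matrix.mul_assoc, Matrix.mul_assoc, ← Matrix.mul_assoc γᵀ, h0, hJ, neg_neg]
  have h2 := mul_eq_one_comm.mp h1
  refine ⟨_, ?_, h1, h2⟩
  set δ := -(sympJ g * γᵀ * sympJ g)
  change δᵀ * sympJ g * δ = sympJ g
  calc δᵀ * sympJ g * δ = δᵀ * (γᵀ * sympJ g * γ) * δ := by rw [h0]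
    _ = (γ * δ)ᵀ * sympJ g * (γ * δ) := by rw [transpose_mul]; simp only [Matrix.mul_assoc]
    _ = _ := by rw [h2]; simp

lemma continuous_jmat (γ : MatZ2 g) : Continuous (jmat γ) :=
  (continuous_const.matrix_mul continuous_id).add continuous_const

lemma continuous_jden (γ : MatZ2 g) : Continuous (jden γ) :=
  (continuous_jmat γ).matrix_det

lemma continuousAt_actSp {γ : MatZ2 g} (h : γ ∈ SpZ g) {τ : MatC g} (hτ : τ ∈ Sieg g) :
    ContinuousAt (actSp γ) τ := by
  have h0 : ContinuousAt (fun τ => (jden γ τ)⁻¹) τ :=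
    (continuous_jden γ).continuousAt.inv₀ (jden_ne_zero h hτ)
  have h1 : ContinuousAt (fun τ => (jmat γ τ)⁻¹) τ := by
    have h4 : (fun τ => (jmat γ τ)⁻¹) = fun τ => (jden γ τ)⁻¹ • (jmat γ τ).adjugate := by
      funext τ
      rw [Matrix.inv_def, Ring.inverse_eq_inv', jden]
    rw [h4]
    exact h0.smul (continuous_jmat γ).matrix_adjugate.continuousAt
  have h2 : Continuous (nmat γ) := (continuous_const.matrix_mul continuous_id).add continuous_const
  have h3 : Continuous fun p : MatC g × MatC g => p.1 * p.2 :=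
    continuous_fst.matrix_mul continuous_snd
  exact (h3.continuousAt (x := (nmat γ τ, (jmat γ τ)⁻¹))).comp (f := fun τ => (nmat γ τ, (jmat γ τ)⁻¹))
    (h2.continuousAt.prodMk h1)

end Cocycle

section Bordered

variable {h : ℕ} {R : Type*}

/-- The bordered matrix `(n, z; ᵀw, s)`. -/
def bk (n : Matrix (Fin h) (Fin h) R) (z w : Fin h → R) (s : R) :
    Matrix (Fin (h + 1)) (Fin (h + 1)) R :=
  Matrix.of (Fin.snoc (α := fun _ => Fin (h + 1) → R)
    (fun i => Fin.snoc (α := fun _ => R) (n i) (z i)) (Fin.snoc (α := fun _ => R) w s))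

@[simp] lemma bk_castSucc_castSucc (n : Matrix (Fin h) (Fin h) R) (z w : Fin h → R) (s : R)
    (i j : Fin h) : bk n z w s i.castSucc j.castSucc = n i j := by simp [bk]

@[simp] lemma bk_castSucc_last (n : Matrix (Fin h) (Fin h) R) (z w : Fin h → R) (s : R)
    (i : Fin h) : bk n z w s i.castSucc (Fin.last h) = z i := by simp [bk]

@[simp] lemma bk_last_castSucc (n : Matrix (Fin h) (Fin h) R) (z w : Fin h → R) (s : R)
    (j : Fin h) : bk n z w s (Fin.last h) j.castSucc = w j := by simp [bk]

@[simp] lemma bk_last_last (n : Matrix (Fin h) (Fin h) R) (z w : Fin h → R) (s : R) :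
    bk n z w s (Fin.last h) (Fin.last h) = s := by simp [bk]

lemma ext_bordered {M N : Matrix (Fin (h + 1)) (Fin (h + 1)) R}
    (h1 : ∀ i j : Fin h, M i.castSucc j.castSucc = N i.castSucc j.castSucc)
    (h2 : ∀ i : Fin h, M i.castSucc (Fin.last h) = N i.castSucc (Fin.last h))
    (h3 : ∀ j : Fin h, M (Fin.last h) j.castSucc = N (Fin.last h) j.castSucc)
    (h4 : M (Fin.last h) (Fin.last h) = N (Fin.last h) (Fin.last h)) : M = N := by
  ext i j
  refine Fin.lastCases ?_ (fun i => ?_) i <;> refine Fin.lastCases ?_ (fun j => ?_) j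
  exacts [h4, h3 j, h2 i, h1 i j]

lemma eq_bk (M : Matrix (Fin (h + 1)) (Fin (h + 1)) R) :
    M = bk (topBlk M) (fun i => M i.castSucc (Fin.last h)) (fun j => M (Fin.last h) j.castSucc)
      (M (Fin.last h) (Fin.last h)) :=
  ext_bordered (by simp [topBlk]) (by simp) (by simp) (by simp)

lemma topBlk_bk (n : Matrix (Fin h) (Fin h) R) (z w : Fin h → R) (s : R) :
    topBlk (bk n z w s) = n := by
  ext i j
  simp [topBlk]

lemma bk_mul [CommRing R] (n n' : Matrix (Fin h) (Fin h) R) (z w z' w' : Fin h → R) (s s' : R) :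
    bk n z w s * bk n' z' w' s' =
      bk (n * n' + vecMulVec z w') (n *ᵥ z' + s' • z) (w ᵥ* n' + s • w') (w ⬝ᵥ z' + s * s') := by
  refine ext_bordered ?_ ?_ ?_ ?_ <;> intros <;>
    simp [Matrix.mul_apply, Fin.sum_univ_castSucc, vecMulVec_apply, mulVec, vecMul, dotProduct,
      mul_comm]

lemma bk_add [Add R] (n n' : Matrix (Fin h) (Fin h) R) (z w z' w' : Fin h → R) (s s' : R) :
    bk n z w s + bk n' z' w' s' = bk (n + n') (z + z') (w + w') (s + s') := by
  refine ext_bordered ?_ ?_ ?_ ?_ <;> intros <;> simp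

lemma bk_transpose (n : Matrix (Fin h) (Fin h) R) (z w : Fin h → R) (s : R) :
    (bk n z w s)ᵀ = bk nᵀ w z s := by
  refine ext_bordered ?_ ?_ ?_ ?_ <;> intros <;> simp

lemma bk_one [Zero R] [One R] : bk (1 : Matrix (Fin h) (Fin h) R) 0 0 1 = 1 := by
  refine ext_bordered ?_ ?_ ?_ ?_ <;> intros <;> simp [Matrix.one_apply, Fin.ext_iff, Nat.ne_of_lt, Nat.ne_of_gt]

lemma bk_zero [Zero R] : bk (0 : Matrix (Fin h) (Fin h) R) 0 0 0 = 0 := by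
  refine ext_bordered ?_ ?_ ?_ ?_ <;> intros <;> simp

lemma bk_neg [CommRing R] (n : Matrix (Fin h) (Fin h) R) (z w : Fin h → R) (s : R) :
    -bk n z w s = bk (-n) (-z) (-w) (-s) := by
  refine ext_bordered ?_ ?_ ?_ ?_ <;> intros <;> simp

lemma det_bk [CommRing R] (n : Matrix (Fin h) (Fin h) R) (z : Fin h → R) (s : R) :
    (bk n z 0 s).det = n.det * s := by
  rw [det_succ_row _ (Fin.last h), Finset.sum_eq_single (Fin.last h)]
  · have : (bk n z 0 s).submatrix (Fin.last h).succAbove (Fin.last h).succAbove = n := by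
      ext i j
      simp
    rw [this, bk_last_last, ← two_mul, pow_mul]
    simp [mul_comm]
  · intro j _ hj
    obtain ⟨j, rfl⟩ := Fin.exists_castSucc_eq.mpr hj
    simp
  · simp

/-- The embedding of `Sp_{2h}` into `Sp_{2h+2}`. -/
def emb (γ : MatZ2 h) : MatZ2 (h + 1) :=
  fromBlocks (bk γ.toBlocks₁₁ 0 0 1) (bk γ.toBlocks₁₂ 0 0 0) (bk γ.toBlocks₂₁ 0 0 0)
    (bk γ.toBlocks₂₂ 0 0 1)

lemma emb_mul (γ γ' : MatZ2 h) : emb (γ * γ') = emb γ * emb γ' := by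
  obtain ⟨a, b, c, d, rfl⟩ : ∃ a b c d, γ = fromBlocks a b c d :=
    ⟨_, _, _, _, (fromBlocks_toBlocks γ).symm⟩
  obtain ⟨a', b', c', d', rfl⟩ : ∃ a b c d, γ' = fromBlocks a b c d :=
    ⟨_, _, _, _, (fromBlocks_toBlocks γ').symm⟩
  simp [emb, fromBlocks_multiply, bk_mul, bk_add]

lemma emb_mem_SpZ {γ : MatZ2 h} (hγ : γ ∈ SpZ h) : emb γ ∈ SpZ (h + 1) := by
  obtain ⟨a, b, c, d, rfl⟩ : ∃ a b c d, γ = fromBlocks a b c d :=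
    ⟨_, _, _, _, (fromBlocks_toBlocks γ).symm⟩
  change _ * _ * _ = _
  have h0 : (fromBlocks a b c d)ᵀ * sympJ h * fromBlocks a b c d = sympJ h := hγ
  rw [sympJ, fromBlocks_transpose, fromBlocks_multiply, fromBlocks_multiply, fromBlocks_inj] at h0
  simp only [Matrix.mul_zero, Matrix.mul_one, Matrix.mul_neg, zero_add, add_zero,
    Matrix.neg_mul] at h0
  rw [sympJ, ← bk_one, ← bk_zero, emb, fromBlocks_transpose, bk_neg]
  simp [fromBlocks_multiply, bk_mul, bk_add, bk_transpose, h0]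

lemma emb_one : emb (1 : MatZ2 h) = 1 := by
  rw [← fromBlocks_one, emb, toBlocks_fromBlocks₁₁, toBlocks_fromBlocks₁₂, toBlocks_fromBlocks₂₁,
    toBlocks_fromBlocks₂₂, bk_one, bk_zero, fromBlocks_one]

lemma blk_emb (γ : MatZ2 h) : blkA (emb γ) = bk (blkA γ) 0 0 1 ∧ blkB (emb γ) = bk (blkB γ) 0 0 0 ∧
    blkC (emb γ) = bk (blkC γ) 0 0 0 ∧ blkD (emb γ) = bk (blkD γ) 0 0 1 := by
  refine ⟨?_, ?_, ?_, ?_⟩ <;> refine ext_bordered ?_ ?_ ?_ ?_ <;> intros <;>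
    simp [blkA, blkB, blkC, blkD, emb, toBlocks₁₁, toBlocks₁₂, toBlocks₂₁, toBlocks₂₂]

lemma jmat_emb (γ : MatZ2 h) (n : MatC h) (z w : Fin h → ℂ) (s : ℂ) :
    jmat (emb γ) (bk n z w s) = bk (jmat γ n) (blkC γ *ᵥ z) 0 1 := by
  obtain ⟨-, -, e3, e4⟩ := blk_emb γ
  rw [jmat, e3, e4, bk_mul, bk_add, jmat]
  simp

lemma nmat_emb (γ : MatZ2 h) (n : MatC h) (z w : Fin h → ℂ) (s : ℂ) :
    nmat (emb γ) (bk n z w s) = bk (nmat γ n) (blkA γ *ᵥ z) w s := by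
  obtain ⟨e1, e2, -, -⟩ := blk_emb γ
  rw [nmat, e1, e2, bk_mul, bk_add, nmat]
  simp

lemma jden_emb (γ : MatZ2 h) (τ : MatC (h + 1)) : jden (emb γ) τ = jden γ (topBlk τ) := by
  conv_lhs => rw [eq_bk τ]
  rw [jden, jmat_emb, det_bk, mul_one, jden]

end Bordered

section Embedding

variable {h : ℕ}

open Filter Topology

lemma Sieg_subset_jacobiDomain {τ : MatC (h + 1)} (hτ : τ ∈ Sieg (h + 1)) : τ ∈ jacobiDomain h :=
  fun x hx _ => (mem_Sieg_iff.mp hτ).2 x hx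

lemma topBlk_mem_Sieg_of_mem {τ : MatC (h + 1)} (hτ : τ ∈ Sieg (h + 1)) : topBlk τ ∈ Sieg h :=
  topBlk_mem_Sieg (mem_Sieg_iff.mp hτ).1 (Sieg_subset_jacobiDomain hτ)

lemma actSp_mul_blkC_add {γ : MatZ2 g} (hγ : γ ∈ SpZ g) {τ : MatC g} (hτ : τ ∈ Sieg g) :
    actSp γ τ * blkC γ + (jmat γ τ)⁻¹ᵀ = blkA γ := by
  obtain ⟨e1, e2, e3, e4⟩ := blk_rel hγ
  have hτ' : τᵀ = τ := (mem_Sieg_iff.mp hτ).1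
  have hs : (actSp γ τ)ᵀ = actSp γ τ := actSp_isSymm hγ hτ
  have hu : IsUnit (jmat γ τ)ᵀ.det := by rw [det_transpose]; exact isUnit_jmat hγ hτ
  have h1 : (jmat γ τ)ᵀ * actSp γ τ = (nmat γ τ)ᵀ := by
    rw [← actSp_mul_jmat hγ hτ, transpose_mul, hs]
  have h2 : (jmat γ τ)ᵀ * (actSp γ τ * blkC γ + (jmat γ τ)⁻¹ᵀ) = (jmat γ τ)ᵀ * blkA γ := by
    rw [Matrix.mul_add, ← Matrix.mul_assoc, h1, transpose_nonsing_inv, mul_nonsing_inv _ hu, ← e4,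
      nmat, jmat, ← sub_eq_zero]
    simp only [transpose_add, transpose_mul, hτ']
    calc _ = τ * ((blkA γ)ᵀ * blkC γ - (blkC γ)ᵀ * blkA γ) := by noncomm_ring
      _ = 0 := by rw [e1, sub_self, Matrix.mul_zero]
  have := congrArg ((jmat γ τ)ᵀ⁻¹ * ·) h2
  simpa only [← Matrix.mul_assoc, nonsing_inv_mul _ hu, Matrix.one_mul] using this

lemma eq_bk_of_isSymm {R : Type*} {τ : Matrix (Fin (h + 1)) (Fin (h + 1)) R} (hτ : τ.IsSymm) :
    τ = bk (topBlk τ) (fun i => τ i.castSucc (Fin.last h)) (fun i => τ i.castSucc (Fin.last h))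
      (τ (Fin.last h) (Fin.last h)) := by
  conv_lhs => rw [eq_bk τ]
  congr
  ext i
  exact hτ.apply _ _

lemma actSp_emb {γ : MatZ2 h} (hγ : γ ∈ SpZ h) {n : MatC h} (hn : n ∈ Sieg h) (z : Fin h → ℂ)
    (s : ℂ) :
    actSp (emb γ) (bk n z z s) = bk (actSp γ n) ((jmat γ n)⁻¹ᵀ *ᵥ z) ((jmat γ n)⁻¹ᵀ *ᵥ z)
      (s - z ⬝ᵥ ((jmat γ n)⁻¹ *ᵥ (blkC γ *ᵥ z))) := by
  have hu := isUnit_jmat hγ hn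
  refine actSp_eq ?_ ?_
  · rw [jmat_emb, det_bk, mul_one]
    exact hu
  · rw [jmat_emb, nmat_emb, bk_mul, actSp_mul_jmat hγ hn, mulVec_mulVec]
    congr 1
    · simp
    · rw [one_smul, ← add_mulVec, actSp_mul_blkC_add hγ hn]
    · rw [mulVec_transpose, vecMul_vecMul, nonsing_inv_mul _ hu]
      simp
    · rw [mulVec_transpose, dotProduct_mulVec z]
      ring

lemma imM_bk (n : MatC h) (z w : Fin h → ℂ) (s : ℂ) :
    imM (bk n z w s) = bk (imM n) (fun i => (z i).im) (fun i => (w i).im) s.im := by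
  refine ext_bordered ?_ ?_ ?_ ?_ <;> intros <;> simp [imM]

lemma lastE_eq_bk : lastE h = bk 0 0 0 1 := by
  refine ext_bordered ?_ ?_ ?_ ?_ <;> intros <;>
    simp [lastE, Fin.ext_iff, Nat.ne_of_gt]

lemma bk_sub_smul_lastE (n : MatR h) (z w : Fin h → ℝ) (s r : ℝ) :
    bk n z w s - r • lastE h = bk n z w (s - r) := by
  rw [lastE_eq_bk]
  refine ext_bordered ?_ ?_ ?_ ?_ <;> intros <;> simp

/-- The embedded group commutes with translations in the last diagonal variable. -/
lemma PD_sub_lastE_emb {γ : MatZ2 h} (hγ : γ ∈ SpZ h) {τ : MatC (h + 1)}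
    (hτ : τ ∈ Sieg (h + 1)) {r : ℝ} (hr : PD (imM τ - r • lastE h)) :
    PD (imM (actSp (emb γ) τ) - r • lastE h) := by
  have hn := topBlk_mem_Sieg_of_mem hτ
  have hs := eq_bk_of_isSymm (mem_Sieg_iff.mp hτ).1
  generalize topBlk τ = n at hn hs
  generalize (fun i : Fin h => τ i.castSucc (Fin.last h)) = z at hs
  generalize τ (Fin.last h) (Fin.last h) = s at hs
  subst hs
  have h1 : bk n z z (s - r * Complex.I) ∈ Sieg (h + 1) := by
    refine mem_Sieg_iff.mpr ⟨?_, ?_⟩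
    · rw [IsSymm, bk_transpose, (mem_Sieg_iff.mp hn).1]
    · convert hr using 1
      rw [imM_bk, imM_bk, bk_sub_smul_lastE]
      simp
  have h2 := (mem_Sieg_iff.mp (actSp_mem_Sieg (emb_mem_SpZ hγ) h1)).2
  convert h2 using 1
  rw [actSp_emb hγ hn, actSp_emb hγ hn, imM_bk, imM_bk, bk_sub_smul_lastE]
  congr 1
  simp
  ring

lemma topBlk_actSp_emb {γ : MatZ2 h} (hγ : γ ∈ SpZ h) {τ : MatC (h + 1)}
    (hτ : τ ∈ Sieg (h + 1)) : topBlk (actSp (emb γ) τ) = actSp γ (topBlk τ) := by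
  conv_lhs => rw [eq_bk_of_isSymm (mem_Sieg_iff.mp hτ).1]
  rw [actSp_emb hγ (topBlk_mem_Sieg_of_mem hτ), topBlk_bk]

/-- The levels of a symmetric formal Fourier-Jacobi series transform like modular forms under the
embedded group. -/
lemma ser_lev_actSp_emb {k : ℤ} {c : MatQ (h + 1) → ℂ} (hc : IsSymFM h 1 k c) {γ : MatZ2 h}
    (hγ : γ ∈ SpZ h) {τ : MatC (h + 1)} (hτ : τ ∈ Sieg (h + 1)) (m : ℕ) :
    ser (lev c m) (actSp (emb γ) τ) = jden (emb γ) τ ^ k * ser (lev c m) τ := by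
  obtain ⟨φ, hφ⟩ := hc.2.2 (oneByOne m) (oneByOne_index m).1 (oneByOne_index m).2
  have hτ' := actSp_mem_Sieg (emb_mem_SpZ hγ) hτ
  have hn := topBlk_mem_Sieg_of_mem hτ
  have h1 := (hasSum_lev_of_jacobiF hc.1 φ hφ (mem_Sieg_iff.mp hτ).1
    (Sieg_subset_jacobiDomain hτ)).tsum_eq
  have h2 := (hasSum_lev_of_jacobiF hc.1 φ hφ (mem_Sieg_iff.mp hτ').1
    (Sieg_subset_jacobiDomain hτ')).tsum_eq
  rw [jden_emb, ser, ser, h1, h2, topBlk_actSp_emb hγ hτ]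
  set z : Fin h → ℂ := fun i => τ i.castSucc (Fin.last h) with hz
  have h3 := actSp_emb hγ hn z (τ (Fin.last h) (Fin.last h))
  rw [← eq_bk_of_isSymm (mem_Sieg_iff.mp hτ).1] at h3
  have h4 := φ.transfSp γ hγ (topBlk τ, Matrix.of fun i _ => z i) hn
  have h5 : (Matrix.of fun i (_ : Fin 1) => actSp (emb γ) τ i.castSucc (Fin.last h)) =
      (jmat γ (topBlk τ))⁻¹ᵀ * Matrix.of fun i _ => z i := by
    ext i j
    rw [h3]
    simp [Matrix.mul_apply, mulVec, dotProduct]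
  have h6 : (((oneByOne m).map fun q => (q : ℂ)) * ((Matrix.of fun i (_ : Fin 1) => z i)ᵀ *
      ((jmat γ (topBlk τ))⁻¹ * (blkC γ * Matrix.of fun i (_ : Fin 1) => z i)))).trace =
      m * (z ⬝ᵥ ((jmat γ (topBlk τ))⁻¹ *ᵥ (blkC γ *ᵥ z))) := by
    simp [Matrix.trace, Matrix.mul_apply, mulVec, dotProduct, oneByOne]
  rw [h5, h4, h6, h3, bk_last_last]
  rw [mul_assoc, mul_assoc, mul_assoc, mul_left_comm _ (φ.toFun _), ← Complex.exp_add]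
  congr 3
  ring_nf

end Embedding

section Reduced

variable {h : ℕ}

open Filter Topology

lemma PD.mono {Y Y' : MatR g} (hY : PD Y) (h : ∀ x, 0 ≤ qf (Y' - Y) x) : PD Y' := fun x hx => by
  have h1 := h x
  have h2 := hY x hx
  rw [qf_sub] at h1
  linarith

lemma PD.topBlk {Y : MatR (h + 1)} (hY : PD Y) : PD (topBlk Y) := fun v hv => by
  have := hY (Fin.snoc v 0) (fun h0 => hv (snoc_eq_zero_iff.mp h0).1)
  rw [qf_snoc] at this
  simpa using this

lemma PD.of_sub_lastE {Y : MatR (h + 1)} {r : ℝ} (hr : 0 ≤ r) (hY : PD (Y - r • lastE h)) : PD Y :=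
  hY.mono fun x => by
    rw [sub_sub_cancel, qf_smul, qf_lastE]
    positivity

/-- Convergence over the part of the tube domain where the top block is reduced implies
convergence over the whole tube domain. -/
lemma mem_Om_of_reduced {k : ℤ} {c : MatQ (h + 1) → ℂ} (hc : IsSymFM h 1 k c) {c0 c1 : ℝ}
    (h01 : c0 < c1)
    (hred : ∀ τ ∈ Sieg h, ∃ γ ∈ SpZ h, ∀ x, c1 * (x ⬝ᵥ x) ≤ qf (imM (actSp γ τ)) x)
    {r : ℝ} (hr : 0 ≤ r)
    (H : ∀ Y : MatR (h + 1), PD (Y - r • lastE h) → (∀ x, c0 * (x ⬝ᵥ x) ≤ qf (topBlk Y) x) →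
      Y ∈ Om c) {Y : MatR (h + 1)} (hY : PD (Y - r • lastE h)) : Y ∈ Om c := by
  have hs : SuppIndex c := hc.1
  rw [← symPart_mem_Om hs]
  have hY1 : PD (symPart Y - r • lastE h) := fun x hx => by
    have := hY x hx
    rwa [qf_sub, qf_symPart, ← qf_sub]
  obtain ⟨ε, hε, hY2⟩ := hY1.sub_smul_one
  set Y0 := symPart Y - ε • (1 : MatR (h + 1)) with hY0
  have hY3 : PD (Y0 - r • lastE h) := by rwa [hY0, sub_right_comm]
  have hY0s : Y0.IsSymm := by
    rw [IsSymm, hY0, transpose_sub, symPart_isSymm Y, transpose_smul, transpose_one]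
  have hY0p := hY3.of_sub_lastE hr
  have hmem : ∀ W, cpt W Y0 ∈ Sieg (h + 1) := fun W => cpt_mem_Sieg W hY0s hY0p
  obtain ⟨C, hC⟩ := exists_norm_term_le (b := lev c) (Y := Y0) (B := fun C _ => C)
    (fun m => hs.lev m)
    (fun m => by
      have := hc.levSummable m _ (Sieg_subset_jacobiDomain (hmem 0))
      rwa [imM_cpt] at this)
    (fun a b hab _ => hab)
    (fun W => by
      obtain ⟨γ, hγ, hγr⟩ := hred _ (topBlk_mem_Sieg_of_mem (hmem W))
      have hγ' := emb_mem_SpZ hγ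
      set σ := actSp (emb γ) (cpt W Y0) with hσ
      have h1 : PD (imM σ - r • lastE h) := PD_sub_lastE_emb hγ (hmem W) (by rwa [imM_cpt])
      obtain ⟨ε1, hε1, h2⟩ := h1.sub_smul_one
      set δ := min ε1 (c1 - c0)
      have hδ : 0 < δ := lt_min hε1 (sub_pos.mpr h01)
      set Y' := imM σ - δ • (1 : MatR (h + 1)) with hY'
      have h3 : Y' ∈ Om c := by
        refine H Y' (h2.mono fun x => ?_) fun x => ?_
        · have : Y' - r • lastE h - (imM σ - r • lastE h - ε1 • (1 : MatR (h + 1))) =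
              (ε1 - δ) • (1 : MatR (h + 1)) := by rw [hY', sub_smul]; abel
          rw [this, qf_smul, qf_one]
          exact mul_nonneg (sub_nonneg.mpr (min_le_left _ _)) (dotProduct_self_nonneg_real x)
        · rw [hY', topBlk_sub_smul_one, qf_sub, qf_smul, qf_one]
          have h4 := hγr x
          rw [← topBlk_actSp_emb hγ (hmem W)] at h4
          have h5 : topBlk (imM σ) = imM (topBlk σ) := rfl
          rw [h5]
          have h6 : δ ≤ c1 - c0 := min_le_right _ _
          nlinarith [dotProduct_self_nonneg_real x]
      set K := ∑' t, ‖c t‖ * Real.exp (-(2 * Real.pi * trQ t Y')) with hK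
      have hcont : ContinuousAt (fun W' => actSp (emb γ) (cpt W' Y0)) W :=
        (continuousAt_actSp hγ' (hmem W)).comp (f := fun W' => cpt W' Y0)
          (continuous_cpt Y0).continuousAt
      have hev1 := hcont.eventually (eventually_imM_ge σ hδ)
      have hjc : ContinuousAt (fun W' => ‖jden (emb γ) (cpt W' Y0) ^ (-k)‖) W :=
        ((((continuous_jden (emb γ)).comp (continuous_cpt Y0)).continuousAt).zpow₀ (-k)
          (Or.inl (jden_ne_zero hγ' (hmem W)))).norm
      have hev2 := hjc.eventually (eventually_lt_nhds (lt_add_one _))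
      refine ⟨(‖jden (emb γ) (cpt W Y0) ^ (-k)‖ + 1) * K, ?_⟩
      filter_upwards [hev1, hev2] with W' h5 h6 m
      have h7 : ser (lev c m) (cpt W' Y0) = jden (emb γ) (cpt W' Y0) ^ (-k) *
          ser (lev c m) (actSp (emb γ) (cpt W' Y0)) := by
        rw [ser_lev_actSp_emb hc hγ (hmem W'), ← mul_assoc,
          ← zpow_add₀ (jden_ne_zero hγ' (hmem W'))]
        simp
      have h8 : ‖ser (lev c m) (actSp (emb γ) (cpt W' Y0))‖ ≤ K := by
        refine (norm_ser_le (hs.lev m) (Om_lev_of_Om m h3) h5).trans ?_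
        refine Summable.tsum_le_tsum (fun t => ?_) (Om_lev_of_Om m h3) h3
        refine mul_le_mul_of_nonneg_right ?_ (Real.exp_pos _).le
        unfold lev
        split_ifs
        · exact le_rfl
        · simp
      rw [h7, norm_mul]
      exact mul_le_mul h6.le h8 (norm_nonneg _) (by positivity))
  refine mem_Om_of_bound (Y := Y0) (C := C) hs (fun t => ?_) hε (fun x => ?_)
  · by_cases h0 : c t = 0
    · rw [h0, norm_zero, zero_mul]
      exact le_trans (by positivity) (hC 0 0)
    · obtain ⟨m, hm⟩ := (hs t h0).exists_level
      have := hC m t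
      rwa [lev, if_pos hm] at this
  · rw [hY0, sub_sub_cancel, qf_smul, qf_one]

end Reduced

section Congruence

/-- The congruence action of an invertible rational matrix. -/
def congrEquiv (u : MatQ g) (hu : IsUnit u.det) : MatQ g ≃ MatQ g where
  toFun t := uᵀ * t * u
  invFun t := u⁻¹ᵀ * t * u⁻¹
  left_inv t := by
    have h1 : u⁻¹ᵀ * uᵀ = 1 := by rw [← transpose_mul, mul_nonsing_inv _ hu, transpose_one]
    calc u⁻¹ᵀ * (uᵀ * t * u) * u⁻¹ = u⁻¹ᵀ * uᵀ * t * (u * u⁻¹) := by simp only [Matrix.mul_assoc]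
      _ = t := by rw [h1, mul_nonsing_inv _ hu, Matrix.one_mul, Matrix.mul_one]
  right_inv t := by
    have h1 : uᵀ * u⁻¹ᵀ = 1 := by rw [← transpose_mul, nonsing_inv_mul _ hu, transpose_one]
    calc uᵀ * (u⁻¹ᵀ * t * u⁻¹) * u = uᵀ * u⁻¹ᵀ * t * (u⁻¹ * u) := by simp only [Matrix.mul_assoc]
      _ = t := by rw [h1, nonsing_inv_mul _ hu, Matrix.one_mul, Matrix.mul_one]

lemma isUnit_det_map {R : Type*} [CommRing R] {u : Matrix (Fin g) (Fin g) ℤ} (hu : IsUnit u.det) :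
    IsUnit (u.map fun z : ℤ => (z : R)).det := by
  have : (u.map fun z : ℤ => (z : R)) = (Int.castRingHom R).mapMatrix u := rfl
  rw [this, ← RingHom.map_det]
  exact hu.map _

lemma trQ_congr (u : Matrix (Fin g) (Fin g) ℤ) (t : MatQ g) (Y : MatR g) :
    trQ ((u.map fun z => (z : ℚ))ᵀ * t * (u.map fun z => (z : ℚ))) Y =
      trQ t (u.map (fun z => (z : ℝ)) * Y * (u.map fun z => (z : ℝ))ᵀ) := by
  have h1 : (((u.map fun z => (z : ℚ))ᵀ * t * (u.map fun z => (z : ℚ))).map fun q : ℚ => (q : ℝ)) =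
      (u.map fun z => (z : ℝ))ᵀ * (t.map fun q : ℚ => (q : ℝ)) * u.map fun z => (z : ℝ) := by
    have h2 : ∀ A B C : MatQ g, (A * B * C).map (Rat.castHom ℝ) =
        A.map (Rat.castHom ℝ) * B.map (Rat.castHom ℝ) * C.map (Rat.castHom ℝ) := fun A B C => by
      rw [Matrix.map_mul, Matrix.map_mul]
    refine (h2 _ _ _).trans (congrArg₂ _ (congrArg₂ _ ?_ rfl) ?_)
    · ext i j; simp
    · ext i j; simp
  rw [trQ, trQ, h1, Matrix.mul_assoc, Matrix.mul_assoc, trace_mul_comm]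
  simp only [Matrix.mul_assoc]

/-- Symmetry of the coefficients makes the domain of convergence invariant. -/
lemma mem_Om_conj {c : MatQ g → ℂ} (u : Matrix (Fin g) (Fin g) ℤ) (hu : IsUnit u.det)
    (hc : ∀ t, ‖c ((u.map fun z => (z : ℚ))ᵀ * t * (u.map fun z => (z : ℚ)))‖ = ‖c t‖)
    {Y : MatR g} :
    u.map (fun z => (z : ℝ)) * Y * (u.map fun z => (z : ℝ))ᵀ ∈ Om c ↔ Y ∈ Om c := by
  rw [mem_Om, mem_Om]
  conv_rhs => rw [← (congrEquiv _ (isUnit_det_map (R := ℚ) hu)).summable_iff]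
  refine summable_congr fun t => ?_
  simp only [Function.comp, congrEquiv, Equiv.coe_fn_mk, trQ_congr, hc]

lemma IsSymFM.norm_congr {h : ℕ} {k : ℤ} {c : MatQ (h + 1) → ℂ} (hc : IsSymFM h 1 k c)
    (u : Matrix (Fin (h + 1)) (Fin (h + 1)) ℤ) (hu : IsUnit u.det) (t : MatQ (h + 1)) :
    ‖c ((u.map fun z => (z : ℚ))ᵀ * t * (u.map fun z => (z : ℚ)))‖ = ‖c t‖ := by
  rw [hc.2.1 u hu t, norm_mul]
  rcases Int.isUnit_iff.mp hu with h | h <;> simp [h]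

end Congruence

section Schur

variable {h : ℕ}

/-- `Y` has the Schur decomposition with top block form `Y1`, shear vector `l` and remaining
diagonal entry `w`. -/
def IsSchur (Y : MatR (h + 1)) (Y1 : MatR h) (l : Fin h → ℝ) (w : ℝ) : Prop :=
  ∀ (v : Fin h → ℝ) (s : ℝ), qf Y (Fin.snoc v s) = qf Y1 (v + s • l) + w * s ^ 2

lemma qf_add_smul {M : MatR g} (hM : M.IsSymm) (v l : Fin g → ℝ) (s : ℝ) :
    qf M (v + s • l) = qf M v + 2 * s * (v ⬝ᵥ M *ᵥ l) + s ^ 2 * qf M l := by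
  have h1 : l ⬝ᵥ M *ᵥ v = v ⬝ᵥ M *ᵥ l := by
    rw [dotProduct_mulVec, ← mulVec_transpose, hM, dotProduct_comm]
  simp only [qf, mulVec_add, mulVec_smul, add_dotProduct, dotProduct_add, smul_dotProduct,
    dotProduct_smul, smul_eq_mul, h1]
  ring

lemma exists_isSchur {Y : MatR (h + 1)} (hY : PD (topBlk Y)) :
    ∃ l w, IsSchur Y (topBlk Y) l w := by
  set Y1 := symPart (topBlk Y) with hY1
  have hs : Y1.IsSymm := symPart_isSymm _
  have hp : PD Y1 := fun x hx => by rw [hY1, qf_symPart]; exact hY x hx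
  have hu : IsUnit Y1.det := (posDef_iff.mpr ⟨hs, hp⟩).det_pos.ne'.isUnit
  set y : Fin h → ℝ := fun i => (Y i.castSucc (Fin.last h) + Y (Fin.last h) i.castSucc) / 2
  refine ⟨Y1⁻¹ *ᵥ y, Y (Fin.last h) (Fin.last h) - qf Y1 (Y1⁻¹ *ᵥ y), fun v s => ?_⟩
  have h1 : Y1 *ᵥ (Y1⁻¹ *ᵥ y) = y := by rw [mulVec_mulVec, mul_nonsing_inv _ hu, one_mulVec]
  rw [← qf_symPart (topBlk Y), ← hY1, qf_add_smul hs, h1, qf_snoc, ← qf_symPart (topBlk Y), ← hY1]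
  have h2 : ∑ i, v i * (Y i.castSucc (Fin.last h) + Y (Fin.last h) i.castSucc) = 2 * (v ⬝ᵥ y) := by
    rw [dotProduct, Finset.mul_sum]
    exact Finset.sum_congr rfl fun i _ => by simp only [y]; ring
  rw [h2]
  ring

/-- The integral shear in the last variable. -/
def shear (n : Fin h → ℤ) : Matrix (Fin (h + 1)) (Fin (h + 1)) ℤ := bk 1 0 n 1

lemma isUnit_det_shear (n : Fin h → ℤ) : IsUnit (shear n).det := by
  rw [← det_transpose, shear, bk_transpose, det_bk]
  simp

lemma bk_mulVec_snoc {R : Type*} [CommRing R] (n : Matrix (Fin h) (Fin h) R) (z w : Fin h → R)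
    (s : R) (v : Fin h → R) (x : R) :
    bk n z w s *ᵥ (Fin.snoc v x : Fin (h + 1) → R) =
      (Fin.snoc (n *ᵥ v + x • z) (w ⬝ᵥ v + s * x) : Fin (h + 1) → R) := by
  ext i
  refine Fin.lastCases ?_ (fun i => ?_) i <;>
    simp [mulVec, dotProduct, Fin.sum_univ_castSucc, mul_comm]

lemma IsSchur.shear {Y : MatR (h + 1)} {Y1 : MatR h} {l : Fin h → ℝ} {w : ℝ}
    (H : IsSchur Y Y1 l w) (n : Fin h → ℤ) :
    IsSchur ((shear n).map (fun z => (z : ℝ)) * Y * ((shear n).map fun z => (z : ℝ))ᵀ) Y1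
      (fun i => n i + l i) w := by
  intro v s
  have h1 : ((_root_.shear n).map fun z => (z : ℝ))ᵀ = bk 1 (fun i => (n i : ℝ)) 0 1 := by
    refine ext_bordered ?_ ?_ ?_ ?_ <;> intros <;> simp [_root_.shear, Matrix.one_apply, eq_comm]
  rw [qf_conj, h1, bk_mulVec_snoc]
  simp only [one_mulVec, zero_dotProduct, zero_add, one_mul]
  rw [H]
  congr 2
  ext i
  simp
  ring

end Schur

section Tubes

variable {h : ℕ} {k : ℤ} {c : MatQ (h + 1) → ℂ}

open Filter Topology

/-- The series converges over the tube domain `Y > r E`. -/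
def TubeConv (c : MatQ (h + 1) → ℂ) (r : ℝ) : Prop :=
  ∀ Y : MatR (h + 1), PD (Y - r • lastE h) → Y ∈ Om c

lemma IsSchur.lt {Y : MatR (h + 1)} {Y1 : MatR h} {l : Fin h → ℝ} {w : ℝ}
    (H : IsSchur Y Y1 l w) {r : ℝ} (hr : PD (Y - r • lastE h)) : r < w := by
  have h1 := hr (Fin.snoc (-l) 1) (fun h0 => one_ne_zero (snoc_eq_zero_iff.mp h0).2)
  rw [qf_sub, qf_smul, qf_lastE, H] at h1
  simp [qf] at h1
  linarith

/-- It suffices to check convergence on matrices in Schur form with bounded shear vector and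
reduced top block. -/
lemma tubeConv_of_isSchur (hc : IsSymFM h 1 k c) {c0 c1 : ℝ} (h01 : c0 < c1)
    (hred : ∀ τ ∈ Sieg h, ∃ γ ∈ SpZ h, ∀ x, c1 * (x ⬝ᵥ x) ≤ qf (imM (actSp γ τ)) x)
    {r : ℝ} (hr : 0 ≤ r)
    (H : ∀ (Y : MatR (h + 1)) (Y1 : MatR h) (l : Fin h → ℝ) (w : ℝ), IsSchur Y Y1 l w →
      (∀ i, l i ∈ Set.Icc (0 : ℝ) 1) → (∀ x, c0 * (x ⬝ᵥ x) ≤ qf Y1 x) → r < w → Y ∈ Om c) :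
    TubeConv c r := fun Y hY => by
  refine mem_Om_of_reduced hc h01 hred hr (fun Y hY hY1 => ?_) hY
  obtain ⟨l, w, hl⟩ := exists_isSchur (hY.of_sub_lastE hr).topBlk
  rw [← mem_Om_conj _ (isUnit_det_shear fun i => -⌊l i⌋) (hc.norm_congr _ (isUnit_det_shear _))]
  refine H _ _ _ _ (hl.shear _) (fun i => ?_) hY1 (hl.lt hY)
  push_cast
  rw [neg_add_eq_sub]
  exact ⟨Int.fract_nonneg _, (Int.fract_lt_one _).le⟩

lemma qf_smul_one_add (a : ℝ) (v l : Fin g → ℝ) (s : ℝ) :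
    a * ((v + s • l) ⬝ᵥ (v + s • l)) =
      a * (v ⬝ᵥ v) + 2 * a * s * (v ⬝ᵥ l) + a * s ^ 2 * (l ⬝ᵥ l) := by
  have := qf_add_smul (M := (1 : MatR g)) transpose_one v l s
  simp only [qf_one, one_mulVec] at this
  rw [this]
  ring

/-- The matrix with scalar top block and linear dependence on the shear vector. -/
def scalarBk (a M : ℝ) (l : Fin h → ℝ) : MatR (h + 1) := bk (a • 1) (a • l) (a • l) M

lemma qf_scalarBk (a M : ℝ) (l v : Fin h → ℝ) (s : ℝ) :
    qf (scalarBk a M l) (Fin.snoc v s) =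
      a * (v ⬝ᵥ v) + 2 * a * s * (v ⬝ᵥ l) + M * s ^ 2 := by
  have : ∑ i, v i * (a * l i + a * l i) = 2 * a * (v ⬝ᵥ l) := by
    rw [dotProduct, Finset.mul_sum]
    exact Finset.sum_congr rfl fun i _ => by ring
  simp only [qf_snoc, scalarBk, topBlk_bk, qf_smul, qf_one, bk_castSucc_last, bk_last_castSucc,
    bk_last_last, Pi.smul_apply, smul_eq_mul, this]
  ring

lemma convex_scalarBk (a M : ℝ) : Convex ℝ {l : Fin h → ℝ | scalarBk a M l ∈ Om c} := by
  intro l hl l' hl' p q hp hq hpq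
  have h1 : scalarBk a M (p • l + q • l') = p • scalarBk a M l + q • scalarBk a M l' := by
    refine ext_bordered (fun i j => ?_) (fun i => ?_) (fun j => ?_) ?_
    · simp [scalarBk, ← add_mul, hpq]
    · simp [scalarBk]; ring
    · simp [scalarBk]; ring
    · simp [scalarBk, ← add_mul, hpq]
  change scalarBk a M _ ∈ Om c
  rw [h1]
  exact convex_Om c hl hl' hp hq hpq

lemma qf_nonneg_of_snoc {M : MatR (h + 1)} (H : ∀ v s, 0 ≤ qf M (Fin.snoc v s)) (x) :
    0 ≤ qf M x := by
  obtain ⟨v, s, rfl⟩ := snoc_surj x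
  exact H v s

lemma exists_scalarBk_mem (hc : IsSymFM h 1 k c)
    (hloc : ∀ p0 ∈ jacobiDomain h, ∃ C : ℝ, 0 ≤ C ∧
      ∀ᶠ p in 𝓝 p0, ∀ m, ‖ser (lev c m) p‖ ≤ C ^ (m + 1)) {a : ℝ} (ha : 0 < a) :
    ∃ M : ℝ, ∀ l : Fin h → ℝ, (∀ i, l i ∈ Set.Icc (0 : ℝ) 1) → scalarBk a M l ∈ Om c := by
  have hs : SuppIndex c := hc.1
  obtain ⟨M, hM⟩ := exists_add_lastE_mem_Om hs hc.levSummable hloc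
    (Y := scalarBk a 0 0) (fun x hx => by
      rw [scalarBk, topBlk_bk, qf_smul, qf_one]
      exact mul_pos ha (dotProduct_self_pos_real hx))
  refine ⟨M + a * h, fun l hl => ?_⟩
  have hvert : ∀ n : Fin h → ℝ, (∀ i, n i ∈ ({0, 1} : Set ℝ)) →
      scalarBk a (M + a * h) n ∈ Om c := fun n hn => by
    have h1 : ∃ n' : Fin h → ℤ, n = fun i => (n' i : ℝ) := by
      refine ⟨fun i => ⌊n i⌋, funext fun i => ?_⟩
      rcases hn i with h | h
      · have h' : n i = 0 := h
        simp [h']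
      · have h' : n i = 1 := h
        simp [h']
    obtain ⟨n', rfl⟩ := h1
    have h2 : (fun i => (n' i : ℝ)) ⬝ᵥ (fun i => (n' i : ℝ)) ≤ h := by
      rw [dotProduct]
      calc ∑ i, (n' i : ℝ) * n' i ≤ ∑ _i : Fin h, (1 : ℝ) := Finset.sum_le_sum fun i _ => by
            rcases hn i with h | h
            · have h' : (n' i : ℝ) = 0 := h
              simp [h']
            · have h' : (n' i : ℝ) = 1 := h
              simp [h']
        _ = h := by simp
    have h3 : IsSchur (scalarBk a 0 0 + M • lastE h) (a • 1) 0 M := fun v s => by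
      rw [qf_add, qf_scalarBk, qf_smul, qf_lastE, qf_smul, qf_one]
      simp
    refine Om_mono hs ((mem_Om_conj _ (isUnit_det_shear n')
      (hc.norm_congr _ (isUnit_det_shear n'))).mpr hM) (qf_nonneg_of_snoc fun v s => ?_)
    rw [qf_sub, h3.shear n', qf_scalarBk, qf_smul, qf_one]
    simp only [Pi.zero_apply, add_zero]
    rw [qf_smul_one_add]
    have h4 : 0 ≤ a * s ^ 2 := by positivity
    nlinarith [mul_le_mul_of_nonneg_left h2 h4]
  have h5 : l ∈ convexHull ℝ (Set.univ.pi fun _ : Fin h => ({0, 1} : Set ℝ)) := by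
    rw [convexHull_pi]
    intro i _
    rw [convexHull_pair, segment_eq_Icc zero_le_one]
    exact hl i
  exact convexHull_min (fun n hn => hvert n fun i => Set.mem_univ_pi.mp hn i) (convex_scalarBk a _) h5

lemma exists_tubeConv (hc : IsSymFM h 1 k c) {c0 c1 : ℝ} (hc0 : 0 < c0) (h01 : c0 < c1)
    (hred : ∀ τ ∈ Sieg h, ∃ γ ∈ SpZ h, ∀ x, c1 * (x ⬝ᵥ x) ≤ qf (imM (actSp γ τ)) x)
    (hloc : ∀ p0 ∈ jacobiDomain h, ∃ C : ℝ, 0 ≤ C ∧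
      ∀ᶠ p in 𝓝 p0, ∀ m, ‖ser (lev c m) p‖ ≤ C ^ (m + 1)) : ∃ r, 0 < r ∧ TubeConv c r := by
  obtain ⟨M, hM⟩ := exists_scalarBk_mem hc hloc hc0
  refine ⟨max M 1, by positivity, tubeConv_of_isSchur hc h01 hred (by positivity)
    fun Y Y1 l w hY hl hY1 hw => Om_mono hc.1 (hM l hl) (qf_nonneg_of_snoc fun v s => ?_)⟩
  have h1 := hY1 (v + s • l)
  have h2 : M ≤ w := (le_max_left _ _).trans hw.le
  have h3 : 0 ≤ c0 * s ^ 2 * (l ⬝ᵥ l) :=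
    mul_nonneg (by positivity) (dotProduct_self_nonneg_real l)
  rw [qf_smul_one_add] at h1
  rw [qf_sub, hY, qf_scalarBk]
  nlinarith [mul_le_mul_of_nonneg_right h2 (sq_nonneg s)]

lemma TubeConv.mem_of_conj (hc : IsSymFM h 1 k c) {r : ℝ} (H : TubeConv c r)
    (u : Matrix (Fin (h + 1)) (Fin (h + 1)) ℤ) (hu : IsUnit u.det) {D Y : MatR (h + 1)}
    (hD : ∀ x, qf D ((u.map fun z => (z : ℝ))ᵀ *ᵥ x) = x (Fin.last h) ^ 2)
    (hY : PD (Y - r • D)) : Y ∈ Om c := by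
  rw [← mem_Om_conj u hu (hc.norm_congr u hu)]
  refine H _ fun x hx => ?_
  have h1 : (u.map fun z => (z : ℝ))ᵀ *ᵥ x ≠ 0 := fun h0 => hx <| by
    have hu' : IsUnit (u.map fun z => (z : ℝ))ᵀ.det := by
      rw [det_transpose]; exact isUnit_det_map hu
    have := congrArg ((u.map fun z => (z : ℝ))ᵀ⁻¹ *ᵥ ·) h0
    simpa only [mulVec_mulVec, nonsing_inv_mul _ hu', one_mulVec, mulVec_zero] using this
  have := hY _ h1
  rw [qf_sub, qf_smul, hD] at this
  rwa [qf_sub, qf_smul, qf_conj, qf_lastE]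

end Tubes

section Gain

variable {h : ℕ} {k : ℤ} {c : MatQ (h + 1) → ℂ}

lemma qf_vecMulVec_self (u x : Fin g → ℝ) : qf (vecMulVec u u) x = (u ⬝ᵥ x) ^ 2 := by
  rw [qf, vecMulVec_mulVec, op_smul_eq_smul, dotProduct_smul, smul_eq_mul, dotProduct_comm x u, sq]

lemma exists_swap_last (i : Fin h) :
    ∃ u : Matrix (Fin (h + 1)) (Fin (h + 1)) ℤ, IsUnit u.det ∧
      ∀ x, ((u.map fun z => (z : ℝ))ᵀ *ᵥ x) i.castSucc = x (Fin.last h) := by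
  refine ⟨(Equiv.Perm.permMatrix ℤ (Equiv.swap i.castSucc (Fin.last h)))ᵀ, ?_, fun x => ?_⟩
  · rw [det_transpose, det_permutation]
    exact (Equiv.Perm.sign _).isUnit
  · have : ((Equiv.Perm.permMatrix ℤ (Equiv.swap i.castSucc (Fin.last h)))ᵀ.map
        fun z => (z : ℝ))ᵀ = Equiv.Perm.permMatrix ℝ (Equiv.swap i.castSucc (Fin.last h)) := by
      refine Matrix.ext fun a b => ?_
      have : Equiv.swap i.castSucc (Fin.last h) b = a ↔ Equiv.swap i.castSucc (Fin.last h) a = b :=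
        by rw [Equiv.swap_apply_eq_iff, eq_comm]
      simp [Equiv.Perm.permMatrix, PEquiv.toMatrix_apply, this]
    rw [this, permMatrix_mulVec]
    simp

lemma exists_add_last (i : Fin h) :
    ∃ u : Matrix (Fin (h + 1)) (Fin (h + 1)) ℤ, IsUnit u.det ∧
      ∀ x, ((u.map fun z => (z : ℝ))ᵀ *ᵥ x) i.castSucc +
        ((u.map fun z => (z : ℝ))ᵀ *ᵥ x) (Fin.last h) = x (Fin.last h) := by
  refine ⟨bk 1 (-Pi.single i 1) 0 1, by simp [det_bk], fun x => ?_⟩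
  obtain ⟨v, s, rfl⟩ := snoc_surj x
  have : ((bk 1 (-Pi.single i 1) 0 1 : Matrix (Fin (h + 1)) (Fin (h + 1)) ℤ).map
      fun z => (z : ℝ))ᵀ = bk 1 0 (-Pi.single i 1) 1 := by
    refine ext_bordered (fun i j => ?_) (fun i => ?_) (fun j => ?_) ?_
    · simp [Matrix.one_apply, eq_comm]
    · simp
    · simp [Pi.single_apply]
    · simp
  rw [this, bk_mulVec_snoc]
  simp

/-- Averaging over three unimodular conjugates enlarges the tube of convergence. -/
lemma TubeConv.gain (hc : IsSymFM h 1 k c) {c0 c1 : ℝ} (h01 : c0 < c1)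
    (hred : ∀ τ ∈ Sieg h, ∃ γ ∈ SpZ h, ∀ x, c1 * (x ⬝ᵥ x) ≤ qf (imM (actSp γ τ)) x)
    (i : Fin h) {r κ : ℝ} (hκ : 0 < κ) (hκ0 : κ < c0) (hκr : κ ≤ r) (H : TubeConv c r) :
    TubeConv c (r - κ / 2) := by
  refine tubeConv_of_isSchur hc h01 hred (by linarith) fun Y Y1 l w hY hl hY1 hw => ?_
  obtain ⟨hl0, hl1⟩ := hl i
  obtain ⟨a, ha⟩ : ∃ a, a = κ * (1 - l i) := ⟨_, rfl⟩
  obtain ⟨b, hb⟩ : ∃ b, b = κ * l i := ⟨_, rfl⟩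
  obtain ⟨e, he⟩ : ∃ e, e = w - κ * (l i * (1 - l i)) - κ / 8 := ⟨_, rfl⟩
  have hq : κ * (l i * (1 - l i)) ≤ κ * (1 / 4) :=
    mul_le_mul_of_nonneg_left (by nlinarith [sq_nonneg (l i - 1 / 2)]) hκ.le
  have ha0 : 0 ≤ a := ha ▸ mul_nonneg hκ.le (by linarith)
  have hb0 : 0 ≤ b := hb ▸ mul_nonneg hκ.le hl0
  have he0 : 0 < e := by linarith
  obtain ⟨S, hS⟩ : ∃ S, S = a + b + e := ⟨_, rfl⟩
  have hab : a + b = κ := by rw [ha, hb]; ring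
  have hSr : r < S := by linarith
  have hS0 : 0 < S := by linarith
  set u0 : Fin (h + 1) → ℝ := Pi.single i.castSucc 1 with hu0
  set u1 : Fin (h + 1) → ℝ := Pi.single i.castSucc 1 + Pi.single (Fin.last h) 1 with hu1
  set Q := Y - a • vecMulVec u0 u0 - b • vecMulVec u1 u1 - e • lastE h with hQ
  have hQPD : PD Q := fun x hx => by
    obtain ⟨v, s, rfl⟩ := snoc_surj x
    have h0 : qf (vecMulVec u0 u0) (Fin.snoc v s) = v i ^ 2 := by
      rw [qf_vecMulVec_self, hu0]; simp
    have h1 : qf (vecMulVec u1 u1) (Fin.snoc v s) = (v i + s) ^ 2 := by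
      rw [qf_vecMulVec_self, hu1, add_dotProduct]; simp
    have h2 : qf Q (Fin.snoc v s) =
        qf Y1 (v + s • l) - κ * (v + s • l) i ^ 2 + κ / 8 * s ^ 2 := by
      rw [hQ, qf_sub, qf_sub, qf_sub, qf_smul, qf_smul, qf_smul, h0, h1, qf_lastE, hY]
      simp only [Fin.snoc_last, Pi.add_apply, Pi.smul_apply, smul_eq_mul, ha, hb, he]
      ring
    rw [h2]
    have h3 := hY1 (v + s • l)
    have h4 := mul_le_mul_of_nonneg_left (sq_le_dotProduct_self (v + s • l) i) hκ.le
    rcases eq_or_ne s 0 with rfl | hs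
    · have hv : v + (0 : ℝ) • l ≠ 0 := fun h0 => hx (snoc_eq_zero_iff.mpr ⟨by simpa using h0, rfl⟩)
      have := mul_pos (sub_pos.mpr hκ0) (dotProduct_self_pos_real hv)
      linarith
    · have h5 : 0 < κ / 8 * s ^ 2 := by positivity
      have := mul_nonneg (sub_pos.mpr hκ0).le (dotProduct_self_nonneg_real (v + s • l))
      linarith
  have hmem : ∀ D : MatR (h + 1), (∀ x, 0 ≤ qf D x) → (∃ u : Matrix (Fin (h + 1)) (Fin (h + 1)) ℤ,
      IsUnit u.det ∧ ∀ x, qf D ((u.map fun z => (z : ℝ))ᵀ *ᵥ x) = x (Fin.last h) ^ 2) →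
      S • D + Q ∈ Om c := by
    rintro D hD ⟨u, hu, hDu⟩
    refine H.mem_of_conj hc u hu hDu fun x hx => ?_
    rw [qf_sub, qf_add, qf_smul, qf_smul]
    nlinarith [hQPD x hx, mul_nonneg (sub_pos.mpr hSr).le (hD x)]
  have hm0 : S • vecMulVec u0 u0 + Q ∈ Om c := by
    obtain ⟨u, hu, hu'⟩ := exists_swap_last i
    refine hmem _ (fun x => by rw [qf_vecMulVec_self]; positivity) ⟨u, hu, fun x => ?_⟩
    rw [qf_vecMulVec_self, hu0, single_one_dotProduct, hu']
  have hm1 : S • vecMulVec u1 u1 + Q ∈ Om c := by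
    obtain ⟨u, hu, hu'⟩ := exists_add_last i
    refine hmem _ (fun x => by rw [qf_vecMulVec_self]; positivity) ⟨u, hu, fun x => ?_⟩
    rw [qf_vecMulVec_self, hu1, add_dotProduct, single_one_dotProduct, single_one_dotProduct, hu']
  have hm2 : S • lastE h + Q ∈ Om c :=
    hmem _ (fun x => by rw [qf_lastE]; positivity) ⟨1, by simp, fun x => by simp [qf_lastE]⟩
  have hsum := (convex_Om c).sum_mem (t := Finset.univ) (w := ![a / S, b / S, e / S])
    (z := ![S • vecMulVec u0 u0 + Q, S • vecMulVec u1 u1 + Q, S • lastE h + Q])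
    (fun j _ => by fin_cases j <;> simp <;> positivity)
    (by simp only [Fin.sum_univ_three]; simp; field_simp; exact hS.symm)
    (fun j _ => by fin_cases j <;> simp <;> assumption)
  convert hsum using 1
  rw [Fin.sum_univ_three]
  change Y = (a / S) • (S • vecMulVec u0 u0 + Q) + (b / S) • (S • vecMulVec u1 u1 + Q) +
    (e / S) • (S • lastE h + Q)
  have e1 : ∀ p : ℝ, ∀ D : MatR (h + 1), (p / S) • (S • D + Q) = p • D + (p / S) • Q := by
    intro p D
    rw [smul_add, smul_smul, div_mul_cancel₀ _ hS0.ne']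
  have e2 : (a / S) • Q + (b / S) • Q + (e / S) • Q = Q := by
    rw [← add_smul, ← add_smul, ← add_div, ← add_div, ← hS, div_self hS0.ne', one_smul]
  rw [e1, e1, e1]
  calc Y = a • vecMulVec u0 u0 + b • vecMulVec u1 u1 + e • lastE h + Q := by rw [hQ]; abel
    _ = a • vecMulVec u0 u0 + b • vecMulVec u1 u1 + e • lastE h +
        ((a / S) • Q + (b / S) • Q + (e / S) • Q) := by rw [e2]
    _ = _ := by abel

/-- The series attached to a symmetric formal Fourier-Jacobi series with locally bounded
Fourier-Jacobi coefficients converges over the whole positive definite cone. -/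
theorem mem_Om_of_PD (hh : 1 ≤ h) (hc : IsSymFM h 1 k c) {c0 c1 : ℝ} (hc0 : 0 < c0) (h01 : c0 < c1)
    (hred : ∀ τ ∈ Sieg h, ∃ γ ∈ SpZ h, ∀ x, c1 * (x ⬝ᵥ x) ≤ qf (imM (actSp γ τ)) x)
    (hloc : ∀ p0 ∈ jacobiDomain h, ∃ C : ℝ, 0 ≤ C ∧
      ∀ᶠ p in nhds p0, ∀ m, ‖ser (lev c m) p‖ ≤ C ^ (m + 1)) {Y : MatR (h + 1)} (hY : PD Y) :
    Y ∈ Om c := by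
  set V : Set ℝ := {r | 0 < r ∧ TubeConv c r} with hV
  have hne : V.Nonempty := exists_tubeConv hc hc0 h01 hred hloc
  have hbdd : BddBelow V := ⟨0, fun r hr => hr.1.le⟩
  have h0 : sInf V = 0 := by
    by_contra hne0
    have hpos : 0 < sInf V :=
      lt_of_le_of_ne (le_csInf hne fun r hr => hr.1.le) (Ne.symm hne0)
    set κ := min (c0 / 2) (sInf V) with hκ
    have hκpos : 0 < κ := lt_min (by positivity) hpos
    have hκ1 : κ ≤ c0 / 2 := min_le_left _ _
    have hκ2 : κ ≤ sInf V := min_le_right _ _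
    obtain ⟨r, hr, hr'⟩ := exists_lt_of_csInf_lt hne (show sInf V < sInf V + κ / 4 by linarith)
    have hrV := csInf_le hbdd hr
    have := csInf_le hbdd (show r - κ / 2 ∈ V from ⟨by linarith,
      hr.2.gain hc h01 hred ⟨0, hh⟩ hκpos (by linarith) (by linarith)⟩)
    linarith
  obtain ⟨ε, hε, hYε⟩ := hY.sub_smul_one
  obtain ⟨r, hr, hr'⟩ := exists_lt_of_csInf_lt hne (h0 ▸ hε)
  refine hr.2 Y (hYε.mono fun x => ?_)
  rw [qf_sub, qf_sub, qf_sub, qf_smul, qf_smul, qf_lastE, qf_one]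
  have h1 := sq_le_dotProduct_self x (Fin.last h)
  nlinarith [mul_le_mul_of_nonneg_right hr'.le (sq_nonneg (x (Fin.last h))),
    mul_le_mul_of_nonneg_left h1 hε.le]

end Gain

section Transitive

lemma vecMul_single' {ι R : Type*} [Fintype ι] [DecidableEq ι] [CommRing R] (v : ι → R) (i j : ι)
    (a : R) : v ᵥ* Matrix.single i j a = Pi.single j (v i * a) := by
  funext l
  rcases eq_or_ne l j with rfl | hl
  · simp [vecMul, dotProduct, Matrix.single_apply]
  · simp [vecMul, dotProduct, hl, hl.symm]

open Finset in
/-- Every integral row vector can be moved into a coordinate axis by a unimodular matrix. -/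
lemma exists_unimodular_vecMul {ι : Type*} [Fintype ι] [DecidableEq ι] (i : ι) (v : ι → ℤ) :
    ∃ u : Matrix ι ι ℤ, IsUnit u.det ∧ ∃ a, v ᵥ* u = Pi.single i a := by
  obtain ⟨n, hn⟩ : ∃ n, ∑ j, (v j).natAbs = n := ⟨_, rfl⟩
  induction n using Nat.strong_induction_on generalizing v with
  | _ n ih =>
    by_cases H : ∃ j k, j ≠ k ∧ v k ≠ 0 ∧ (v k).natAbs ≤ (v j).natAbs
    · obtain ⟨j, k, hjk, hk, hle⟩ := H
      set u := transvection k j (-(v j / v k)) with hu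
      have hv : v ᵥ* u = Function.update v j (v j % v k) := by
        funext l
        rw [hu, transvection, vecMul_add, vecMul_one, Pi.add_apply, vecMul_single']
        rcases eq_or_ne l j with rfl | hl
        · simp only [Function.update_self, Pi.single_eq_same, Int.emod_def]
          ring
        · simp [hl]
      have hlt : ((v j % v k).natAbs) < (v j).natAbs := by
        refine lt_of_lt_of_le ?_ hle
        have := Int.emod_lt_abs (v j) hk
        rw [Int.abs_eq_natAbs] at this
        have := Int.emod_nonneg (v j) hk
        omega
      obtain ⟨u', hu', a, ha⟩ := ih (∑ l, ((v ᵥ* u) l).natAbs) (by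
        rw [← hn, hv]
        refine Finset.sum_lt_sum (fun l _ => ?_) ⟨j, mem_univ _, by simpa using hlt⟩
        rcases eq_or_ne l j with rfl | hl
        · simpa using hlt.le
        · simp [hl]) (v ᵥ* u) rfl
      refine ⟨u * u', ?_, a, by rw [← vecMul_vecMul, ha]⟩
      rw [det_mul, hu, det_transvection_of_ne k j hjk.symm, one_mul]
      exact hu'
    · push Not at H
      have h1 : ∃ j, ∀ l, l ≠ j → v l = 0 := by
        by_cases h0 : ∃ j, v j ≠ 0
        · obtain ⟨j, hj⟩ := h0
          refine ⟨j, fun l hl => by_contra fun h2 => ?_⟩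
          exact lt_asymm (H l j hl hj) (H j l hl.symm h2)
        · push Not at h0
          exact ⟨i, fun l _ => h0 l⟩
      obtain ⟨j, hj⟩ := h1
      refine ⟨(Equiv.swap i j).permMatrix ℤ, ?_, v j, ?_⟩
      · rw [det_permutation]
        exact (Equiv.Perm.sign _).isUnit
      · rw [vecMul_permMatrix]
        funext l
        rw [Function.comp_apply, Equiv.symm_swap]
        rcases eq_or_ne l i with rfl | hl
        · simp
        · rw [Pi.single_eq_of_ne hl]
          refine hj _ fun h0 => hl ?_
          rwa [Equiv.swap_apply_eq_iff, Equiv.swap_apply_right] at h0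

lemma fromBlocks_mem_SpZ {a b c d : Matrix (Fin g) (Fin g) ℤ} :
    fromBlocks a b c d ∈ SpZ g ↔
      aᵀ * c = cᵀ * a ∧ aᵀ * d - cᵀ * b = 1 ∧ bᵀ * d = dᵀ * b := by
  change _ * _ * _ = _ ↔ _
  rw [sympJ, fromBlocks_transpose, fromBlocks_multiply, fromBlocks_multiply, fromBlocks_inj]
  simp only [Matrix.mul_zero, Matrix.mul_one, Matrix.mul_neg, zero_add, add_zero,
    Matrix.neg_mul]
  constructor
  · rintro ⟨e1, e2, -, e4⟩
    refine ⟨?_, ?_, ?_⟩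
    · rw [← sub_eq_zero, ← e1]; abel
    · rw [← e2]; abel
    · rw [← sub_eq_zero, ← e4]; abel
  · rintro ⟨e1, e2, e3⟩
    refine ⟨?_, ?_, ?_, ?_⟩
    · rw [e1]; abel
    · rw [← e2]; abel
    · have := congrArg transpose e2
      simp only [transpose_sub, transpose_mul, transpose_transpose, transpose_one] at this
      rw [← this]; abel
    · rw [e3]; abel

/-- The symplectic translation by a symmetric matrix. -/
def trE (S : Matrix (Fin g) (Fin g) ℤ) : MatZ2 g := fromBlocks 1 S 0 1

/-- The symplectic matrix attached to a unimodular matrix. -/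
def glE (u : Matrix (Fin g) (Fin g) ℤ) : MatZ2 g := fromBlocks u 0 0 (u⁻¹)ᵀ

/-- The symplectic inversion in one coordinate. -/
def swE (i : Fin g) : MatZ2 g :=
  fromBlocks (1 - Matrix.single i i 1) (-Matrix.single i i 1) (Matrix.single i i 1)
    (1 - Matrix.single i i 1)

lemma trE_mem {S : Matrix (Fin g) (Fin g) ℤ} (hS : S.IsSymm) : trE S ∈ SpZ g := by
  rw [trE, fromBlocks_mem_SpZ]
  simp [hS.eq]

lemma glE_mem {u : Matrix (Fin g) (Fin g) ℤ} (hu : IsUnit u.det) : glE u ∈ SpZ g := by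
  rw [glE, fromBlocks_mem_SpZ]
  simp [← transpose_mul, nonsing_inv_mul _ hu]

lemma swE_mem (i : Fin g) : swE i ∈ SpZ g := by
  rw [swE, fromBlocks_mem_SpZ]
  simp only [transpose_sub, transpose_one, transpose_single, transpose_neg, Matrix.sub_mul,
    Matrix.mul_sub, Matrix.mul_neg, Matrix.neg_mul, single_mul_single_same, Matrix.one_mul,
    Matrix.mul_one]
  simp

lemma emb_swE {h : ℕ} (i : Fin h) : emb (swE i) = swE i.castSucc := by
  have h1 : (Matrix.single i.castSucc i.castSucc 1 : Matrix (Fin (h + 1)) (Fin (h + 1)) ℤ) =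
      bk (Matrix.single i i 1) 0 0 0 := by
    refine ext_bordered ?_ ?_ ?_ ?_ <;> intros <;> simp [Matrix.single_apply, Fin.ext_iff]
    all_goals omega
  have h2 (n : Matrix (Fin h) (Fin h) ℤ) : 1 - bk n 0 0 0 = bk (1 - n) 0 0 1 := by
    rw [sub_eq_add_neg, bk_neg, ← bk_one, bk_add, sub_eq_add_neg]
    simp
  rw [emb, swE, swE, h1, bk_neg, h2]
  simp

lemma vecMul_fromBlocks_elim (c d : Fin g → ℤ) (A B C D : Matrix (Fin g) (Fin g) ℤ) :
    Sum.elim c d ᵥ* fromBlocks A B C D = Sum.elim (c ᵥ* A + d ᵥ* C) (c ᵥ* B + d ᵥ* D) := by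
  rw [vecMul_fromBlocks]
  rfl

/-- A multiplicatively closed set containing the Siegel parabolic and one coordinate inversion
moves every integral vector into a coordinate axis. -/
lemma exists_symplectic_vecMul {P : MatZ2 g → Prop}
    (hmul : ∀ γ ∈ SpZ g, ∀ γ' ∈ SpZ g, P γ → P γ' → P (γ * γ'))
    (hpar : ∀ γ ∈ SpZ g, γ.toBlocks₂₁ = 0 → P γ) (i : Fin g) (hsw : P (swE i)) (j : Fin g)
    (v : Fin g ⊕ Fin g → ℤ) :
    ∃ γ ∈ SpZ g, P γ ∧ ∃ a, v ᵥ* γ = Pi.single (Sum.inr j) a := by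
  have step : ∀ {v w : Fin g ⊕ Fin g → ℤ} {N : MatZ2 g}, N ∈ SpZ g → P N → v ᵥ* N = w →
      (∃ γ ∈ SpZ g, P γ ∧ ∃ a, w ᵥ* γ = Pi.single (Sum.inr j) a) →
      ∃ γ ∈ SpZ g, P γ ∧ ∃ a, v ᵥ* γ = Pi.single (Sum.inr j) a := by
    rintro v w N hN hPN rfl ⟨γ, hγ, hPγ, a, ha⟩
    exact ⟨N * γ, mul_mem_SpZ hN hγ, hmul _ hN _ hγ hPN hPγ, a, by rw [← vecMul_vecMul, ha]⟩
  have key : ∀ n : ℕ, ∀ (a : ℤ) (d : Fin g → ℤ), a.natAbs = n →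
      ∃ γ ∈ SpZ g, P γ ∧ ∃ b, Sum.elim (Pi.single i a) d ᵥ* γ = Pi.single (Sum.inr j) b := by
    intro n
    induction n using Nat.strong_induction_on with
    | _ n ih =>
      intro a d han
      rcases eq_or_ne a 0 with rfl | ha
      · obtain ⟨u, hu, b, hb⟩ := exists_unimodular_vecMul j d
        have hu' : IsUnit (u⁻¹)ᵀ.det := by
          rw [det_transpose]; exact isUnit_nonsing_inv_det u hu
        refine ⟨glE (u⁻¹)ᵀ, glE_mem hu', hpar _ (glE_mem hu') (by simp [glE]), b, ?_⟩
        have h1 : ((u⁻¹)ᵀ⁻¹)ᵀ = u := by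
          rw [transpose_nonsing_inv, transpose_transpose, nonsing_inv_nonsing_inv _ hu]
        rw [glE, vecMul_fromBlocks_elim, h1, hb]
        funext l
        rcases l with l | l <;> simp [Pi.single_apply]
      · set S : Matrix (Fin g) (Fin g) ℤ := Matrix.of fun p q =>
          if p = i then -(d q / a) else if q = i then -(d p / a) else 0 with hS
        have hSs : S.IsSymm := by
          refine Matrix.ext fun p q => ?_
          simp only [hS, transpose_apply, of_apply]
          split_ifs <;> simp_all
        have h1 : Sum.elim (Pi.single i a) d ᵥ* trE S =
            Sum.elim (Pi.single i a) (fun l => d l % a) := by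
          rw [trE, vecMul_fromBlocks_elim]
          funext l
          rcases l with l | l
          · simp
          · simp [hS, Int.emod_def]
            ring
        have h2 : Sum.elim (Pi.single i a) (fun l => d l % a) ᵥ* swE i =
            Sum.elim (Pi.single i (d i % a)) (fun l => if l = i then -a else d l % a) := by
          rw [swE, vecMul_fromBlocks_elim]
          funext l
          rcases l with l | l
          · rcases eq_or_ne l i with rfl | hl
            · simp [vecMul_single', vecMul_sub]
            · simp [vecMul_single', vecMul_sub, hl]
          · rcases eq_or_ne l i with rfl | hl
            · simp [vecMul_single', vecMul_sub, vecMul_neg]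
            · simp [vecMul_single', vecMul_sub, vecMul_neg, hl]
        refine step (trE_mem hSs) (hpar _ (trE_mem hSs) (by simp [trE])) h1
          (step (swE_mem i) hsw h2 (ih _ ?_ _ _ rfl))
        have := Int.emod_lt_abs (d i) ha
        rw [Int.abs_eq_natAbs] at this
        have := Int.emod_nonneg (d i) ha
        omega
  obtain ⟨u, hu, a, ha⟩ := exists_unimodular_vecMul i (v ∘ Sum.inl)
  refine step (glE_mem hu) (hpar _ (glE_mem hu) (by simp [glE]))
    (w := Sum.elim (Pi.single i a) ((v ∘ Sum.inr) ᵥ* (u⁻¹)ᵀ)) ?_ (key _ _ _ rfl)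
  rw [← Sum.elim_comp_inl_inr v, glE, vecMul_fromBlocks_elim]
  simp [ha]

end Transitive

section Generation

lemma exists_eq_fromBlocks (γ : MatZ2 g) : ∃ a b c d, γ = fromBlocks a b c d :=
  ⟨_, _, _, _, (fromBlocks_toBlocks γ).symm⟩

lemma mul_sympJ_mul_transpose {γ : MatZ2 g} (hγ : γ ∈ SpZ g) : γ * sympJ g * γᵀ = sympJ g := by
  have h0 : γᵀ * sympJ g * γ = sympJ g := hγ
  have hJ : sympJ g * sympJ g = -1 := by
    simp [sympJ, fromBlocks_multiply, ← fromBlocks_one, fromBlocks_neg]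
  have h1 : (-(sympJ g * γᵀ * sympJ g)) * γ = 1 := by
    rw [Matrix.neg_mul, Matrix.mul_assoc, Matrix.mul_assoc, ← Matrix.mul_assoc γᵀ, h0, hJ, neg_neg]
  have h2 := mul_eq_one_comm.mp h1
  calc γ * sympJ g * γᵀ = (γ * (-(sympJ g * γᵀ * sympJ g))) * sympJ g := by
        simp only [Matrix.mul_neg, Matrix.neg_mul, Matrix.mul_assoc, hJ, Matrix.mul_one, neg_neg]
    _ = _ := by rw [h2, Matrix.one_mul]

lemma fromBlocks_mem_SpZ_rows {a b c d : Matrix (Fin g) (Fin g) ℤ} (H : fromBlocks a b c d ∈ SpZ g) :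
    a * dᵀ - b * cᵀ = 1 ∧ c * dᵀ = d * cᵀ := by
  have h0 := mul_sympJ_mul_transpose H
  rw [sympJ, fromBlocks_transpose, fromBlocks_multiply, fromBlocks_multiply, fromBlocks_inj] at h0
  simp only [Matrix.mul_zero, Matrix.mul_one, Matrix.mul_neg, zero_add, add_zero,
    Matrix.neg_mul] at h0
  obtain ⟨-, e2, -, e4⟩ := h0
  refine ⟨by rw [← e2]; abel, ?_⟩
  rw [← sub_eq_zero, ← e4]; abel

/-- A symplectic matrix whose last row is supported on the diagonal factors through the smaller
symplectic group and the Siegel parabolic. -/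
lemma exists_factor_of_last_row {h : ℕ} {M : MatZ2 (h + 1)} (hM : M ∈ SpZ (h + 1)) {a : ℤ}
    (hrow : ∀ j, M (Sum.inr (Fin.last h)) j = Pi.single (M := fun _ => ℤ) (Sum.inr (Fin.last h)) a j) :
    ∃ γ ∈ SpZ h, ∃ T ∈ SpZ (h + 1), T.toBlocks₂₁ = 0 ∧ M = emb γ * T := by
  obtain ⟨A, B, C, D, rfl⟩ := exists_eq_fromBlocks M
  obtain ⟨A1, za, wa, sa, rfl⟩ : ∃ n z w s, A = bk n z w s := ⟨_, _, _, _, eq_bk A⟩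
  obtain ⟨B1, zb, wb, sb, rfl⟩ : ∃ n z w s, B = bk n z w s := ⟨_, _, _, _, eq_bk B⟩
  obtain ⟨C1, zc, wc, sc, rfl⟩ : ∃ n z w s, C = bk n z w s := ⟨_, _, _, _, eq_bk C⟩
  obtain ⟨D1, zd, wd, sd, rfl⟩ : ∃ n z w s, D = bk n z w s := ⟨_, _, _, _, eq_bk D⟩
  obtain rfl : wc = 0 := funext fun j => by simpa using hrow (Sum.inl j.castSucc)
  obtain rfl : sc = 0 := by simpa using hrow (Sum.inl (Fin.last h))
  obtain rfl : wd = 0 := funext fun j => by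
    simpa [Pi.single_apply, Fin.ext_iff, j.2.ne] using hrow (Sum.inr j.castSucc)
  obtain rfl : sd = a := by simpa using hrow (Sum.inr (Fin.last h))
  obtain ⟨r1, r2⟩ := fromBlocks_mem_SpZ_rows hM
  simp only [bk_transpose, bk_mul] at r1 r2
  have hsd : sa * sd = 1 := by
    have := congrFun₂ r1 (Fin.last h) (Fin.last h)
    simpa using this
  have hsd0 : sd ≠ 0 := right_ne_zero_of_mul_eq_one hsd
  obtain rfl : za = 0 := funext fun i => by
    have := congrFun₂ r1 i.castSucc (Fin.last h)
    simpa [hsd0, Matrix.one_apply, Fin.ext_iff, i.2.ne] using this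
  obtain rfl : zc = 0 := funext fun i => by
    have := congrFun₂ r2 i.castSucc (Fin.last h)
    simpa [hsd0] using this
  have hγ : fromBlocks A1 B1 C1 D1 ∈ SpZ h := by
    obtain ⟨e1, e2, e3⟩ := fromBlocks_mem_SpZ.mp hM
    simp only [bk_transpose, bk_mul] at e1 e2 e3
    refine fromBlocks_mem_SpZ.mpr ⟨?_, ?_, ?_⟩
    · simpa [topBlk_bk] using congrArg topBlk e1
    · refine Matrix.ext fun i j => ?_
      simpa [Matrix.one_apply] using congrFun₂ e2 i.castSucc j.castSucc
    · simpa [topBlk_bk] using congrArg topBlk e3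
  obtain ⟨γ', hγ', h1, h2⟩ := exists_inv_SpZ hγ
  refine ⟨_, hγ, emb γ' * _, mul_mem_SpZ (emb_mem_SpZ hγ') hM, ?_, ?_⟩
  · obtain ⟨a', b', c', d', rfl⟩ := exists_eq_fromBlocks γ'
    rw [fromBlocks_multiply, ← fromBlocks_one, fromBlocks_inj] at h1
    rw [emb, fromBlocks_multiply, toBlocks_fromBlocks₂₁, toBlocks_fromBlocks₂₁,
      toBlocks_fromBlocks₂₂, bk_mul, bk_mul, bk_add, ← bk_zero, ← h1.2.2.1]
    simp
  · rw [← Matrix.mul_assoc, ← emb_mul, h2, emb_one, Matrix.one_mul]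

/-- The symplectic group of size `h + 1` is generated by the embedded symplectic group of size `h`
and the Siegel parabolic. -/
theorem SpZ_induction {h : ℕ} (hh : 1 ≤ h) {P : MatZ2 (h + 1) → Prop}
    (hmul : ∀ γ ∈ SpZ (h + 1), ∀ γ' ∈ SpZ (h + 1), P γ → P γ' → P (γ * γ'))
    (hcan : ∀ γ ∈ SpZ (h + 1), ∀ γ' ∈ SpZ (h + 1), P γ' → P (γ * γ') → P γ)
    (hpar : ∀ γ ∈ SpZ (h + 1), γ.toBlocks₂₁ = 0 → P γ) (hemb : ∀ γ ∈ SpZ h, P (emb γ))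
    {γ : MatZ2 (h + 1)} (hγ : γ ∈ SpZ (h + 1)) : P γ := by
  obtain ⟨N, hN, hPN, a, ha⟩ := exists_symplectic_vecMul hmul hpar (Fin.castSucc ⟨0, hh⟩)
    (emb_swE (h := h) ⟨0, hh⟩ ▸ hemb _ (swE_mem _)) (Fin.last h) (γ (Sum.inr (Fin.last h)))
  have hM := mul_mem_SpZ hγ hN
  obtain ⟨γ1, hγ1, T, hT, hT0, h1⟩ := exists_factor_of_last_row hM (a := a) fun j => by
    rw [← ha]; rfl
  refine hcan γ hγ N hN hPN ?_
  rw [h1]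
  exact hmul _ (emb_mem_SpZ hγ1) _ hT (hemb _ hγ1) (hpar _ hT hT0)

end Generation

section Transformation

lemma hasSum_ser_lev {h : ℕ} {c : MatQ (h + 1) → ℂ} (hc : SuppIndex c) {τ : MatC (h + 1)}
    (hτ : imM τ ∈ Om c) : HasSum (fun m => ser (lev c m) τ) (ser c τ) := by
  have h1 := (hasSum_ser hτ).tsum_fiberwise fun t => ⌊t (Fin.last h) (Fin.last h)⌋₊
  refine h1.congr_fun fun m => ?_
  rw [tsum_subtype _ fun t => c t * eMat t τ]
  refine tsum_congr fun t => ?_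
  by_cases h0 : c t = 0
  · simp [Set.indicator, lev, h0]
  · obtain ⟨n, hn⟩ := (hc t h0).exists_level
    by_cases hm : n = m <;> simp [Set.indicator, lev, hn, hm]

lemma jmat_trE (S : Matrix (Fin g) (Fin g) ℤ) (τ : MatC g) : jmat (trE S) τ = 1 := by
  have h1 : blkC (trE S) = 0 := by ext; simp [blkC, trE]
  have h2 : blkD (trE S) = 1 := by ext; simp [blkD, trE, Matrix.one_apply, apply_ite]
  rw [jmat, h1, h2]; simp

lemma actSp_trE (S : Matrix (Fin g) (Fin g) ℤ) (τ : MatC g) :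
    actSp (trE S) τ = τ + S.map fun z => (z : ℂ) := by
  have h1 : blkA (trE S) = 1 := by ext; simp [blkA, trE, Matrix.one_apply, apply_ite]
  have h2 : blkB (trE S) = S.map fun z => (z : ℂ) := by ext; simp [blkB, trE]
  rw [actSp, jmat_trE, h1, h2]; simp

lemma jmat_glE (u : Matrix (Fin g) (Fin g) ℤ) (τ : MatC g) :
    jmat (glE u) τ = ((u⁻¹)ᵀ.map fun z => (z : ℂ)) := by
  have h1 : blkC (glE u) = 0 := by ext; simp [blkC, glE]
  have h2 : blkD (glE u) = ((u⁻¹)ᵀ.map fun z => (z : ℂ)) := by ext; simp [blkD, glE]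
  rw [jmat, h1, h2]; simp

lemma map_intCast_mul_of_mul_eq_one {R : Type*} [CommRing R] {u v : Matrix (Fin g) (Fin g) ℤ}
    (h : u * v = 1) : (u.map fun z => (z : R)) * (v.map fun z => (z : R)) = 1 := by
  have := congrArg (Int.castRingHom R).mapMatrix h
  rwa [map_mul, map_one] at this

lemma actSp_glE {u : Matrix (Fin g) (Fin g) ℤ} (hu : IsUnit u.det) {τ : MatC g}
    (hτ : τ ∈ Sieg g) :
    actSp (glE u) τ = (u.map fun z => (z : ℂ)) * τ * (u.map fun z => (z : ℂ))ᵀ := by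
  refine actSp_eq (isUnit_jmat (glE_mem hu) hτ) ?_
  have h1 : blkA (glE u) = u.map fun z => (z : ℂ) := by ext; simp [blkA, glE]
  have h2 : blkB (glE u) = 0 := by ext; simp [blkB, glE]
  have h3 : (u.map fun z => (z : ℂ))ᵀ * ((u⁻¹)ᵀ.map fun z => (z : ℂ)) = 1 := by
    rw [← transpose_map]
    refine map_intCast_mul_of_mul_eq_one ?_
    rw [← transpose_mul, nonsing_inv_mul _ hu, transpose_one]
  rw [jmat_glE, nmat, h1, h2, Matrix.mul_assoc, h3, Matrix.mul_one, add_zero]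

lemma jden_glE {u : Matrix (Fin g) (Fin g) ℤ} (hu : IsUnit u.det) (τ : MatC g) :
    jden (glE u) τ = ((u.det : ℚ) : ℂ) := by
  have h1 : ((u⁻¹)ᵀ.map fun z => (z : ℂ)).det = (((u⁻¹)ᵀ.det : ℤ) : ℂ) :=
    ((Int.castRingHom ℂ).map_det _).symm
  have h2 : (u⁻¹)ᵀ.det = u.det := by
    have h3 : (u⁻¹)ᵀ.det * u.det = 1 := by
      rw [det_transpose, ← det_mul, nonsing_inv_mul _ hu, det_one]
    rcases Int.isUnit_iff.mp hu with h | h <;> rw [h] at h3 ⊢ <;> linarith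
  rw [jden, jmat_glE, h1, h2]
  simp

lemma eq_trE_mul_glE {γ : MatZ2 g} (hγ : γ ∈ SpZ g) (h0 : γ.toBlocks₂₁ = 0) :
    ∃ S u, S.IsSymm ∧ IsUnit u.det ∧ γ = trE S * glE u := by
  obtain ⟨a, b, c, d, rfl⟩ := exists_eq_fromBlocks γ
  obtain rfl : c = 0 := by simpa using h0
  obtain ⟨-, h1, h2⟩ := fromBlocks_mem_SpZ.mp hγ
  have h1' : aᵀ * d = 1 := by simpa using h1
  have h3 : dᵀ * a = 1 := by simpa using congrArg transpose h1'
  have h3' : a * dᵀ = 1 := mul_eq_one_comm.mp h3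
  have hu : IsUnit a.det := by
    have := congrArg Matrix.det h3'
    rw [det_mul, det_one] at this
    exact IsUnit.of_mul_eq_one _ this
  have h4 : d * aᵀ = 1 := mul_eq_one_comm.mp h1'
  have hinv : (a⁻¹)ᵀ = d := by
    rw [inv_eq_left_inv h3, transpose_transpose]
  refine ⟨b * aᵀ, a, ?_, hu, ?_⟩
  · have h5 : a * bᵀ * (d * aᵀ) = a * dᵀ * b * aᵀ := by
      rw [Matrix.mul_assoc, ← Matrix.mul_assoc bᵀ, h2]
      simp only [Matrix.mul_assoc]
    rw [h4, h3', Matrix.mul_one, Matrix.one_mul] at h5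
    rw [IsSymm, transpose_mul, transpose_transpose, h5]
  · rw [trE, glE, fromBlocks_multiply, hinv]
    simp [Matrix.mul_assoc, h1']

lemma exists_int_sum_of_symm : ∀ {n : ℕ} {f : Fin n → Fin n → ℚ}, (∀ i j, f i j = f j i) →
    (∀ i j, ∃ z : ℤ, 2 * f i j = z) → (∀ i, ∃ z : ℤ, f i i = z) → ∃ z : ℤ, ∑ i, ∑ j, f i j = z
  | 0, _, _, _, _ => ⟨0, by simp⟩
  | n + 1, f, h1, h2, h3 => by
    obtain ⟨z, hz⟩ := exists_int_sum_of_symm (f := fun i j => f i.succ j.succ)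
      (fun i j => h1 _ _) (fun i j => h2 _ _) (fun i => h3 _)
    obtain ⟨w, hw⟩ := h3 0
    choose y hy using fun j : Fin n => h2 0 j.succ
    refine ⟨w + ∑ j, y j + z, ?_⟩
    simp only [Fin.sum_univ_succ, Finset.sum_add_distrib]
    rw [hz, hw]
    push_cast
    simp only [← hy, ← Finset.mul_sum, fun j : Fin n => h1 j.succ 0]
    ring

lemma eMat_add_int {t : MatQ g} (ht : HalfIntegral t) {S : Matrix (Fin g) (Fin g) ℤ}
    (hS : S.IsSymm) (τ : MatC g) : eMat t (τ + S.map fun z => (z : ℂ)) = eMat t τ := by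
  obtain ⟨z, hz⟩ := exists_int_sum_of_symm (f := fun i j => t i j * (S i j : ℚ))
    (fun i j => by rw [ht.1.apply i j, hS.apply i j])
    (fun i j => by
      obtain ⟨z, hz⟩ := ht.2.1 i j
      exact ⟨z * S i j, by push_cast; rw [← hz]; ring⟩)
    (fun i => by
      obtain ⟨z, hz⟩ := ht.2.2 i
      exact ⟨z * S i i, by push_cast; rw [← hz]⟩)
  have h1 : ((t.map fun q => (q : ℂ)) * S.map fun z => (z : ℂ)).trace = (z : ℂ) := by
    have h2 : ((∑ i, ∑ j, t i j * (S i j : ℚ) : ℚ) : ℂ) = ((z : ℚ) : ℂ) := by rw [hz]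
    push_cast at h2
    rw [← h2, Matrix.trace]
    refine Finset.sum_congr rfl fun i _ => ?_
    rw [diag_apply, Matrix.mul_apply]
    exact Finset.sum_congr rfl fun j _ => by simp [hS.apply i j]
  rw [eMat, eMat, Matrix.mul_add, trace_add, h1, mul_add, Complex.exp_add,
    show 2 * (Real.pi : ℂ) * Complex.I * (z : ℂ) = z * (2 * Real.pi * Complex.I) by ring,
    Complex.exp_int_mul_two_pi_mul_I, mul_one]

lemma eMat_congr (u : Matrix (Fin g) (Fin g) ℤ) (t : MatQ g) (τ : MatC g) :
    eMat ((u.map fun z => (z : ℚ))ᵀ * t * (u.map fun z => (z : ℚ))) τ =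
      eMat t (u.map (fun z => (z : ℂ)) * τ * (u.map fun z => (z : ℂ))ᵀ) := by
  have h1 : (((u.map fun z => (z : ℚ))ᵀ * t * (u.map fun z => (z : ℚ))).map fun q : ℚ => (q : ℂ)) =
      (u.map fun z => (z : ℂ))ᵀ * (t.map fun q : ℚ => (q : ℂ)) * u.map fun z => (z : ℂ) := by
    have h2 : ∀ A B C : MatQ g, (A * B * C).map (Rat.castHom ℂ) =
        A.map (Rat.castHom ℂ) * B.map (Rat.castHom ℂ) * C.map (Rat.castHom ℂ) := fun A B C => by
      rw [Matrix.map_mul, Matrix.map_mul]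
    refine (h2 _ _ _).trans (congrArg₂ _ (congrArg₂ _ ?_ rfl) ?_)
    · ext i j; simp
    · ext i j; simp
  rw [eMat, eMat, h1, Matrix.mul_assoc, Matrix.mul_assoc, trace_mul_comm]
  simp only [Matrix.mul_assoc]

variable {h : ℕ} {k : ℤ} {c : MatQ (h + 1) → ℂ}

/-- An everywhere convergent symmetric formal Fourier-Jacobi series is modular. -/
theorem ser_actSp (hh : 1 ≤ h) (hc : IsSymFM h 1 k c) (hO : ∀ Y, PD Y → Y ∈ Om c)
    {γ : MatZ2 (h + 1)} (hγ : γ ∈ SpZ (h + 1)) :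
    ∀ τ ∈ Sieg (h + 1), ser c (actSp γ τ) = jden γ τ ^ k * ser c τ := by
  have hmul : ∀ γ ∈ SpZ (h + 1), ∀ γ' ∈ SpZ (h + 1),
      (∀ τ ∈ Sieg (h + 1), ser c (actSp γ τ) = jden γ τ ^ k * ser c τ) →
      (∀ τ ∈ Sieg (h + 1), ser c (actSp γ' τ) = jden γ' τ ^ k * ser c τ) →
      ∀ τ ∈ Sieg (h + 1), ser c (actSp (γ * γ') τ) = jden (γ * γ') τ ^ k * ser c τ := by
    intro γ hγ γ' hγ' H H' τ hτ
    rw [actSp_mul hγ hγ' hτ, H _ (actSp_mem_Sieg hγ' hτ), H' τ hτ, jden_mul _ hγ' hτ, mul_zpow,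
      mul_assoc]
  refine SpZ_induction hh hmul ?_ ?_ ?_ hγ
  · intro γ hγ γ' hγ' H' H τ hτ
    obtain ⟨δ, hδ, -, h1⟩ := exists_inv_SpZ hγ'
    have hσ := actSp_mem_Sieg hδ hτ
    have h2 : actSp γ' (actSp δ τ) = τ := by rw [← actSp_mul hγ' hδ hτ, h1, actSp_one]
    have h3 := H _ hσ
    have h4 := H' _ hσ
    rw [h2] at h4
    rw [actSp_mul hγ hγ' hσ, jden_mul _ hγ' hσ, h2] at h3
    rw [h3, h4, mul_zpow, mul_assoc]
  · intro γ hγ h0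
    obtain ⟨S, u, hS, hu, rfl⟩ := eq_trE_mul_glE hγ h0
    refine hmul _ (trE_mem hS) _ (glE_mem hu) (fun τ _ => ?_) fun τ hτ => ?_
    · rw [actSp_trE, jden, jmat_trE, det_one, _root_.one_zpow, one_mul]
      refine tsum_congr fun t => ?_
      by_cases ht : c t = 0
      · simp [ht]
      · rw [eMat_add_int (hc.1 t ht).1 hS]
    · rw [actSp_glE hu hτ, jden_glE hu, ser, ser, ← tsum_mul_left,
        ← (congrEquiv _ (isUnit_det_map (R := ℚ) hu)).tsum_eq fun t => _ * (c t * eMat t τ)]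
      refine tsum_congr fun t => ?_
      change _ = _ * (c ((u.map fun z => (z : ℚ))ᵀ * t * (u.map fun z => (z : ℚ))) *
        eMat ((u.map fun z => (z : ℚ))ᵀ * t * (u.map fun z => (z : ℚ))) τ)
      rw [eMat_congr, ← mul_assoc, ← hc.2.1 u hu t]
  · intro γ hγ τ hτ
    have hs : SuppIndex c := hc.1
    have h1 := hasSum_ser_lev hs (hO _ (mem_Sieg_iff.mp hτ).2)
    have h2 := hasSum_ser_lev hs
      (hO _ (mem_Sieg_iff.mp (actSp_mem_Sieg (emb_mem_SpZ hγ) hτ)).2)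
    simp only [ser_lev_actSp_emb hc hγ hτ] at h2
    exact h2.unique (h1.mul_left _)

end Transformation

section Reduction

open MeasureTheory

/-- Minkowski's theorem for the sup norm and a unimodular real matrix. -/
lemma exists_int_abs_mulVec_lt {ι : Type*} [Fintype ι] [DecidableEq ι] [Nonempty ι]
    {M : Matrix ι ι ℝ} (hM : M.det = 1) :
    ∃ v : ι → ℤ, v ≠ 0 ∧ ∀ i, |(M *ᵥ fun j => (v j : ℝ)) i| < 2 := by
  set b := Pi.basisFun ℝ ι
  set s : Set (ι → ℝ) := (Matrix.toLin' M) ⁻¹' Metric.ball 0 2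
  have hdet : LinearMap.det (Matrix.toLin' M) = 1 := by rw [LinearMap.det_toLin', hM]
  have hvol : volume s = ENNReal.ofReal ((2 * 2) ^ Fintype.card ι) := by
    rw [Measure.addHaar_preimage_linearMap _ (by rw [hdet]; exact one_ne_zero), hdet,
      Real.volume_pi_ball _ two_pos]
    simp
  have hfund : volume (ZSpan.fundamentalDomain b) = 1 := by
    rw [ZSpan.volume_fundamentalDomain]
    have : (Matrix.of fun i => b i) = (1 : Matrix ι ι ℝ) := by
      ext i j
      simp [b, Matrix.one_apply, Pi.single_apply, eq_comm]
    rw [this]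
    simp
  have : Countable (Submodule.span ℤ (Set.range b)).toAddSubgroup :=
    inferInstanceAs (Countable (Submodule.span ℤ (Set.range b)))
  obtain ⟨x, hx0, hx⟩ := exists_ne_zero_mem_lattice_of_measure_mul_two_pow_lt_measure
    (μ := volume) (ZSpan.isAddFundamentalDomain' b volume) (s := s)
    (fun x hx => by simpa [s, mulVec_neg] using hx)
    ((convex_ball 0 2).linear_preimage (Matrix.toLin' M)) (by
      rw [hfund, hvol, one_mul, Module.finrank_fintype_fun_eq_card,
        ENNReal.ofReal_pow (by norm_num)]
      refine ENNReal.pow_lt_pow_left Fintype.card_ne_zero ?_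
      rw [← ENNReal.ofReal_ofNat 2]
      exact (ENNReal.ofReal_lt_ofReal_iff (by norm_num)).mpr (by norm_num))
  have hint := (Module.Basis.mem_span_iff_repr_mem ℤ b (x : ι → ℝ)).mp x.2
  choose v hv using hint
  have hv' : (fun j => (v j : ℝ)) = (x : ι → ℝ) := by
    funext j
    simpa [b] using hv j
  refine ⟨v, fun h0 => hx0 (Subtype.ext ?_), fun i => ?_⟩
  · rw [← hv', h0]; ext; simp
  · rw [hv']
    have h1 : ‖M *ᵥ (x : ι → ℝ)‖ < 2 := by simpa [s] using hx
    exact (norm_le_pi_norm (M *ᵥ (x : ι → ℝ)) i).trans_lt h1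

lemma dotProduct_self_le_of_abs_lt {p : Fin g → ℝ} (hp : ∀ i, |p i| < 2) :
    p ⬝ᵥ p ≤ 4 * g := by
  calc p ⬝ᵥ p ≤ ∑ _i : Fin g, (4 : ℝ) := Finset.sum_le_sum fun i _ => by
        nlinarith [abs_lt.mp (hp i)]
    _ = 4 * g := by simp [mul_comm]

lemma sq_dotProduct_le (p q : Fin g → ℝ) : (p ⬝ᵥ q) ^ 2 ≤ (p ⬝ᵥ p) * (q ⬝ᵥ q) := by
  have := Finset.sum_mul_sq_le_sq_mul_sq Finset.univ p q
  simpa [dotProduct, sq] using this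

lemma re_dotProduct (u w : Fin g → ℂ) :
    (u ⬝ᵥ w).re = (fun i => (u i).re) ⬝ᵥ (fun i => (w i).re) -
      (fun i => (u i).im) ⬝ᵥ fun i => (w i).im := by
  simp [dotProduct, ← Finset.sum_sub_distrib]

variable {h : ℕ}

/-- Every point of the Siegel upper half space is equivalent to one whose imaginary part is
bounded below in the last variable. -/
lemma exists_sq_last_le {τ : MatC (h + 1)} (hτ : τ ∈ Sieg (h + 1)) :
    ∃ γ ∈ SpZ (h + 1), ∀ x : Fin (h + 1) → ℝ,
      x (Fin.last h) ^ 2 ≤ 16 * (h + 1) * qf (imM (actSp γ τ)) x := by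
  obtain ⟨hs, hpos⟩ := hτ
  obtain ⟨B, hB⟩ := exists_gram hpos.posSemidef
  change imM τ = Bᵀ * B at hB
  have hBu : IsUnit B.det := by
    have h1 : 0 < (imM τ).det := hpos.det_pos
    rw [hB, det_mul] at h1
    exact (right_ne_zero_of_mul h1.ne').isUnit
  have hBu' : IsUnit Bᵀ.det := by rwa [det_transpose]
  set X : MatR (h + 1) := τ.map Complex.re with hX
  have hM : (fromBlocks B 0 (Bᵀ⁻¹ * X) Bᵀ⁻¹).det = 1 := by
    rw [det_fromBlocks_zero₁₂, ← det_transpose B, ← det_mul, mul_nonsing_inv _ hBu', det_one]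
  obtain ⟨v, hv0, hv⟩ := exists_int_abs_mulVec_lt hM
  set c : Fin (h + 1) → ℝ := fun j => (v (Sum.inl j) : ℝ) with hc
  set d : Fin (h + 1) → ℝ := fun j => (v (Sum.inr j) : ℝ) with hd
  have hcd : (fun j => (v j : ℝ)) = Sum.elim c d := by
    funext j; rcases j with j | j <;> rfl
  rw [hcd, fromBlocks_mulVec] at hv
  set p : Fin (h + 1) → ℝ := B *ᵥ c with hp
  set q : Fin (h + 1) → ℝ := Bᵀ⁻¹ *ᵥ (X *ᵥ c + d) with hq
  have hpp : p ⬝ᵥ p ≤ 4 * (h + 1) := by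
    refine (dotProduct_self_le_of_abs_lt fun i => ?_).trans (by push_cast; rfl)
    simpa using hv (Sum.inl i)
  have hqq : q ⬝ᵥ q ≤ 4 * (h + 1) := by
    refine (dotProduct_self_le_of_abs_lt fun i => ?_).trans (by push_cast; rfl)
    simpa [hq, mulVec_add] using hv (Sum.inr i)
  obtain ⟨γ0, hγ0, -, a, ha⟩ := exists_symplectic_vecMul (P := fun _ => True)
    (fun _ _ _ _ _ _ => trivial) (fun _ _ _ => trivial) (0 : Fin (h + 1)) trivial (Fin.last h) v
  obtain ⟨γ, hγ, -, hγ1⟩ := exists_inv_SpZ hγ0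
  have hva : v = Pi.single (Sum.inr (Fin.last h)) a ᵥ* γ := by
    rw [← ha, vecMul_vecMul, hγ1, vecMul_one]
  have hva' : ∀ j, v j = a * γ (Sum.inr (Fin.last h)) j := fun j => by
    rw [hva, single_vecMul]; rfl
  have ha0 : a ≠ 0 := by
    rintro rfl
    exact hv0 (funext fun j => by simp [hva'])
  refine ⟨γ, hγ, fun x => ?_⟩
  have hu := isUnit_jmat hγ ⟨hs, hpos⟩
  set w : Fin (h + 1) → ℂ := (jmat γ τ)⁻¹ *ᵥ fun i => (x i : ℂ) with hw
  have hjw : jmat γ τ *ᵥ w = fun i => (x i : ℂ) := by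
    rw [hw, mulVec_mulVec, mul_nonsing_inv _ hu, one_mulVec]
  rw [qf_imM_actSp hγ ⟨hs, hpos⟩ hjw]
  set y : Fin (h + 1) → ℝ := fun i => (w i).re
  set z : Fin (h + 1) → ℝ := fun i => (w i).im
  set u : Fin (h + 1) → ℂ := fun j => (a : ℂ) * jmat γ τ (Fin.last h) j with hu'
  have hu1 : ∀ j, u j = (∑ i, (c i : ℂ) * τ i j) + (d j : ℂ) := fun j => by
    simp [hu', jmat, Matrix.add_apply, Matrix.mul_apply, blkC, blkD, hc, hd, hva', mul_add,
      Finset.mul_sum, mul_assoc]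
  have hre : (fun j => (u j).re) = Bᵀ *ᵥ q := by
    rw [hq, mulVec_mulVec, mul_nonsing_inv _ hBu', one_mulVec]
    funext j
    simp [hu1, hX, mulVec, dotProduct, hs.apply j, mul_comm]
  have him : (fun j => (u j).im) = Bᵀ *ᵥ p := by
    rw [hp, mulVec_mulVec, ← hB]
    funext j
    simp [hu1, imM, mulVec, dotProduct, hs.apply j, mul_comm]
  have h1 : (a : ℝ) * x (Fin.last h) = q ⬝ᵥ B *ᵥ y - p ⬝ᵥ B *ᵥ z := by
    have h2 : u ⬝ᵥ w = (a : ℂ) * x (Fin.last h) := by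
      rw [← congrFun hjw (Fin.last h)]
      simp [hu', dotProduct, mulVec, Finset.mul_sum, mul_assoc]
    have h3 := re_dotProduct u w
    rw [h2, hre, him, mulVec_transpose, mulVec_transpose, ← dotProduct_mulVec,
      ← dotProduct_mulVec] at h3
    simpa using h3
  have hqf : ∀ y, qf (imM τ) y = (B *ᵥ y) ⬝ᵥ (B *ᵥ y) := fun y => by
    rw [qf, hB, ← mulVec_mulVec, dotProduct_mulVec, vecMul_transpose]
  have h2 := sq_dotProduct_le q (B *ᵥ y)
  have h3 := sq_dotProduct_le p (B *ᵥ z)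
  rw [← hqf y] at h2
  rw [← hqf z] at h3
  have hy : 0 ≤ qf (imM τ) y := by rw [hqf]; exact dotProduct_self_nonneg_real _
  have hz : 0 ≤ qf (imM τ) z := by rw [hqf]; exact dotProduct_self_nonneg_real _
  have h4 : (1 : ℝ) ≤ (a : ℝ) ^ 2 := by
    have : 0 < a ^ 2 := by positivity
    exact_mod_cast this
  have h5 := mul_le_mul_of_nonneg_right hqq hy
  have h6 := mul_le_mul_of_nonneg_right hpp hz
  have h7 : (a : ℝ) ^ 2 * x (Fin.last h) ^ 2 ≤ 8 * (h + 1) * (qf (imM τ) y + qf (imM τ) z) := by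
    rw [← mul_pow, h1]
    nlinarith [sq_nonneg (q ⬝ᵥ B *ᵥ y + p ⬝ᵥ B *ᵥ z)]
  have h8 : 0 ≤ (h + 1 : ℝ) * (qf (imM τ) y + qf (imM τ) z) := by positivity
  nlinarith [mul_le_mul_of_nonneg_right h4 (sq_nonneg (x (Fin.last h)))]

lemma dotProduct_self_le_of_mem_Icc {l : Fin h → ℝ} (hl : ∀ i, l i ∈ Set.Icc (0 : ℝ) 1) :
    l ⬝ᵥ l ≤ h := by
  calc l ⬝ᵥ l ≤ ∑ _i : Fin h, (1 : ℝ) := Finset.sum_le_sum fun i _ => by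
        nlinarith [(hl i).1, (hl i).2]
    _ = h := by simp

lemma IsSchur.lower_bound {Y : MatR (h + 1)} {Y1 : MatR h} {l : Fin h → ℝ} {w c r : ℝ}
    (H : IsSchur Y Y1 l w) (hl : ∀ i, l i ∈ Set.Icc (0 : ℝ) 1)
    (hY1 : ∀ x, c * (x ⬝ᵥ x) ≤ qf Y1 x) (hr : r ≤ w) {ε : ℝ} (hε : 0 ≤ ε) (hεc : 2 * ε ≤ c)
    (hεr : ε * (2 * h + 1) ≤ r) (x : Fin (h + 1) → ℝ) : ε * (x ⬝ᵥ x) ≤ qf Y x := by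
  obtain ⟨v, s, rfl⟩ := snoc_surj x
  rw [H v s]
  have h1 := hY1 (v + s • l)
  set y := v + s • l
  have h2 : v ⬝ᵥ v ≤ 2 * (y ⬝ᵥ y) + 2 * (s ^ 2 * (l ⬝ᵥ l)) := by
    simp only [dotProduct, Finset.mul_sum, ← Finset.sum_add_distrib]
    refine Finset.sum_le_sum fun i _ => ?_
    simp only [y, Pi.add_apply, Pi.smul_apply, smul_eq_mul]
    nlinarith [sq_nonneg (v i + 2 * (s * l i))]
  have h3 : (Fin.snoc v s : Fin (h + 1) → ℝ) ⬝ᵥ Fin.snoc v s = v ⬝ᵥ v + s ^ 2 := by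
    simp [dotProduct, Fin.sum_univ_castSucc, sq]
  have h4 := mul_le_mul_of_nonneg_left (dotProduct_self_le_of_mem_Icc hl) (sq_nonneg s)
  have h5 : 0 ≤ y ⬝ᵥ y := dotProduct_self_nonneg_real _
  rw [h3]
  have h6 : v ⬝ᵥ v + s ^ 2 ≤ 2 * (y ⬝ᵥ y) + (2 * h + 1) * s ^ 2 := by nlinarith
  have h7 := mul_le_mul_of_nonneg_left h6 hε
  have h8 := mul_le_mul_of_nonneg_right hεc h5
  have h9 := mul_le_mul_of_nonneg_right (hεr.trans hr) (sq_nonneg s)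
  nlinarith

lemma imM_conj_intCast (u : Matrix (Fin g) (Fin g) ℤ) (τ : MatC g) :
    imM ((u.map fun z => (z : ℂ)) * τ * (u.map fun z => (z : ℂ))ᵀ) =
      (u.map fun z => (z : ℝ)) * imM τ * (u.map fun z => (z : ℝ))ᵀ := by
  ext i j
  simp [imM, Matrix.mul_apply]

/-- Every point of the Siegel upper half space is equivalent to one whose imaginary part is
uniformly bounded below. -/
theorem exists_reduction : ∀ h : ℕ, ∃ ε : ℝ, 0 < ε ∧ ∀ τ ∈ Sieg h, ∃ γ ∈ SpZ h, ∀ x,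
    ε * (x ⬝ᵥ x) ≤ qf (imM (actSp γ τ)) x
  | 0 => ⟨1, one_pos, fun τ _ => ⟨1, one_mem_SpZ, fun x => by simp [qf]⟩⟩
  | h + 1 => by
    obtain ⟨c, hc, H⟩ := exists_reduction h
    set r : ℝ := 1 / (32 * (h + 1)) with hr
    have hr0 : 0 < r := by positivity
    have hε : 0 < min (c / 2) (r / (2 * h + 1)) := lt_min (by positivity) (by positivity)
    refine ⟨_, hε, fun τ hτ => ?_⟩
    obtain ⟨γ1, hγ1, h1⟩ := exists_sq_last_le hτ
    have hτ1 := actSp_mem_Sieg hγ1 hτ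
    have hPD : PD (imM (actSp γ1 τ) - r • lastE h) := fun x hx => by
      have h2 := (mem_Sieg_iff.mp hτ1).2 x hx
      have h3 := mul_le_mul_of_nonneg_left (h1 x) hr0.le
      have h4 : r * (16 * (h + 1) * qf (imM (actSp γ1 τ)) x) = qf (imM (actSp γ1 τ)) x / 2 := by
        rw [hr]; field_simp; ring
      obtain ⟨v, s, rfl⟩ := snoc_surj x
      rw [h4, Fin.snoc_last] at h3
      rw [qf_sub, qf_smul, qf_lastE, Fin.snoc_last]
      linarith
    obtain ⟨γ2, hγ2, h2⟩ := H _ (topBlk_mem_Sieg_of_mem hτ1)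
    have hτ2 := actSp_mem_Sieg (emb_mem_SpZ hγ2) hτ1
    have hPD2 := PD_sub_lastE_emb hγ2 hτ1 hPD
    rw [← topBlk_actSp_emb hγ2 hτ1] at h2
    set τ2 := actSp (emb γ2) (actSp γ1 τ)
    obtain ⟨l, w, hl⟩ := exists_isSchur (mem_Sieg_iff.mp hτ2).2.topBlk
    have hsh := isUnit_det_shear fun i => -⌊l i⌋
    refine ⟨glE (shear fun i => -⌊l i⌋) * (emb γ2 * γ1),
      mul_mem_SpZ (glE_mem hsh) (mul_mem_SpZ (emb_mem_SpZ hγ2) hγ1), ?_⟩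
    rw [actSp_mul (glE_mem hsh) (mul_mem_SpZ (emb_mem_SpZ hγ2) hγ1) hτ,
      actSp_mul (emb_mem_SpZ hγ2) hγ1 hτ, actSp_glE hsh hτ2, imM_conj_intCast]
    refine (hl.shear _).lower_bound (c := c) (fun i => ?_) h2 (hl.lt hPD2).le hε.le ?_ ?_
    · push_cast
      exact ⟨by linarith [Int.floor_le (l i)], by linarith [Int.lt_floor_add_one (l i)]⟩
    · linarith [min_le_left (c / 2) (r / (2 * h + 1))]
    · exact (le_div_iff₀ (by positivity)).mp (min_le_right _ _)

end Reduction

section Holomorphy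

open Filter Topology

lemma isOpen_setOf_PD_imM : IsOpen {Z : MatC g | PD (imM Z)} := by
  refine isOpen_iff_mem_nhds.mpr fun Z0 hZ0 => ?_
  obtain ⟨ε, hε, h1⟩ := PD.sub_smul_one hZ0
  filter_upwards [eventually_imM_ge Z0 hε] with Z hZ x hx
  have h2 := hZ x
  rw [qf_sub] at h2
  linarith [h1 x hx]

lemma SiegelMF.Nonzero.coeff_ne_zero {k : ℤ} {f : SiegelMF g k} (hf : f.Nonzero) :
    f.coeff ≠ 0 := fun h0 => by
  obtain ⟨τ, hτ, h1⟩ := hf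
  have h2 := f.expansion τ hτ
  rw [h0] at h2
  simp only [Pi.zero_apply, zero_mul] at h2
  exact h1 (h2.unique hasSum_zero)

end Holomorphy

theorem siegel_algebraically_closed_in_symFM
    {h : ℕ} (hh : 1 ≤ h) (k k0 : ℤ) (d : ℕ)
    (a : (i : Fin (d + 1)) → SiegelMF (h + 1) (k0 + ((d : ℤ) - ((i : ℕ) : ℤ)) * k))
    (hQne : ∃ i, (a i).Nonzero)             -- the polynomial relation is nonzero
    (c : MatQ (h + 1) → ℂ) (hc : IsSymFM h 1 k c)
    (hrel : ∀ t, (∑ i : Fin (d + 1), convC (a i).coeff (powC c i) t) = 0) :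
    ∃ F : SiegelMF (h + 1) k, F.coeff = c := by
  obtain ⟨ε, hε, hred⟩ := exists_reduction h
  have hO : ∀ Y, PD Y → Y ∈ Om c := fun Y hY =>
    mem_Om_of_PD hh hc (half_pos hε) (half_lt_self hε) hred
      (fun p0 hp0 => exists_local_bound (b := fun i => (a i).coeff) (fun i => (a i).suppIndex)
        (fun i _ => (a i).mem_Om) (hQne.imp fun _ hi => hi.coeff_ne_zero) hc.1 hc.levSummable hrel
        hp0) hY
  have hS : ∀ τ ∈ Sieg (h + 1), imM τ ∈ Om c := fun τ hτ => hO _ (mem_Sieg_iff.mp hτ).2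
  exact ⟨{
    toFun := ser c
    coeff := c
    holo := (differentiableOn_ser hc.1 isOpen_setOf_PD_imM fun Z => hO (imM Z)).mono
      fun τ hτ => (mem_Sieg_iff.mp hτ).2
    transf := fun _ hγ => ser_actSp hh hc hO hγ
    supp := hc.1
    expansion := fun τ hτ => hasSum_ser (hS τ hτ) }, rfl⟩

end
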